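/- For every δ ∈ (0,1) and every R > 2M there is a constant C = C(M, δ, R) > 0 such that: for every spherically symmetric solution φ of the wave equation on the exterior of the Schwarzschild spacetime of mass M with E₂(φ) < ∞, and for all t ≥ 1 and all s ∈ ℝ with r(s) ≤ R, one has |φ(t,s)| ≤ C · (max{(t+s)/2, 1})^{−3/2+δ} · E₂(φ)^{1/2}. -/

import Mathlib

open Real MeasureTheory

noncomputable section

/-- partial derivative in the first (time) variable -/
def pd_t (φ : ℝ → ℝ → ℝ) : ℝ → ℝ → ℝ := fun t s => deriv (fun t' => φ t' s) t

/-- partial derivative in the second (tortoise) variable -/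
def pd_s (φ : ℝ → ℝ → ℝ) : ℝ → ℝ → ℝ := fun t s => deriv (fun s' => φ t s') s

/-- the scaling vector field `S ξ = t ∂_t ξ + s ∂_s ξ` -/
def Svf (φ : ℝ → ℝ → ℝ) : ℝ → ℝ → ℝ := fun t s => t * pd_t φ t s + s * pd_s φ t s

/-- `r` is the Schwarzschild area-radius of mass `M` in the Regge-Wheeler tortoise
coordinate: `r(s) > 2M`, `r' = 1 - 2M/r`, `r(0) = 3M`. -/
def IsTortoise (M : ℝ) (r : ℝ → ℝ) : Prop :=
  (∀ s, 2 * M < r s) ∧ (∀ s, HasDerivAt r (1 - 2 * M / r s) s) ∧ r 0 = 3 * M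

/-- `μ(s) = 2M / r(s)` -/
def muS (M : ℝ) (r : ℝ → ℝ) (s : ℝ) : ℝ := 2 * M / r s

/-- a spherically symmetric solution of the wave equation on the exterior of the
Schwarzschild spacetime: smooth, satisfying `∂_t²φ = r⁻² ∂_s(r² ∂_s φ)`, and supported
away from spatial infinity. -/
def IsWaveSol (r : ℝ → ℝ) (φ : ℝ → ℝ → ℝ) : Prop :=
  ContDiff ℝ (⊤ : ℕ∞) (Function.uncurry φ) ∧
  (∀ t s, pd_t (pd_t φ) t s = ((r s) ^ 2)⁻¹ * deriv (fun x => (r x) ^ 2 * pd_s φ t x) s) ∧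
  ∃ S₀ : ℝ, ∀ t s, S₀ + |t - 1| ≤ s → φ t s = 0

/-- the integrand of the initial energy `E₀(ξ)`, evaluated on the slice `t = 1`. -/
def E0Integrand (M : ℝ) (r : ℝ → ℝ) (ξ : ℝ → ℝ → ℝ) (s : ℝ) : ℝ :=
  ((1 - muS M r s)⁻¹ * (pd_t ξ 1 s - pd_s ξ 1 s) ^ 2
    + (pd_t ξ 1 s + pd_s ξ 1 s) ^ 2
    + ((1 - s) / 2) ^ 2 * (pd_t ξ 1 s - pd_s ξ 1 s) ^ 2
    + ((1 + s) / 2) ^ 2 * (pd_t ξ 1 s + pd_s ξ 1 s) ^ 2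
    + (1 - muS M r s) * ((1 + s ^ 2) / (r s) ^ 2) * (ξ 1 s) ^ 2) * (r s) ^ 2

/-- the initial energy `E₀(ξ)` -/
def E0 (M : ℝ) (r : ℝ → ℝ) (ξ : ℝ → ℝ → ℝ) : ℝ := ∫ s, E0Integrand M r ξ s

/-- `E₀(ξ) < ∞` : the (nonnegative) integrand of `E₀(ξ)` is integrable -/
def FinE0 (M : ℝ) (r : ℝ → ℝ) (ξ : ℝ → ℝ → ℝ) : Prop := Integrable (E0Integrand M r ξ)

/-- `E₁(ξ) = E₀(Sξ) + E₀(ξ) + E₀(∂_t ξ)` -/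
def E1 (M : ℝ) (r : ℝ → ℝ) (ξ : ℝ → ℝ → ℝ) : ℝ :=
  E0 M r (Svf ξ) + E0 M r ξ + E0 M r (pd_t ξ)

/-- `E₁(ξ) < ∞` -/
def FinE1 (M : ℝ) (r : ℝ → ℝ) (ξ : ℝ → ℝ → ℝ) : Prop :=
  FinE0 M r (Svf ξ) ∧ FinE0 M r ξ ∧ FinE0 M r (pd_t ξ)

/-- `E₂(ξ) = E₁(ξ) + E₁(∂_t ξ) + E₁(∂_t² ξ)` -/
def E2 (M : ℝ) (r : ℝ → ℝ) (ξ : ℝ → ℝ → ℝ) : ℝ :=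
  E1 M r ξ + E1 M r (pd_t ξ) + E1 M r (pd_t (pd_t ξ))

/-- `E₂(ξ) < ∞` -/
def FinE2 (M : ℝ) (r : ℝ → ℝ) (ξ : ℝ → ℝ → ℝ) : Prop :=
  FinE1 M r ξ ∧ FinE1 M r (pd_t ξ) ∧ FinE1 M r (pd_t (pd_t ξ))


/-- smooth functions of two variables -/
def Sm (ξ : ℝ → ℝ → ℝ) : Prop := ContDiff ℝ (⊤ : ℕ∞) (Function.uncurry ξ)

lemma Sm.differentiable {ξ : ℝ → ℝ → ℝ} (h : Sm ξ) : Differentiable ℝ (Function.uncurry ξ) :=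
  ContDiff.differentiable h (by simp)

lemma Sm.has_t {ξ : ℝ → ℝ → ℝ} (h : Sm ξ) (t s : ℝ) :
    HasDerivAt (fun t' => ξ t' s) (fderiv ℝ (Function.uncurry ξ) (t, s) (1, 0)) t := by
  have h1 := (h.differentiable (t, s)).hasFDerivAt
  have h2 : HasDerivAt (fun t' : ℝ => (t', s)) ((1 : ℝ), (0 : ℝ)) t :=
    (hasDerivAt_id t).prodMk (hasDerivAt_const t s)
  exact h1.comp_hasDerivAt t h2

lemma Sm.has_s {ξ : ℝ → ℝ → ℝ} (h : Sm ξ) (t s : ℝ) :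
    HasDerivAt (fun s' => ξ t s') (fderiv ℝ (Function.uncurry ξ) (t, s) (0, 1)) s := by
  have h1 := (h.differentiable (t, s)).hasFDerivAt
  have h2 : HasDerivAt (fun s' : ℝ => (t, s')) ((0 : ℝ), (1 : ℝ)) s :=
    (hasDerivAt_const s t).prodMk (hasDerivAt_id s)
  exact h1.comp_hasDerivAt s h2

lemma Sm.pd_t_eq {ξ : ℝ → ℝ → ℝ} (h : Sm ξ) (t s : ℝ) :
    pd_t ξ t s = fderiv ℝ (Function.uncurry ξ) (t, s) (1, 0) := (h.has_t t s).deriv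

lemma Sm.pd_s_eq {ξ : ℝ → ℝ → ℝ} (h : Sm ξ) (t s : ℝ) :
    pd_s ξ t s = fderiv ℝ (Function.uncurry ξ) (t, s) (0, 1) := (h.has_s t s).deriv

lemma Sm.dt {ξ : ℝ → ℝ → ℝ} (h : Sm ξ) (t s : ℝ) :
    HasDerivAt (fun t' => ξ t' s) (pd_t ξ t s) t := by
  rw [h.pd_t_eq]; exact h.has_t t s

lemma Sm.ds {ξ : ℝ → ℝ → ℝ} (h : Sm ξ) (t s : ℝ) :
    HasDerivAt (fun s' => ξ t s') (pd_s ξ t s) s := by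
  rw [h.pd_s_eq]; exact h.has_s t s

lemma Sm.fderiv_sm {ξ : ℝ → ℝ → ℝ} (h : Sm ξ) :
    ContDiff ℝ (⊤ : ℕ∞) (fderiv ℝ (Function.uncurry ξ)) :=
  ContDiff.fderiv_right h (by simp)

lemma Sm.pd_t {ξ : ℝ → ℝ → ℝ} (h : Sm ξ) : Sm (pd_t ξ) := by
  have : Function.uncurry (_root_.pd_t ξ) =
      fun z : ℝ × ℝ => fderiv ℝ (Function.uncurry ξ) z ((1 : ℝ), (0 : ℝ)) := by
    funext z; exact h.pd_t_eq z.1 z.2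
  unfold Sm
  rw [this]
  exact h.fderiv_sm.clm_apply contDiff_const

lemma Sm.pd_s {ξ : ℝ → ℝ → ℝ} (h : Sm ξ) : Sm (pd_s ξ) := by
  have : Function.uncurry (_root_.pd_s ξ) =
      fun z : ℝ × ℝ => fderiv ℝ (Function.uncurry ξ) z ((0 : ℝ), (1 : ℝ)) := by
    funext z; exact h.pd_s_eq z.1 z.2
  unfold Sm
  rw [this]
  exact h.fderiv_sm.clm_apply contDiff_const

lemma Sm.comm {ξ : ℝ → ℝ → ℝ} (h : Sm ξ) : _root_.pd_s (_root_.pd_t ξ) = _root_.pd_t (_root_.pd_s ξ) := by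
  funext t s
  have hd : DifferentiableAt ℝ (fderiv ℝ (Function.uncurry ξ)) (t, s) :=
    (h.fderiv_sm.differentiable (by simp)) _
  have e1 : _root_.pd_s (_root_.pd_t ξ) t s =
      fderiv ℝ (fderiv ℝ (Function.uncurry ξ)) (t, s) (0, 1) (1, 0) := by
    rw [h.pd_t.pd_s_eq]
    have : Function.uncurry (_root_.pd_t ξ) =
        fun z : ℝ × ℝ => fderiv ℝ (Function.uncurry ξ) z ((1 : ℝ), (0 : ℝ)) := by
      funext z; exact h.pd_t_eq z.1 z.2
    rw [this, fderiv_clm_apply hd (differentiableAt_const _)]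
    simp
  have e2 : _root_.pd_t (_root_.pd_s ξ) t s =
      fderiv ℝ (fderiv ℝ (Function.uncurry ξ)) (t, s) (1, 0) (0, 1) := by
    rw [h.pd_s.pd_t_eq]
    have : Function.uncurry (_root_.pd_s ξ) =
        fun z : ℝ × ℝ => fderiv ℝ (Function.uncurry ξ) z ((0 : ℝ), (1 : ℝ)) := by
      funext z; exact h.pd_s_eq z.1 z.2
    rw [this, fderiv_clm_apply hd (differentiableAt_const _)]
    simp
  rw [e1, e2]
  have hs : IsSymmSndFDerivAt ℝ (Function.uncurry ξ) (t, s) := by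
    apply ContDiffAt.isSymmSndFDerivAt (n := (⊤ : ℕ∞)) (ContDiff.contDiffAt h)
    rw [minSmoothness_of_isRCLikeNormedField]; exact WithTop.coe_le_coe.2 le_top
  exact hs _ _

lemma Sm.cont {ξ : ℝ → ℝ → ℝ} (h : Sm ξ) : Continuous (Function.uncurry ξ) := ContDiff.continuous h

lemma Sm.cont_comp {ξ : ℝ → ℝ → ℝ} (h : Sm ξ) {X : Type*} [TopologicalSpace X] {a b : X → ℝ}
    (ha : Continuous a) (hb : Continuous b) : Continuous (fun x => ξ (a x) (b x)) :=
  h.cont.comp (ha.prodMk hb)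

lemma Sm.comp2 {ξ : ℝ → ℝ → ℝ} (h : Sm ξ) {a b : ℝ → ℝ → ℝ} (ha : Sm a) (hb : Sm b) :
    Sm (fun t s => ξ (a t s) (b t s)) :=
  ContDiff.comp (g := Function.uncurry ξ) h (ContDiff.prodMk ha hb)

lemma Sm.mul {a b : ℝ → ℝ → ℝ} (ha : Sm a) (hb : Sm b) : Sm (fun t s => a t s * b t s) :=
  ContDiff.mul ha hb
lemma Sm.add {a b : ℝ → ℝ → ℝ} (ha : Sm a) (hb : Sm b) : Sm (fun t s => a t s + b t s) :=
  ContDiff.add ha hb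
lemma Sm.sub {a b : ℝ → ℝ → ℝ} (ha : Sm a) (hb : Sm b) : Sm (fun t s => a t s - b t s) :=
  ContDiff.sub ha hb
lemma Sm.pow {a : ℝ → ℝ → ℝ} (ha : Sm a) (n : ℕ) : Sm (fun t s => a t s ^ n) :=
  ContDiff.pow ha n
lemma Sm.const (c : ℝ) : Sm (fun _ _ => c) := contDiff_const
lemma Sm.fst : Sm (fun t _ => t) := contDiff_fst
lemma Sm.snd : Sm (fun _ s => s) := contDiff_snd
lemma Sm.of_s {a : ℝ → ℝ} (ha : ContDiff ℝ (⊤ : ℕ∞) a) : Sm (fun _ s => a s) :=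
  ha.comp contDiff_snd

lemma Sm.svf {ξ : ℝ → ℝ → ℝ} (h : Sm ξ) : Sm (Svf ξ) :=
  (Sm.fst.mul h.pd_t).add (Sm.snd.mul h.pd_s)

lemma Sm.diag {ξ : ℝ → ℝ → ℝ} (h : Sm ξ) (t x : ℝ) :
    HasDerivAt (fun t' => ξ t' (t' + x)) (_root_.pd_t ξ t (t + x) + _root_.pd_s ξ t (t + x)) t := by
  have h1 := (h.differentiable (t, t + x)).hasFDerivAt
  have h2 : HasDerivAt (fun t' : ℝ => (t', t' + x)) ((1 : ℝ), (1 : ℝ)) t :=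
    (hasDerivAt_id t).prodMk ((hasDerivAt_id t).add_const x)
  have h3 := h1.comp_hasDerivAt t h2
  rw [h.pd_t_eq, h.pd_s_eq, ← map_add]
  have e : ((1:ℝ),(0:ℝ)) + ((0:ℝ),(1:ℝ)) = (1,1) := by simp
  rw [e]
  exact h3

/-- differentiation under the integral sign -/
lemma Sm.param {g : ℝ → ℝ → ℝ} (h : Sm g) (a b t : ℝ) :
    HasDerivAt (fun t' => ∫ x in a..b, g t' x) (∫ x in a..b, _root_.pd_t g t x) t := by
  have hc : Continuous (Function.uncurry (_root_.pd_t g)) := h.pd_t.cont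
  obtain ⟨K, hK⟩ := ((isCompact_Icc (a := t - 1) (b := t + 1)).prod
    (isCompact_uIcc (a := a) (b := b))).exists_bound_of_continuousOn hc.continuousOn
  refine (intervalIntegral.hasDerivAt_integral_of_dominated_loc_of_deriv_le
    (s := Metric.ball t 1) (bound := fun _ => K) (Metric.ball_mem_nhds t one_pos)
    ?_ ?_ ?_ ?_ ?_ ?_).2
  · exact Filter.Eventually.of_forall fun t' =>
      (h.cont_comp continuous_const continuous_id).aestronglyMeasurable
  · exact (h.cont_comp continuous_const continuous_id).intervalIntegrable _ _
  · exact (h.pd_t.cont_comp continuous_const continuous_id).aestronglyMeasurable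
  · refine Filter.Eventually.of_forall fun x hx t' ht' => ?_
    refine hK (t', x) ⟨?_, Set.uIoc_subset_uIcc hx⟩
    rw [Metric.mem_ball, Real.dist_eq, abs_lt] at ht'
    exact ⟨by linarith [ht'.1], by linarith [ht'.2]⟩
  · exact intervalIntegrable_const
  · exact Filter.Eventually.of_forall fun x hx t' ht' => h.dt t' x



def Vp (k x : ℝ) : ℝ := k ^ 2 * x ^ 3 * (1 - x)
def Wp (k s x : ℝ) : ℝ := Vp k x * (2 + s * k * x * (4 * x - 3))
def fp (x : ℝ) : ℝ := 11 - 5 * x - 18 * x ^ 3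

section bg
variable {M : ℝ} {r : ℝ → ℝ}

lemma bg_rpos (hM : 0 < M) (hr : IsTortoise M r) (s : ℝ) : 0 < r s := by
  have := hr.1 s; linarith

lemma bg_x0 (hM : 0 < M) (hr : IsTortoise M r) (s : ℝ) : 0 < muS M r s := by
  have := bg_rpos hM hr s
  unfold muS; positivity

lemma bg_x1 (hM : 0 < M) (hr : IsTortoise M r) (s : ℝ) : muS M r s < 1 := by
  have := bg_rpos hM hr s
  unfold muS; rw [div_lt_one this]; exact hr.1 s

lemma bg_r' (hr : IsTortoise M r) (s : ℝ) : HasDerivAt r (1 - muS M r s) s := hr.2.1 s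

lemma bg_r (hM : 0 < M) (hr : IsTortoise M r) (s : ℝ) : r s * muS M r s = 2 * M := by
  have := bg_rpos hM hr s
  unfold muS; field_simp

lemma bg_x' (hM : 0 < M) (hr : IsTortoise M r) (s : ℝ) :
    HasDerivAt (muS M r) (-(1 / (2 * M)) * muS M r s ^ 2 * (1 - muS M r s)) s := by
  have h0 := bg_rpos hM hr s
  have h := (hasDerivAt_const s (2 * M)).div (bg_r' hr s) h0.ne'
  refine HasDerivAt.congr_deriv h ?_
  unfold muS
  field_simp
  ring

lemma bg_r_cd (hM : 0 < M) (hr : IsTortoise M r) : ContDiff ℝ (⊤ : ℕ∞) r := by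
  have hne : ∀ s, r s ≠ 0 := fun s => (bg_rpos hM hr s).ne'
  have hd : deriv r = fun s => 1 - 2 * M / r s := by
    funext s; exact (hr.2.1 s).deriv
  rw [contDiff_infty]
  intro n
  induction n with
  | zero =>
    have : Differentiable ℝ r := fun s => (hr.2.1 s).differentiableAt
    simpa using this.continuous
  | succ n ih =>
    have : ((n + 1 : ℕ) : WithTop ℕ∞) = (n : WithTop ℕ∞) + 1 := by simp
    rw [this, contDiff_succ_iff_deriv]
    refine ⟨fun s => (hr.2.1 s).differentiableAt, by simp, ?_⟩
    rw [hd]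
    exact contDiff_const.sub (contDiff_const.div ih hne)

lemma bg_x_cd (hM : 0 < M) (hr : IsTortoise M r) : ContDiff ℝ (⊤ : ℕ∞) (muS M r) := by
  have hne : ∀ s, r s ≠ 0 := fun s => (bg_rpos hM hr s).ne'
  exact contDiff_const.div (bg_r_cd hM hr) hne

lemma bg_mono (hM : 0 < M) (hr : IsTortoise M r) : StrictMono r := by
  apply strictMono_of_deriv_pos
  intro s
  rw [(bg_r' hr s).deriv]
  linarith [bg_x1 hM hr s]

lemma bg_up (hM : 0 < M) (hr : IsTortoise M r) {s : ℝ} (hs : 0 ≤ s) : r s ≤ 3 * M + s := by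
  have : Antitone (fun s => r s - s) := by
    apply antitone_of_deriv_nonpos
    · intro s; exact ((bg_r' hr s).sub (hasDerivAt_id s)).differentiableAt
    · intro s
      have := ((bg_r' hr s).sub (hasDerivAt_id s)).deriv
      have e : (fun s => r s - s) = r - id := rfl
      rw [e, this]; linarith [bg_x0 hM hr s]
  have := this hs
  simp only [hr.2.2] at this; linarith

lemma bg_x23 (hM : 0 < M) (hr : IsTortoise M r) {s : ℝ} (hs : 0 ≤ s) : muS M r s ≤ 2 / 3 := by
  have h := (bg_mono hM hr).monotone hs
  rw [hr.2.2] at h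
  unfold muS
  rw [div_le_div_iff₀ (bg_rpos hM hr s) (by norm_num)]; linarith

lemma bg_x23' (hM : 0 < M) (hr : IsTortoise M r) {s : ℝ} (hs : s ≤ 0) : 2 / 3 ≤ muS M r s := by
  have h := (bg_mono hM hr).monotone hs
  rw [hr.2.2] at h
  unfold muS
  rw [div_le_div_iff₀ (by norm_num) (bg_rpos hM hr s)]; linarith

lemma bg_low (hM : 0 < M) (hr : IsTortoise M r) {s : ℝ} (hs : 0 ≤ s) : 3 * M + s / 3 ≤ r s := by
  have : MonotoneOn (fun s => r s - s / 3) (Set.Ici 0) := by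
    apply monotoneOn_of_deriv_nonneg (convex_Ici 0)
    · intro s _
      exact ((bg_r' hr s).sub ((hasDerivAt_id s).div_const 3)).continuousAt.continuousWithinAt
    · intro s _
      exact ((bg_r' hr s).sub ((hasDerivAt_id s).div_const 3)).differentiableAt.differentiableWithinAt
    · intro s h
      rw [interior_Ici, Set.mem_Ioi] at h
      have := ((bg_r' hr s).sub ((hasDerivAt_id s).div_const 3)).deriv
      have e : (fun s => r s - s/3) = r - fun s => id s /3 := rfl
      rw [e, this]; linarith [bg_x23 hM hr h.le]
  have := this (Set.mem_Ici.2 le_rfl) (Set.mem_Ici.2 hs) hs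
  simp only [hr.2.2] at this; linarith

/-- `s x ≤ 6M` for `s ≥ 0` -/
lemma bg_sx (hM : 0 < M) (hr : IsTortoise M r) {s : ℝ} (hs : 0 ≤ s) : s * muS M r s ≤ 6 * M := by
  have h1 := bg_low hM hr hs
  have h0 := bg_x0 hM hr s
  have h2 := bg_r hM hr s
  nlinarith

lemma bg_skx (hM : 0 < M) (hr : IsTortoise M r) {s : ℝ} (hs : 0 ≤ s) :
    1 - 3 / 2 * muS M r s ≤ s * (1 / (2 * M)) * muS M r s := by
  have h1 := bg_up hM hr hs
  have h0 := bg_x0 hM hr s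
  have h2 := bg_r hM hr s
  have : s * (1 / (2 * M)) * muS M r s = (s * muS M r s) / (2 * M) := by ring
  rw [this, le_div_iff₀ (by positivity)]
  nlinarith

lemma bg_y (hM : 0 < M) (hr : IsTortoise M r) {s : ℝ} (hs : s ≤ 0) :
    1 - muS M r s ≤ Real.exp (2 / (9 * M) * s) := by
  have : MonotoneOn (fun s => (1 - muS M r s) * Real.exp (-(2 / (9 * M) * s))) (Set.Iic 0) := by
    have hd : ∀ s, HasDerivAt (fun s => (1 - muS M r s) * Real.exp (-(2 / (9 * M) * s)))
        (((1 / (2 * M)) * muS M r s ^ 2 - 2 / (9 * M)) * (1 - muS M r s)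
          * Real.exp (-(2 / (9 * M) * s))) s := by
      intro s
      have h1 := (bg_x' hM hr s).const_sub 1
      have h2 := (((hasDerivAt_id s).const_mul (2 / (9 * M))).neg).exp
      have := h1.mul h2
      refine HasDerivAt.congr_deriv this ?_
      simp only [id, Pi.neg_apply]
      ring
    apply monotoneOn_of_deriv_nonneg (convex_Iic 0)
    · intro s _; exact (hd s).continuousAt.continuousWithinAt
    · intro s _; exact (hd s).differentiableAt.differentiableWithinAt
    · intro s h
      rw [interior_Iic, Set.mem_Iio] at h
      rw [(hd s).deriv]
      have h1 := bg_x23' hM hr h.le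
      have h2 := bg_x1 hM hr s
      have h3 : 0 ≤ (1 / (2 * M)) * muS M r s ^ 2 - 2 / (9 * M) := by
        have : (1 / (2 * M)) * muS M r s ^ 2 - 2 / (9 * M) = (muS M r s ^ 2 - 4/9) / (2 * M) := by
          field_simp; ring
        rw [this]; apply div_nonneg _ (by positivity); nlinarith
      have h4 : 0 ≤ 1 - muS M r s := by linarith
      positivity
  have h := this (Set.mem_Iic.2 hs) (Set.mem_Iic.2 le_rfl) hs
  have hx := bg_x0 hM hr 0
  simp only [mul_zero, neg_zero, Real.exp_zero, mul_one] at h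
  rw [Real.exp_neg] at h
  have hp := Real.exp_pos (2 / (9 * M) * s)
  have h5 : (1 - muS M r s) * (Real.exp (2 / (9 * M) * s))⁻¹ ≤ 1 := by linarith
  rw [← div_eq_mul_inv, div_le_one hp] at h5
  exact h5

lemma bg_yn (hM : 0 < M) (hr : IsTortoise M r) (n : ℕ) :
    ∃ C : ℝ, 1 ≤ C ∧ ∀ s ≤ 0, (-s) ^ n * (1 - muS M r s) ≤ C := by
  set a : ℝ := 2 / (9 * M) with ha
  have ha0 : 0 < a := by positivity
  refine ⟨n.factorial / a ^ n + 1, by have : 0 ≤ (n.factorial : ℝ) / a ^ n := by positivity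
                                      linarith, ?_⟩
  intro s hs
  have h1 := bg_y hM hr hs
  have h2 := Real.pow_div_factorial_le_exp (a * (-s)) (by nlinarith) n
  have hf : (0 : ℝ) < n.factorial := by exact_mod_cast n.factorial_pos
  rw [div_le_iff₀ hf, mul_pow] at h2
  have h3 : (-s) ^ n * (1 - muS M r s) ≤ (-s) ^ n * Real.exp (a * s) :=
    mul_le_mul_of_nonneg_left h1 (by apply pow_nonneg; linarith)
  have h4 : (-s) ^ n * Real.exp (a * s) ≤ n.factorial / a ^ n := by
    rw [le_div_iff₀ (by positivity)]
    have h5 : Real.exp (a * (-s)) * Real.exp (a * s) = 1 := by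
      rw [← Real.exp_add]; simp
    nlinarith [mul_le_mul_of_nonneg_right h2 (Real.exp_pos (a * s)).le]
  linarith

end bg


/-- derivative of `V f` -/
def dVf (k x : ℝ) : ℝ := Vp k x * (k * x * ((4 * x - 3) * fp x + x * (1 - x) * (5 + 54 * x ^ 2)))

lemma aux_wabc {w a b c : ℝ} (h : w ≤ a) (ha : 0 ≤ a) (hb : 0 ≤ b) (hc : 1 ≤ c) :
    w * b ≤ a * b * c :=
  le_trans (mul_le_mul_of_nonneg_right h hb) (le_mul_of_one_le_right (mul_nonneg ha hb) hc)

lemma aux_le1 {c K a : ℝ} (hK : 0 ≤ K) (h : c ≤ K) (ha : 0 ≤ a) : c ≤ K * (1 + a) :=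
  h.trans (le_mul_of_one_le_right hK (by linarith))

structure Bg (k C s x : ℝ) : Prop where
  k0 : 0 < k
  C1 : 1 ≤ C
  kC : k ≤ C
  kC' : 1 / k ≤ C
  x0 : 0 < x
  x1 : x < 1
  sV : s ^ 2 * (x ^ 3 * (1 - x)) ≤ C
  sF : s ^ 2 * dVf k x ≤ C * (1 + |s|) * (x ^ 3 * (1 - x))
  W : Wp k s x ≤ C * (x ^ 4 * (1 - x))

lemma Vp_nonneg {k x : ℝ} (x0 : 0 < x) (x1 : x < 1) : 0 ≤ Vp k x := by
  unfold Vp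
  have : 0 ≤ 1 - x := by linarith
  positivity

lemma fp_abs {x : ℝ} (x0 : 0 < x) (x1 : x < 1) : |fp x| ≤ 12 := by
  unfold fp
  have h2 : x ^ 3 ≤ 1 := pow_le_one₀ x0.le x1.le
  have h3 : 0 < x ^ 3 := by positivity
  rw [abs_le]; constructor <;> linarith

lemma fp_nonpos {x : ℝ} (x0 : 3 / 4 ≤ x) : fp x ≤ 0 := by
  unfold fp
  have h2 : (3 / 4 : ℝ) ^ 3 ≤ x ^ 3 := pow_le_pow_left₀ (by norm_num) x0 3
  norm_num at h2; linarith

lemma poly_abs {x : ℝ} (x0 : 0 < x) (x1 : x < 1) :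
    (4 * x - 3) * fp x + x * (1 - x) * (5 + 54 * x ^ 2) ≤ 100 := by
  have h := abs_le.1 (fp_abs x0 x1)
  have h1 : (4 * x - 3) * fp x ≤ 36 := by
    have : |(4 * x - 3) * fp x| ≤ 3 * 12 := by
      rw [abs_mul]
      apply mul_le_mul _ (fp_abs x0 x1) (abs_nonneg _) (by norm_num)
      rw [abs_le]; constructor <;> linarith
    linarith [abs_le.1 this]
  have h2 : x ^ 2 ≤ 1 := pow_le_one₀ x0.le x1.le
  have h3 : x * (1 - x) ≤ 1 := by nlinarith
  have h4 : x * (1 - x) * (5 + 54 * x ^ 2) ≤ 1 * 59 := by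
    apply mul_le_mul h3 (by linarith) (by positivity) (by norm_num)
  linarith

set_option maxHeartbeats 2000000 in
lemma bg_exists {M : ℝ} {r : ℝ → ℝ} (hM : 0 < M) (hr : IsTortoise M r) :
    ∃ C : ℝ, ∀ s, Bg (1 / (2 * M)) C s (muS M r s) := by
  obtain ⟨C1, hC1, h1⟩ := bg_yn hM hr 1
  obtain ⟨C2, hC2, h2⟩ := bg_yn hM hr 2
  set k := 1 / (2 * M) with hk
  have k0 : 0 < k := by positivity
  have kM : k * M = 1 / 2 := by rw [hk]; field_simp
  set C := 1 + k + 1/k + (36 * M ^ 2 + C2) + (k^3 * 100) * (6 * M + 4 * C1 + 16 * C1^2 + C2)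
    + k ^ 2 * (9 + 3 + 24 * k * C1) with hC
  have hC2' : 0 ≤ C1^2 := by positivity
  refine ⟨C, fun s => ?_⟩
  have x0 := bg_x0 hM hr s
  have x1 := bg_x1 hM hr s
  set x := muS M r s with hx
  have y0 : 0 < 1 - x := by linarith
  have x3 : x ^ 3 ≤ 1 := pow_le_one₀ x0.le x1.le
  have hs1 : s ^ 2 * (x ^ 3 * (1 - x)) ≤ 36 * M ^ 2 + C2 := by
    rcases le_total 0 s with hs | hs
    · have h := bg_sx hM hr hs
      have h' : (s * x) ^ 2 ≤ (6 * M) ^ 2 := pow_le_pow_left₀ (by positivity) h 2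
      have h3 : x * (1 - x) ≤ 1 := by nlinarith
      have : s ^ 2 * (x ^ 3 * (1 - x)) = (s * x) ^ 2 * (x * (1 - x)) := by ring
      rw [this]
      have : (s * x) ^ 2 * (x * (1 - x)) ≤ (s * x) ^ 2 * 1 :=
        mul_le_mul_of_nonneg_left h3 (by positivity)
      linarith
    · have h := h2 s hs
      have : s ^ 2 * (x ^ 3 * (1 - x)) ≤ s ^ 2 * (1 * (1 - x)) := by gcongr
      nlinarith
  have hL : s ≤ 0 → x ≤ 3 / 4 → -s ≤ 4 * C1 := by
    intro hs hx
    have h := h1 s hs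
    simp only [pow_one] at h
    nlinarith
  have hpc : (4 * x - 3) * fp x + x * (1 - x) * (5 + 54 * x ^ 2) ≤ 100 := poly_abs x0 x1
  refine ⟨k0, ?_, ?_, ?_, x0, x1, ?_, ?_, ?_⟩
  · have : 0 ≤ k + 1/k + (36 * M ^ 2 + C2) + (k^3 * 100) * (6 * M + 4 * C1 + 16 * C1^2 + C2)
      + k ^ 2 * (9 + 3 + 24 * k * C1) := by positivity
    linarith
  · have : 0 ≤ 1 + 1/k + (36 * M ^ 2 + C2) + (k^3 * 100) * (6 * M + 4 * C1 + 16 * C1^2 + C2)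
      + k ^ 2 * (9 + 3 + 24 * k * C1) := by positivity
    linarith
  · have : 0 ≤ 1 + k + (36 * M ^ 2 + C2) + (k^3 * 100) * (6 * M + 4 * C1 + 16 * C1^2 + C2)
      + k ^ 2 * (9 + 3 + 24 * k * C1) := by positivity
    linarith
  · have : 0 ≤ 1 + k + 1 / k + (k^3 * 100) * (6 * M + 4 * C1 + 16 * C1^2 + C2)
      + k ^ 2 * (9 + 3 + 24 * k * C1) := by positivity
    linarith
  · have e : s ^ 2 * dVf k x = (k ^ 3 * (s ^ 2 * x * ((4 * x - 3) * fp x + x * (1 - x) * (5 + 54 * x ^ 2))))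
        * (x ^ 3 * (1 - x)) := by unfold dVf Vp; ring
    rw [e]
    have hCC : (k^3 * 100) * (6 * M + 4 * C1 + 16 * C1^2 + C2) ≤ C := by
      have : 0 ≤ 1 + k + 1 / k + (36 * M ^ 2 + C2)  + k ^ 2 * (9 + 3 + 24 * k * C1) := by positivity
      linarith
    apply mul_le_mul_of_nonneg_right _ (by positivity)
    have key : s ^ 2 * x * ((4 * x - 3) * fp x + x * (1 - x) * (5 + 54 * x ^ 2))
        ≤ 100 * (6 * M + 4 * C1 + 16 * C1^2 + C2) * (1 + |s|) := by
      have hcc : 0 ≤ 100 * (6 * M + 4 * C1 + 16 * C1^2 + C2) := by positivity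
      rcases le_total 0 s with hs | hs
      · rw [abs_of_nonneg hs]
        have h := bg_sx hM hr hs
        calc _ ≤ s ^ 2 * x * 100 := mul_le_mul_of_nonneg_left hpc (by positivity)
          _ = 100 * (s * (s * x)) := by ring
          _ ≤ 100 * (s * (6 * M)) := by gcongr
          _ ≤ _ := by nlinarith
      · rcases le_total x (3 / 4) with hx34 | hx34
        · have h := hL hs hx34
          have hs2 : s ^ 2 ≤ 16 * C1 ^ 2 := by nlinarith
          calc _ ≤ s ^ 2 * x * 100 := mul_le_mul_of_nonneg_left hpc (by positivity)
            _ ≤ (16 * C1 ^ 2) * 1 * 100 := by gcongr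
            _ ≤ _ := aux_le1 hcc (by linarith) (abs_nonneg s)
        · have h := h2 s hs
          have hf := fp_nonpos hx34
          have h5 : (4 * x - 3) * fp x ≤ 0 := mul_nonpos_of_nonneg_of_nonpos (by linarith) hf
          have h6 : x ^ 2 * (5 + 54 * x ^ 2) ≤ 1 * 59 := by
            have : x ^ 2 ≤ 1 := pow_le_one₀ x0.le x1.le
            apply mul_le_mul this (by linarith) (by positivity) (by norm_num)
          calc _ ≤ s ^ 2 * x * (0 + x * (1 - x) * (5 + 54 * x ^ 2)) := by gcongr
            _ = ((-s) ^ 2 * (1 - x)) * (x ^ 2 * (5 + 54 * x ^ 2)) := by ring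
            _ ≤ C2 * (1 * 59) := by gcongr
            _ ≤ _ := aux_le1 hcc (by linarith) (abs_nonneg s)
    calc _ ≤ k ^ 3 * (100 * (6 * M + 4 * C1 + 16 * C1^2 + C2) * (1 + |s|)) := by gcongr
      _ = ((k^3 * 100) * (6 * M + 4 * C1 + 16 * C1^2 + C2)) * (1 + |s|) := by ring
      _ ≤ _ := by gcongr
  · have hCC : k ^ 2 * (9 + 3 + 24 * k * C1) ≤ C := by
      have : 0 ≤ 1 + k + 1 / k + (36 * M ^ 2 + C2)  + (k^3 * 100) * (6 * M + 4 * C1 + 16 * C1^2 + C2) := by positivity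
      linarith
    have key : 2 + s * k * x * (4 * x - 3) ≤ (9 + 3 + 24 * k * C1) * x := by
      have hcc : 0 ≤ k * C1 := by positivity
      rcases le_total 0 s with hs | hs
      · have h := bg_skx hM hr hs
        have h' := bg_x23 hM hr hs
        have : s * k * x * (4 * x - 3) ≤ (1 - 3 / 2 * x) * (4 * x - 3) :=
          mul_le_mul_of_nonpos_right h (by linarith)
        nlinarith
      · have h' := bg_x23' hM hr hs
        rcases le_total x (3 / 4) with hx34 | hx34
        · have h := hL hs hx34
          have : s * k * x * (4 * x - 3) ≤ 4 * C1 * k * x := by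
            have h7 : (-s) * (3 - 4 * x) ≤ (4 * C1) * 1 := by
              apply mul_le_mul h (by linarith) (by linarith) (by linarith)
            have h8 : 0 ≤ k * x := by positivity
            nlinarith
          nlinarith [mul_nonneg hcc x0.le]
        · have : s * k * x * (4 * x - 3) ≤ 0 := by
            have h8 : 0 ≤ k * x * (4 * x - 3) := mul_nonneg (by positivity) (by linarith)
            nlinarith
          nlinarith [mul_nonneg hcc x0.le]
    calc Wp k s x = (k ^ 2 * (x ^ 3 * (1 - x))) * (2 + s * k * x * (4 * x - 3)) := by
          unfold Wp Vp; ring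
      _ ≤ (k ^ 2 * (x ^ 3 * (1 - x))) * ((9 + 3 + 24 * k * C1) * x) := by gcongr
      _ = (k ^ 2 * (9 + 3 + 24 * k * C1)) * (x ^ 4 * (1 - x)) := by ring
      _ ≤ _ := by gcongr

set_option maxHeartbeats 2000000 in
/-- source dichotomy -/
lemma src_exists {M : ℝ} {r : ℝ → ℝ} (hM : 0 < M) (hr : IsTortoise M r) {ε : ℝ} (e0 : 0 < ε)
    (e1 : ε ≤ 1 / 4) : ∃ C : ℝ, 1 ≤ C ∧ ∀ t s, 1 ≤ t → 
      (|s| ≤ t ∧ t ^ (-ε) * |Wp (1 / (2 * M)) s (muS M r s)| ≤ C * (muS M r s ^ 3 * (1 - muS M r s))) ∨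
      Wp (1 / (2 * M)) s (muS M r s) ^ 2 * t ^ 2 ≤
        C * (t ^ (-ε)) ^ 2 * (muS M r s ^ 3 * (1 - muS M r s)) := by
  obtain ⟨n, hn⟩ := exists_nat_ge (3 / ε)
  obtain ⟨C1, hC1, h1⟩ := bg_yn hM hr (n + 2)
  set k := 1 / (2 * M) with hk
  have k0 : 0 < k := by positivity
  have kM : k * M = 1 / 2 := by rw [hk]; field_simp
  set A := k ^ 2 * (5 + 3 * k * (6 * M)) with hA
  have A0 : 0 ≤ A := by positivity
  refine ⟨1 + A * 2 + A ^ 2 * (6 * M) ^ 3 + 4 * A ^ 2 * C1 + k ^ 2 * (5 + 3 * k) * 2 +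
     4 * (k ^ 2 * (5 + 3 * k)) ^ 2 * C1, by
    have : 0 ≤ A * 2 + A ^ 2 * (6 * M) ^ 3 + 4 * A ^ 2 * C1 + k ^ 2 * (5 + 3 * k) * 2 +
     4 * (k ^ 2 * (5 + 3 * k)) ^ 2 * C1 := by positivity
    linarith, ?_⟩
  intro t s ht
  have t0 : 0 < t := by linarith
  have x0 := bg_x0 hM hr s
  have x1 := bg_x1 hM hr s
  set x := muS M r s with hx
  have y0 : 0 < 1 - x := by linarith
  have x3 : x ^ 3 ≤ 1 := pow_le_one₀ x0.le x1.le
  set τ := t ^ (-ε) with hτ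
  have τ0 : 0 < τ := by positivity
  have τ1 : τ ≤ 1 := Real.rpow_le_one_of_one_le_of_nonpos ht (by linarith)
  have τt : t ^ (-(1/4):ℝ) ≤ τ := Real.rpow_le_rpow_of_exponent_le ht (by linarith)
  have τt4 : 1 ≤ t * τ ^ 2 := by
    have : (t ^ (-(1/4):ℝ)) ^ 2 * t = t ^ (1/2 : ℝ) := by
      rw [← Real.rpow_natCast, ← Real.rpow_mul t0.le]
      nth_rewrite 2 [← Real.rpow_one t]
      rw [← Real.rpow_add t0]; norm_num
    have h2 : 1 ≤ t ^ (1/2 : ℝ) := Real.one_le_rpow ht (by norm_num)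
    have h3 : (t ^ (-(1/4):ℝ)) ^ 2 ≤ τ ^ 2 := pow_le_pow_left₀ (by positivity) τt 2
    nlinarith
  have absW : |Wp k s x| ≤ k ^ 2 * (x ^ 3 * (1 - x)) * (2 + 3 * k * (|s| * x)) := by
    have e : Wp k s x = (k ^ 2 * (x ^ 3 * (1 - x))) * (2 + s * k * x * (4 * x - 3)) := by
          unfold Wp Vp; ring
    have hp : 0 ≤ k ^ 2 * (x ^ 3 * (1 - x)) := by positivity
    rw [e, abs_mul, abs_of_nonneg hp]
    apply mul_le_mul_of_nonneg_left _ hp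
    have : |s * k * x * (4 * x - 3)| ≤ 3 * k * (|s| * x) := by
      rw [abs_mul, abs_mul, abs_mul, abs_of_pos k0, abs_of_pos x0]
      have : |4 * x - 3| ≤ 3 := by rw [abs_le]; constructor <;> linarith
      calc _ ≤ |s| * k * x * 3 := by gcongr
        _ = _ := by ring
    calc _ ≤ |2| + |s * k * x * (4 * x - 3)| := abs_add_le _ _
      _ ≤ _ := by rw [abs_of_pos (by norm_num : (0:ℝ) < 2)]; linarith
  set D := x ^ 3 * (1 - x) with hD
  have D0 : 0 ≤ D := by positivity
  have D1 : D ≤ 1 := by rw [hD]; nlinarith [pow_pos x0 3]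
  rcases le_total 0 s with hs | hs
  · have hsx := bg_sx hM hr hs
    rw [abs_of_nonneg hs] at absW ⊢
    have aw : |Wp k s x| ≤ A * D := by
      calc _ ≤ _ := absW
        _ ≤ k ^ 2 * D * (5 + 3 * k * (6 * M)) := by gcongr; norm_num
        _ = A * D := by rw [hA]; ring
    rcases le_total s t with hst | hst
    · left
      refine ⟨hst, ?_⟩
      calc _ ≤ 1 * (A * D) := by gcongr
        _ ≤ _ := by
          rw [one_mul]; gcongr
          have : 0 ≤ 1 + A * 1 + A ^ 2 * (6 * M) ^ 3 + 4 * A ^ 2 * C1 + k ^ 2 * (5 + 3 * k) * 2 +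
            4 * (k ^ 2 * (5 + 3 * k)) ^ 2 * C1 := by positivity
          linarith
    · right
      have hw2 : Wp k s x ^ 2 ≤ (A * D) ^ 2 := by
        rw [← sq_abs]; exact pow_le_pow_left₀ (abs_nonneg _) aw 2
      have hDt : D * t ^ 3 ≤ (6 * M) ^ 3 := by
        calc D * t ^ 3 ≤ D * s ^ 3 := by gcongr
          _ = (s * x) ^ 3 * (1 - x) := by rw [hD]; ring
          _ ≤ (6 * M) ^ 3 * 1 := by
            gcongr
            linarith
          _ = _ := by ring
      calc Wp k s x ^ 2 * t ^ 2 ≤ (A * D) ^ 2 * t ^ 2 * (t * τ ^ 2) := by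
            exact aux_wabc hw2 (by positivity) (by positivity) τt4
        _ = A ^ 2 * (D * t ^ 3) * τ ^ 2 * D := by ring
        _ ≤ A ^ 2 * (6 * M) ^ 3 * τ ^ 2 * D := by gcongr
        _ ≤ _ := by
          gcongr
          have : 0 ≤ 1 + A * 2 + 4 * A ^ 2 * C1 + k ^ 2 * (5 + 3 * k) * 2 +
            4 * (k ^ 2 * (5 + 3 * k)) ^ 2 * C1 := by positivity
          linarith
  · have hyn := h1 s hs
    rw [abs_of_nonpos hs] at absW ⊢
    have aw : |Wp k s x| ≤ k ^ 2 * (5 + 3 * k) * D * (1 + -s) := by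
      calc _ ≤ _ := absW
        _ ≤ k ^ 2 * D * ((5 + 3 * k) * (1 + -s)) := by
          gcongr
          have : -s * x ≤ -s := by nlinarith
          nlinarith
        _ = _ := by ring
    rcases le_total (τ * (-s)) 1 with hst | hst
    · left
      refine ⟨?_, ?_⟩
      · have : τ⁻¹ ≤ t := by
          rw [hτ, ← Real.rpow_neg t0.le, neg_neg]
          calc t ^ ε ≤ t ^ (1:ℝ) := Real.rpow_le_rpow_of_exponent_le ht (by linarith)
            _ = t := Real.rpow_one t
        have h2 : -s ≤ τ⁻¹ := by
          rw [← one_div, le_div_iff₀ τ0]; linarith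
        linarith
      · calc _ ≤ τ * (k ^ 2 * (5 + 3 * k) * D * (1 + -s)) := by gcongr
          _ = k ^ 2 * (5 + 3 * k) * D * (τ + τ * -s) := by ring
          _ ≤ k ^ 2 * (5 + 3 * k) * D * 2 := by gcongr; linarith
          _ = (k ^ 2 * (5 + 3 * k) * 2) * D := by ring
          _ ≤ _ := by
            gcongr
            have : 0 ≤ 1 + A * 2 + A ^ 2 * (6 * M) ^ 3 + 4 * A ^ 2 * C1 +
              4 * (k ^ 2 * (5 + 3 * k)) ^ 2 * C1 := by positivity
            linarith
    · right
      set B := k ^ 2 * (5 + 3 * k) with hB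
      have B0 : 0 ≤ B := by positivity
      have hw2 : Wp k s x ^ 2 ≤ (B * D * (1 + -s)) ^ 2 := by
        rw [← sq_abs]; exact pow_le_pow_left₀ (abs_nonneg _) aw 2
      have s1 : 1 ≤ -s := by nlinarith
      have hsq : (1 + -s) ^ 2 ≤ 4 * (-s) ^ 2 := by nlinarith
      have hpow : t ^ 3 ≤ (-s) ^ n := by
        have h2 : t ^ ε ≤ -s := by
          have : t ^ ε = τ⁻¹ := by rw [hτ, ← Real.rpow_neg t0.le, neg_neg]
          rw [this, ← one_div, div_le_iff₀ τ0]; linarith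
        calc t ^ 3 = t ^ (3 : ℝ) := by norm_cast
          _ ≤ t ^ (ε * n) := by
            apply Real.rpow_le_rpow_of_exponent_le ht
            rw [div_le_iff₀ e0] at hn; linarith
          _ = (t ^ ε) ^ n := by rw [Real.rpow_mul t0.le, Real.rpow_natCast]
          _ ≤ _ := pow_le_pow_left₀ (by positivity) h2 n
      have hDt : D * ((-s) ^ 2 * t ^ 3) ≤ C1 := by
        calc D * ((-s) ^ 2 * t ^ 3) ≤ (1 * (1 - x)) * ((-s) ^ 2 * (-s) ^ n) := by
              have : D ≤ 1 * (1 - x) := mul_le_mul_of_nonneg_right x3 y0.le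
              gcongr
          _ = (-s) ^ (n + 2) * (1 - x) := by ring
          _ ≤ C1 := hyn
      calc Wp k s x ^ 2 * t ^ 2 ≤ (B * D * (1 + -s)) ^ 2 * t ^ 2 * (t * τ ^ 2) := by
            exact aux_wabc hw2 (by positivity) (by positivity) τt4
        _ = B ^ 2 * (1 + -s) ^ 2 * D * t ^ 3 * τ ^ 2 * D := by ring
        _ ≤ B ^ 2 * (4 * (-s) ^ 2) * D * t ^ 3 * τ ^ 2 * D := by gcongr
        _ = 4 * B ^ 2 * (D * ((-s) ^ 2 * t ^ 3)) * τ ^ 2 * D := by ring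
        _ ≤ 4 * B ^ 2 * C1 * τ ^ 2 * D := by gcongr
        _ ≤ _ := by
          gcongr
          have : 0 ≤ 1 + A * 2 + A ^ 2 * (6 * M) ^ 3 + 4 * A ^ 2 * C1 + B * 2 := by positivity
          linarith



/-- conformal energy density -/
def e0F (k u v x c p m : ℝ) : ℝ :=
  (v ^ 2 + 1) * p ^ 2 + (u ^ 2 + 1) * m ^ 2 + Vp k x * (u ^ 2 + v ^ 2 + 2) * c ^ 2
def q0F (k u v x c p : ℝ) : ℝ := 2 * (v ^ 2 + 1) * p ^ 2 + 2 * Vp k x * (u ^ 2 + 1) * c ^ 2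
def hp (k x : ℝ) : ℝ := 20 * k * x ^ 3 * (1 - x)
def dhp (k x : ℝ) : ℝ := -(20 * k ^ 2 * x ^ 4 * (1 - x) * (3 - 4 * x))
def ddhp (k x : ℝ) : ℝ := 20 * k ^ 3 * x ^ 5 * (1 - x) * (12 - 35 * x + 24 * x ^ 2)
def dfp (k x : ℝ) : ℝ := k * x ^ 2 * (1 - x) * (5 + 54 * x ^ 2)
def e1F (k u v x c p m : ℝ) : ℝ :=
  fp x * (v ^ 2 * p ^ 2 - u ^ 2 * m ^ 2) + Vp k x * fp x * (v ^ 2 - u ^ 2) * c ^ 2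
    + 1 / 2 * (u + v) ^ 2 * hp k x * c * ((p + m) / 2)
def q1F (k u v x c p : ℝ) : ℝ :=
  2 * fp x * v ^ 2 * p ^ 2 - 2 * Vp k x * fp x * u ^ 2 * c ^ 2
    + 1 / 2 * (u + v) ^ 2 * (hp k x * c * p - 1 / 2 * dhp k x * c ^ 2)
def b0F (k u v x c : ℝ) : ℝ := (u + v) * Wp k (v - u) x * c ^ 2
def b1F (k u v x c p m : ℝ) : ℝ :=
  -(dfp k x * (v ^ 2 * p ^ 2 + u ^ 2 * m ^ 2))
    + (1 / 2 * ((u + v) ^ 2 + (v - u) ^ 2) * dVf k x + 2 * (v - u) * Vp k x * fp x) * c ^ 2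
    + 1 / 2 * (u + v) ^ 2 * hp k x * (p * m) - 1 / 2 * (u + v) ^ 2 * hp k x * Vp k x * c ^ 2
    + (u + v) * hp k x * c * ((p + m) / 2) + 1 / 4 * (u + v) ^ 2 * ddhp k x * c ^ 2
/-- source terms (coefficient of `ρ`) -/
def s0F (u v p m : ℝ) : ℝ := -(2 * ((v ^ 2 + 1) * p + (u ^ 2 + 1) * m))
def s1F (k u v x c p m : ℝ) : ℝ :=
  -(2 * fp x * (v ^ 2 * p - u ^ 2 * m) + 1 / 2 * (u + v) ^ 2 * hp k x * c)
/-- Morawetz density -/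
def betaF (u v x c p m : ℝ) : ℝ :=
  x ^ 2 * (1 - x) * (v ^ 2 * p ^ 2 + u ^ 2 * m ^ 2) + (u + v) ^ 2 * (x ^ 4 * (1 - x)) * c ^ 2

section ptw
variable {k C u v x c p m τ : ℝ}

lemma betaF_nonneg (x0 : 0 < x) (x1 : x < 1) : 0 ≤ betaF u v x c p m := by
  unfold betaF
  have : 0 ≤ 1 - x := by linarith
  positivity

lemma e0F_nonneg (x0 : 0 < x) (x1 : x < 1) : 0 ≤ e0F k u v x c p m := by
  unfold e0F
  have := Vp_nonneg (k := k) x0 x1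
  positivity

lemma Vp_D (k x : ℝ) : Vp k x = k ^ 2 * (x ^ 3 * (1 - x)) := by unfold Vp; ring

lemma e0F_p (x0 : 0 < x) (x1 : x < 1) : (v ^ 2 + 1) * p ^ 2 ≤ e0F k u v x c p m := by
  unfold e0F
  have := Vp_nonneg (k := k) x0 x1
  have h1 : 0 ≤ (u ^ 2 + 1) * m ^ 2 := by positivity
  have h2 : 0 ≤ Vp k x * (u ^ 2 + v ^ 2 + 2) * c ^ 2 := by positivity
  linarith

lemma e0F_m (x0 : 0 < x) (x1 : x < 1) : (u ^ 2 + 1) * m ^ 2 ≤ e0F k u v x c p m := by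
  unfold e0F
  have := Vp_nonneg (k := k) x0 x1
  have h1 : 0 ≤ (v ^ 2 + 1) * p ^ 2 := by positivity
  have h2 : 0 ≤ Vp k x * (u ^ 2 + v ^ 2 + 2) * c ^ 2 := by positivity
  linarith

lemma e0F_c (_x0 : 0 < x) (_x1 : x < 1) :
    Vp k x * (u ^ 2 + v ^ 2 + 2) * c ^ 2 ≤ e0F k u v x c p m := by
  unfold e0F
  have h1 : 0 ≤ (v ^ 2 + 1) * p ^ 2 := by positivity
  have h2 : 0 ≤ (u ^ 2 + 1) * m ^ 2 := by positivity
  linarith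

lemma D_nonneg (x0 : 0 < x) (x1 : x < 1) : 0 ≤ x ^ 3 * (1 - x) := by
  have : 0 ≤ 1 - x := by linarith
  positivity

lemma D_le (x0 : 0 < x) (x1 : x < 1) : x ^ 3 * (1 - x) ≤ 1 := by
  have h3 : x ^ 3 ≤ 1 := pow_le_one₀ x0.le x1.le
  have : 0 ≤ 1 - x := by linarith
  calc _ ≤ 1 * (1 - x) := by gcongr
    _ ≤ 1 := by linarith

lemma e0F_cD (hk : 0 < k) (hkC : 1 / k ≤ C) (x0 : 0 < x) (x1 : x < 1) :
    (x ^ 3 * (1 - x)) * (u ^ 2 + v ^ 2 + 2) * c ^ 2 ≤ C ^ 2 * e0F k u v x c p m := by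
  have h := e0F_c (k := k) (u := u) (v := v) (c := c) (p := p) (m := m) x0 x1
  rw [Vp_D] at h
  have hE := e0F_nonneg (k := k) (u := u) (v := v) (c := c) (p := p) (m := m) x0 x1
  set E := e0F k u v x c p m
  have h1 : (1 / k) ^ 2 ≤ C ^ 2 := pow_le_pow_left₀ (by positivity) hkC 2
  calc _ = (1 / k) ^ 2 * (k ^ 2 * (x ^ 3 * (1 - x)) * (u ^ 2 + v ^ 2 + 2) * c ^ 2) := by
        field_simp
    _ ≤ (1 / k) ^ 2 * E := by gcongr
    _ ≤ _ := by gcongr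

lemma tD_v (hD : (v - u) ^ 2 * (x ^ 3 * (1 - x)) ≤ C) (hC : 1 ≤ C) (x0 : 0 < x) (x1 : x < 1) :
    (u + v) ^ 2 * (x ^ 3 * (1 - x)) ≤ 10 * C * (v ^ 2 + 1) := by
  have h0 := D_nonneg x0 x1
  have h1 := D_le x0 x1
  set D := x ^ 3 * (1 - x)
  have h2 : (u + v) ^ 2 ≤ 8 * v ^ 2 + 2 * (v - u) ^ 2 := by nlinarith [sq_nonneg (3 * v - u)]
  calc (u + v) ^ 2 * D ≤ (8 * v ^ 2 + 2 * (v - u) ^ 2) * D := by gcongr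
    _ = 8 * v ^ 2 * D + 2 * ((v - u) ^ 2 * D) := by ring
    _ ≤ 8 * v ^ 2 * 1 + 2 * C := by gcongr
    _ ≤ _ := by nlinarith [sq_nonneg v]

lemma tD_u (hD : (v - u) ^ 2 * (x ^ 3 * (1 - x)) ≤ C) (hC : 1 ≤ C) (x0 : 0 < x) (x1 : x < 1) :
    (u + v) ^ 2 * (x ^ 3 * (1 - x)) ≤ 10 * C * (u ^ 2 + 1) := by
  have h : (u - v) ^ 2 * (x ^ 3 * (1 - x)) ≤ C := by
    have : (u - v) ^ 2 = (v - u) ^ 2 := by ring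
    rw [this]; exact hD
  have := tD_v h hC x0 x1
  rw [add_comm u v]; exact this

/-- `t² D c² ≤ C e0` -/
lemma tD_c (h : Bg k C (v - u) x) :
    (u + v) ^ 2 * (x ^ 3 * (1 - x)) * c ^ 2 ≤ 2 * C ^ 2 * e0F k u v x c p m := by
  have h1 := e0F_cD (u := u) (v := v) (c := c) (p := p) (m := m) h.k0 h.kC' h.x0 h.x1
  have h0 := D_nonneg h.x0 h.x1
  set D := x ^ 3 * (1 - x)
  calc (u + v) ^ 2 * D * c ^ 2 ≤ (2 * (u ^ 2 + v ^ 2 + 2)) * D * c ^ 2 := by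
        gcongr; nlinarith [sq_nonneg (u - v)]
    _ = 2 * (D * (u ^ 2 + v ^ 2 + 2) * c ^ 2) := by ring
    _ ≤ 2 * (C ^ 2 * e0F k u v x c p m) := by gcongr
    _ = _ := by ring

lemma amgm (a b : ℝ) : |a| * |b| ≤ 1 / 2 * (a ^ 2 + b ^ 2) := by
  have := sq_nonneg (|a| - |b|)
  have h1 := sq_abs a
  have h2 := sq_abs b
  nlinarith

lemma amgml (a b l : ℝ) (hl : 0 < l) : |a| * |b| ≤ 1 / 2 * (l * a ^ 2 + l⁻¹ * b ^ 2) := by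
  have h1 := sq_abs a
  have h2 := sq_abs b
  have : 0 ≤ l⁻¹ * (l * |a| - |b|) ^ 2 := by positivity
  have e : l⁻¹ * (l * |a| - |b|) ^ 2 = l * |a| ^ 2 - 2 * (|a| * |b|) + l⁻¹ * |b| ^ 2 := by
    field_simp; ring
  rw [e, h1, h2] at this
  linarith

/-- mixed: `t² D |c p'| ≤ C (e0 + e0')` for any two fields -/
lemma tD_cp (h : Bg k C (v - u) x) {c' p' m' : ℝ} :
    (u + v) ^ 2 * (x ^ 3 * (1 - x)) * (|c| * |p'|) ≤
      10 * C ^ 2 * (e0F k u v x c p m + e0F k u v x c' p' m') := by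
  have hC := h.C1
  have h1 := tD_c (c := c) (p := p) (m := m) h
  have h2 := tD_v h.sV h.C1 h.x0 h.x1
  have h3 := e0F_p (k := k) (u := u) (v := v) (c := c') (p := p') (m := m') h.x0 h.x1
  have h0 := D_nonneg h.x0 h.x1
  have hE := e0F_nonneg (k := k) (u := u) (v := v) (c := c) (p := p) (m := m) h.x0 h.x1
  have hE' := e0F_nonneg (k := k) (u := u) (v := v) (c := c') (p := p') (m := m') h.x0 h.x1
  set D := x ^ 3 * (1 - x)
  set E := e0F k u v x c p m
  set E' := e0F k u v x c' p' m'
  calc (u + v) ^ 2 * D * (|c| * |p'|) ≤ (u + v) ^ 2 * D * (1 / 2 * (c ^ 2 + p' ^ 2)) := by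
        exact mul_le_mul_of_nonneg_left (amgm c p') (by positivity)
    _ = 1 / 2 * ((u + v) ^ 2 * D * c ^ 2) + 1 / 2 * ((u + v) ^ 2 * D) * p' ^ 2 := by ring
    _ ≤ 1 / 2 * (2 * C ^ 2 * E) + 1 / 2 * (10 * C * (v ^ 2 + 1)) * p' ^ 2 := by gcongr
    _ = C ^ 2 * E + 5 * C * ((v ^ 2 + 1) * p' ^ 2) := by ring
    _ ≤ C ^ 2 * E + 5 * C * E' := by gcongr
    _ ≤ C ^ 2 * E + 5 * (C * C) * E' := by gcongr; nlinarith
    _ ≤ _ := by nlinarith [mul_nonneg (sq_nonneg C) hE, mul_nonneg (sq_nonneg C) hE']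

lemma tD_cm (h : Bg k C (v - u) x) {c' p' m' : ℝ} :
    (u + v) ^ 2 * (x ^ 3 * (1 - x)) * (|c| * |m'|) ≤
      10 * C ^ 2 * (e0F k u v x c p m + e0F k u v x c' p' m') := by
  have hC := h.C1
  have h1 := tD_c (c := c) (p := p) (m := m) h
  have h2 := tD_u h.sV h.C1 h.x0 h.x1
  have h3 := e0F_m (k := k) (u := u) (v := v) (c := c') (p := p') (m := m') h.x0 h.x1
  have h0 := D_nonneg h.x0 h.x1
  have hE := e0F_nonneg (k := k) (u := u) (v := v) (c := c) (p := p) (m := m) h.x0 h.x1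
  have hE' := e0F_nonneg (k := k) (u := u) (v := v) (c := c') (p := p') (m := m') h.x0 h.x1
  set D := x ^ 3 * (1 - x)
  set E := e0F k u v x c p m
  set E' := e0F k u v x c' p' m'
  calc (u + v) ^ 2 * D * (|c| * |m'|) ≤ (u + v) ^ 2 * D * (1 / 2 * (c ^ 2 + m' ^ 2)) := by
        exact mul_le_mul_of_nonneg_left (amgm c m') (by positivity)
    _ = 1 / 2 * ((u + v) ^ 2 * D * c ^ 2) + 1 / 2 * ((u + v) ^ 2 * D) * m' ^ 2 := by ring
    _ ≤ 1 / 2 * (2 * C ^ 2 * E) + 1 / 2 * (10 * C * (u ^ 2 + 1)) * m' ^ 2 := by gcongr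
    _ = C ^ 2 * E + 5 * C * ((u ^ 2 + 1) * m' ^ 2) := by ring
    _ ≤ C ^ 2 * E + 5 * C * E' := by gcongr
    _ ≤ C ^ 2 * E + 5 * (C * C) * E' := by gcongr; nlinarith
    _ ≤ _ := by nlinarith [mul_nonneg (sq_nonneg C) hE, mul_nonneg (sq_nonneg C) hE']

/-- `t² D |c χ_t| ≤ C e0` -/
lemma tD_ca (h : Bg k C (v - u) x) :
    (u + v) ^ 2 * (x ^ 3 * (1 - x)) * |c * ((p + m) / 2)| ≤ 20 * C ^ 2 * e0F k u v x c p m := by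
  have h1 := tD_cp (c := c) (p := p) (m := m) (c' := c) (p' := p) (m' := m) h
  have h2 := tD_cm (c := c) (p := p) (m := m) (c' := c) (p' := p) (m' := m) h
  have h0 := D_nonneg h.x0 h.x1
  have h3 : |c * ((p + m) / 2)| ≤ 1 / 2 * (|c| * |p|) + 1 / 2 * (|c| * |m|) := by
    rw [abs_mul, abs_div, abs_of_pos (by norm_num : (0:ℝ) < 2)]
    nlinarith [abs_add_le p m, abs_nonneg c]
  set D := x ^ 3 * (1 - x)
  calc (u + v) ^ 2 * D * |c * ((p + m) / 2)|
      ≤ (u + v) ^ 2 * D * (1 / 2 * (|c| * |p|) + 1 / 2 * (|c| * |m|)) := by gcongr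
    _ = 1 / 2 * ((u + v) ^ 2 * D * (|c| * |p|)) + 1 / 2 * ((u + v) ^ 2 * D * (|c| * |m|)) := by
        ring
    _ ≤ _ := by linarith

lemma hp_D (k x : ℝ) : hp k x = 20 * k * (x ^ 3 * (1 - x)) := by unfold hp; ring

lemma e1F_le (h : Bg k C (v - u) x) :
    |e1F k u v x c p m| ≤ (12 + 200 * C ^ 3) * e0F k u v x c p m := by
  have hC := h.C1
  have hE := e0F_nonneg (k := k) (u := u) (v := v) (c := c) (p := p) (m := m) h.x0 h.x1
  have h1 := tD_ca (c := c) (p := p) (m := m) h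
  have hf := fp_abs h.x0 h.x1
  have hV := Vp_nonneg (k := k) h.x0 h.x1
  have h0 := D_nonneg h.x0 h.x1
  have a1 : |fp x * (v ^ 2 * p ^ 2 - u ^ 2 * m ^ 2) + Vp k x * fp x * (v ^ 2 - u ^ 2) * c ^ 2|
      ≤ 12 * e0F k u v x c p m := by
    have e : fp x * (v ^ 2 * p ^ 2 - u ^ 2 * m ^ 2) + Vp k x * fp x * (v ^ 2 - u ^ 2) * c ^ 2
      = fp x * ((v ^ 2 * p ^ 2 - u ^ 2 * m ^ 2) + Vp k x * (v ^ 2 - u ^ 2) * c ^ 2) := by ring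
    rw [e, abs_mul]
    apply mul_le_mul hf _ (abs_nonneg _) (by norm_num)
    unfold e0F
    have g1 : 0 ≤ Vp k x * c ^ 2 := by positivity
    have g2 : 0 ≤ Vp k x * c ^ 2 * u ^ 2 := by positivity
    have g3 : 0 ≤ Vp k x * c ^ 2 * v ^ 2 := by positivity
    have g4 : 0 ≤ v ^ 2 * p ^ 2 := by positivity
    have g5 : 0 ≤ u ^ 2 * m ^ 2 := by positivity
    rw [abs_le]; constructor <;> nlinarith [sq_nonneg p, sq_nonneg m]
  have a2 : |1 / 2 * (u + v) ^ 2 * hp k x * c * ((p + m) / 2)| ≤ 200 * C ^ 3 * e0F k u v x c p m := by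
    have e : 1 / 2 * (u + v) ^ 2 * hp k x * c * ((p + m) / 2)
       = (10 * k * ((u + v) ^ 2 * (x ^ 3 * (1 - x)))) * (c * ((p + m) / 2)) := by rw [hp_D]; ring
    have hk := h.k0
    have hkC := h.kC
    rw [e, abs_mul, abs_of_nonneg (by positivity)]
    calc _ = 10 * k * ((u + v) ^ 2 * (x ^ 3 * (1 - x)) * |c * ((p + m) / 2)|) := by ring
      _ ≤ 10 * C * (20 * C ^ 2 * e0F k u v x c p m) := by gcongr
      _ = _ := by ring
  unfold e1F
  refine (abs_add_le _ _).trans ?_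
  linarith

set_option maxHeartbeats 1000000 in
/-- left flux: nonnegative for small τ -/
lemma q_nonneg (h : Bg k C (v - u) x) (hs : v ≤ u) (hv : 0 ≤ u + v) (hτ : 0 ≤ τ)
    (hτ1 : τ * (1000 * C ^ 3) ≤ 1) : 0 ≤ q0F k u v x c p + τ * q1F k u v x c p := by
  have hC := h.C1
  have hk := h.k0
  have hkC := h.kC
  have hf := abs_le.1 (fp_abs h.x0 h.x1)
  have hV := Vp_nonneg (k := k) h.x0 h.x1
  have h0 := D_nonneg h.x0 h.x1
  have hx0 := h.x0
  have hx1 := h.x1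
  have y0 : 0 ≤ 1 - x := by linarith
  have htv := tD_v h.sV h.C1 h.x0 h.x1
  have C13 : 1 ≤ C ^ 3 := one_le_pow₀ hC
  have htu : (u + v) ^ 2 ≤ 4 * u ^ 2 := by nlinarith
  set D := x ^ 3 * (1 - x) with hD
  have hVD : Vp k x = k ^ 2 * D := Vp_D k x
  have hkC2 : k * C ≥ 1 := by
    have := h.kC'
    rw [div_le_iff₀ hk] at this; linarith
  -- A = v²p²-type, B = V u² c²
  have a1 : -(24 * (v ^ 2 * p ^ 2)) ≤ 2 * fp x * v ^ 2 * p ^ 2 := by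
    nlinarith [mul_nonneg (sq_nonneg v) (sq_nonneg p)]
  have a2 : -(24 * (Vp k x * u ^ 2 * c ^ 2)) ≤ - (2 * Vp k x * fp x * u ^ 2 * c ^ 2) := by
    have : 0 ≤ Vp k x * u ^ 2 * c ^ 2 := by positivity
    nlinarith
  have a3 : -(100 * C ^ 2 * ((v ^ 2 + 1) * p ^ 2) + 40 * C * (Vp k x * u ^ 2 * c ^ 2)) ≤
      1 / 2 * (u + v) ^ 2 * (hp k x * c * p) := by
    have e : 1 / 2 * (u + v) ^ 2 * (hp k x * c * p) = 10 * k * ((u + v) ^ 2 * D * (c * p)) := by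
      rw [hp_D, hD]; ring
    rw [e]
    have b1 : |c * p| ≤ 1 / 2 * (c ^ 2 + p ^ 2) := by rw [abs_mul]; exact amgm c p
    have b2 : -(1 / 2 * (c ^ 2 + p ^ 2)) ≤ c * p := (abs_le.1 b1).1
    have b3 : (u + v) ^ 2 * D * (1 / 2 * (c ^ 2 + p ^ 2)) ≤
        2 * (D * u ^ 2 * c ^ 2) + 5 * C * ((v ^ 2 + 1) * p ^ 2) := by
      calc _ = 1 / 2 * ((u + v) ^ 2) * (D * c ^ 2) + 1 / 2 * ((u + v) ^ 2 * D) * p ^ 2 := by ring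
        _ ≤ 1 / 2 * (4 * u ^ 2) * (D * c ^ 2) + 1 / 2 * (10 * C * (v ^ 2 + 1)) * p ^ 2 := by gcongr
        _ = _ := by ring
    have b4 : -((u + v) ^ 2 * D * (1 / 2 * (c ^ 2 + p ^ 2))) ≤ (u + v) ^ 2 * D * (c * p) := by
      rw [← mul_neg]; gcongr
    have b5 : 10 * k * (2 * (D * u ^ 2 * c ^ 2) + 5 * C * ((v ^ 2 + 1) * p ^ 2)) ≤
        100 * C ^ 2 * ((v ^ 2 + 1) * p ^ 2) + 40 * C * (Vp k x * u ^ 2 * c ^ 2) := by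
      rw [hVD]
      have g1 : 0 ≤ (v ^ 2 + 1) * p ^ 2 := by positivity
      have g2 : 0 ≤ k * (D * u ^ 2 * c ^ 2) := by positivity
      have g3 : k * (D * u ^ 2 * c ^ 2) ≤ k * C * (k * (D * u ^ 2 * c ^ 2)) :=
        le_mul_of_one_le_left g2 hkC2
      have g4 : k * C * ((v ^ 2 + 1) * p ^ 2) ≤ C * C * ((v ^ 2 + 1) * p ^ 2) := by gcongr
      have e2 : 40 * C * (k ^ 2 * D * u ^ 2 * c ^ 2) = 40 * (k * C * (k * (D * u ^ 2 * c ^ 2))) := by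
        ring
      have e3 : 100 * C ^ 2 * ((v ^ 2 + 1) * p ^ 2) = 100 * (C * C * ((v ^ 2 + 1) * p ^ 2)) := by
        ring
      have g5 : 0 ≤ C * C * ((v ^ 2 + 1) * p ^ 2) := by positivity
      rw [e2, e3]
      have e4 : 10 * k * (2 * (D * u ^ 2 * c ^ 2) + 5 * C * ((v ^ 2 + 1) * p ^ 2)) =
        20 * (k * (D * u ^ 2 * c ^ 2)) + 50 * (k * C * ((v ^ 2 + 1) * p ^ 2)) := by ring
      rw [e4]
      linarith
    have b6 := mul_le_mul_of_nonneg_left (b3) (by positivity : 0 ≤ 10 * k)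
    have b7 := mul_le_mul_of_nonneg_left (b4) (by positivity : 0 ≤ 10 * k)
    linarith
  have a4 : -(60 * (Vp k x * u ^ 2 * c ^ 2)) ≤ - (1 / 2 * (u + v) ^ 2 * (1 / 2 * dhp k x * c ^ 2)) := by
    have e : - (1 / 2 * (u + v) ^ 2 * (1 / 2 * dhp k x * c ^ 2)) =
      (u + v) ^ 2 * (5 * (Vp k x * c ^ 2) * (x * (3 - 4 * x))) := by unfold dhp Vp; ring
    rw [e]
    have b1 : -3 ≤ x * (3 - 4 * x) := by nlinarith
    have b2 : 0 ≤ 5 * (Vp k x * c ^ 2) := by positivity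
    calc _ = 4 * u ^ 2 * (-(5 * (Vp k x * c ^ 2) * 3)) := by ring
      _ ≤ (u + v) ^ 2 * (-(5 * (Vp k x * c ^ 2) * 3)) := by
        apply mul_le_mul_of_nonpos_right htu
        rw [neg_nonpos]; positivity
      _ ≤ _ := by
        apply mul_le_mul_of_nonneg_left _ (by positivity)
        have := mul_le_mul_of_nonneg_left b1 b2
        linarith
  have hq1 : -(1000 * C ^ 3 * ((v ^ 2 + 1) * p ^ 2 + Vp k x * (u ^ 2 + 1) * c ^ 2)) ≤ q1F k u v x c p := by
    have e : q1F k u v x c p = 2 * fp x * v ^ 2 * p ^ 2 + - (2 * Vp k x * fp x * u ^ 2 * c ^ 2)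
      + 1 / 2 * (u + v) ^ 2 * (hp k x * c * p) + - (1 / 2 * (u + v) ^ 2 * (1 / 2 * dhp k x * c ^ 2)) := by
      unfold q1F; ring
    rw [e]
    have g1 : 0 ≤ v ^ 2 * p ^ 2 := by positivity
    have g2 : 0 ≤ Vp k x * u ^ 2 * c ^ 2 := by positivity
    have g3 : v ^ 2 * p ^ 2 ≤ C ^ 3 * ((v ^ 2 + 1) * p ^ 2) := by
      calc _ ≤ (v ^ 2 + 1) * p ^ 2 := by gcongr; linarith
        _ ≤ _ := le_mul_of_one_le_left (by positivity) C13
    have g4 : Vp k x * u ^ 2 * c ^ 2 ≤ C ^ 3 * (Vp k x * (u ^ 2 + 1) * c ^ 2) := by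
      calc _ ≤ Vp k x * (u ^ 2 + 1) * c ^ 2 := by gcongr; linarith
        _ ≤ _ := le_mul_of_one_le_left (by positivity) C13
    have g5 : C * (Vp k x * u ^ 2 * c ^ 2) ≤ C ^ 3 * (Vp k x * (u ^ 2 + 1) * c ^ 2) := by
      have : C ≤ C ^ 3 := le_self_pow₀ hC (by norm_num)
      have h3 : Vp k x * u ^ 2 * c ^ 2 ≤ Vp k x * (u ^ 2 + 1) * c ^ 2 := by gcongr; linarith
      exact mul_le_mul this h3 g2 (by positivity)
    have g6 : C ^ 2 * ((v ^ 2 + 1) * p ^ 2) ≤ C ^ 3 * ((v ^ 2 + 1) * p ^ 2) := by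
      gcongr
      norm_num
    linarith
  have hq0 : q0F k u v x c p = 2 * ((v ^ 2 + 1) * p ^ 2 + Vp k x * (u ^ 2 + 1) * c ^ 2) := by
    unfold q0F; ring
  rw [hq0]
  have g : 0 ≤ (v ^ 2 + 1) * p ^ 2 + Vp k x * (u ^ 2 + 1) * c ^ 2 := by positivity
  set Q := (v ^ 2 + 1) * p ^ 2 + Vp k x * (u ^ 2 + 1) * c ^ 2
  have := mul_le_mul_of_nonneg_left hq1 hτ
  have h9 := mul_le_mul_of_nonneg_right hτ1 g
  have e9 : τ * -(1000 * C ^ 3 * Q) = -(τ * (1000 * C ^ 3) * Q) := by ring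
  rw [e9] at this
  linarith

end ptw

section ptw
variable {k C u v x c p m τ ε : ℝ}

lemma npoly (x : ℝ) : 3 / 2 ≤ 33 - 184 * x + 395 * x ^ 2 - 368 * x ^ 3 + 126 * x ^ 4 := by
  nlinarith [sq_nonneg (x ^ 2 - 92 / 63 * x + 1 / 2), sq_nonneg x]

lemma t_pm (x0 : 0 < x) (x1 : x < 1) : (u + v) * |p * m| ≤ e0F k u v x c p m := by
  have h1 := amgm (u * m) p
  have h2 := amgm (v * p) m
  have hV := Vp_nonneg (k := k) x0 x1
  have h3 : (u + v) * |p * m| ≤ |u * m| * |p| + |v * p| * |m| := by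
    have : u + v ≤ |u| + |v| := add_le_add (le_abs_self u) (le_abs_self v)
    calc (u + v) * |p * m| ≤ (|u| + |v|) * |p * m| := by gcongr
      _ = _ := by rw [abs_mul, abs_mul, abs_mul]; ring
  have g : 0 ≤ Vp k x * (u ^ 2 + v ^ 2 + 2) * c ^ 2 := by positivity
  unfold e0F
  have g1 : 0 ≤ v ^ 2 * p ^ 2 := by positivity
  have g2 : 0 ≤ u ^ 2 * m ^ 2 := by positivity
  have e1 : (u * m) ^ 2 = u ^ 2 * m ^ 2 := by ring
  have e2 : (v * p) ^ 2 = v ^ 2 * p ^ 2 := by ring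
  rw [e1] at h1; rw [e2] at h2
  linarith [sq_nonneg p, sq_nonneg m]

lemma aux_hts (ht : 1 ≤ u + v) : (u + v) * (1 + |v - u|) ≤ 3 * (u ^ 2 + v ^ 2 + 2) := by
  have h1 : (u + v) * |v - u| ≤ u ^ 2 + v ^ 2 := by
    have := amgm (u + v) (v - u)
    rw [abs_of_nonneg (by linarith : 0 ≤ u + v)] at this
    linarith
  linarith [sq_nonneg (u - 1), sq_nonneg (v - 1)]

set_option maxHeartbeats 1000000 in
/-- multiplied by `t` -/
lemma b1F_le (h : Bg k C (v - u) x) (ht : 1 ≤ u + v) :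
    (u + v) * b1F k u v x c p m ≤
      -((u + v) * (3 * k * (x ^ 2 * (1 - x)) * (v ^ 2 * p ^ 2 + u ^ 2 * m ^ 2)
        + 3 / 4 * k ^ 3 * ((u + v) ^ 2 * (x ^ 4 * (1 - x)) * c ^ 2)))
      + 1000 * C ^ 3 * e0F k u v x c p m := by
  have hC := h.C1
  have hk := h.k0
  have hkC := h.kC
  have hx0 := h.x0
  have hx1 := h.x1
  have y0 : 0 < 1 - x := by linarith
  have hE := e0F_nonneg (k := k) (u := u) (v := v) (c := c) (p := p) (m := m) h.x0 h.x1
  have hca := tD_ca (c := c) (p := p) (m := m) h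
  have hpm := t_pm (k := k) (u := u) (v := v) (c := c) (p := p) (m := m) h.x0 h.x1
  have hcD := e0F_cD (u := u) (v := v) (c := c) (p := p) (m := m) h.k0 h.kC' h.x0 h.x1
  have hcV := e0F_c (k := k) (u := u) (v := v) (c := c) (p := p) (m := m) h.x0 h.x1
  have hf := abs_le.1 (fp_abs h.x0 h.x1)
  have hV := Vp_nonneg (k := k) h.x0 h.x1
  have h0 := D_nonneg h.x0 h.x1
  have hsF := h.sF
  have hsV := h.sV
  set E := e0F k u v x c p m with hEdef
  have e : b1F k u v x c p m =
      -((dfp k x - hp k x) * (v ^ 2 * p ^ 2 + u ^ 2 * m ^ 2)) - hp k x * (v * p - u * m) ^ 2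
      + 10 * k * ((v - u) ^ 2 * (x ^ 3 * (1 - x))) * (p * m)
      - 1 / 2 * k ^ 3 * ((u + v) ^ 2 * (x ^ 4 * (1 - x)) * c ^ 2) *
         (33 - 184 * x + 395 * x ^ 2 - 368 * x ^ 3 + 126 * x ^ 4)
      + 1 / 2 * ((v - u) ^ 2 * dVf k x) * c ^ 2
      + 2 * (v - u) * Vp k x * fp x * c ^ 2
      + 20 * k * ((u + v) * (x ^ 3 * (1 - x)) * (c * ((p + m) / 2))) := by
    unfold b1F dfp hp dVf ddhp Vp fp
    ring
  have t1 : 3 * k * (x ^ 2 * (1 - x)) * (v ^ 2 * p ^ 2 + u ^ 2 * m ^ 2) ≤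
      (dfp k x - hp k x) * (v ^ 2 * p ^ 2 + u ^ 2 * m ^ 2) := by
    apply mul_le_mul_of_nonneg_right _ (by positivity)
    have e : dfp k x - hp k x = k * (x ^ 2 * (1 - x)) * (5 + 54 * x ^ 2 - 20 * x) := by
      unfold dfp hp; ring
    rw [e]
    have : 3 ≤ 5 + 54 * x ^ 2 - 20 * x := by nlinarith [sq_nonneg (54 * x - 10)]
    calc 3 * k * (x ^ 2 * (1 - x)) = k * (x ^ 2 * (1 - x)) * 3 := by ring
      _ ≤ _ := by gcongr
  have t2 : 0 ≤ hp k x * (v * p - u * m) ^ 2 := by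
    rw [hp_D]; positivity
  have t3 : (u + v) * (10 * k * ((v - u) ^ 2 * (x ^ 3 * (1 - x))) * (p * m)) ≤ 10 * C ^ 2 * E := by
    calc _ ≤ (u + v) * (10 * k * ((v - u) ^ 2 * (x ^ 3 * (1 - x))) * |p * m|) := by
          gcongr; exact le_abs_self _
      _ = 10 * k * ((v - u) ^ 2 * (x ^ 3 * (1 - x))) * ((u + v) * |p * m|) := by ring
      _ ≤ 10 * C * C * E := by gcongr
      _ = _ := by ring
  have t4 : 3 / 4 * k ^ 3 * ((u + v) ^ 2 * (x ^ 4 * (1 - x)) * c ^ 2) ≤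
      1 / 2 * k ^ 3 * ((u + v) ^ 2 * (x ^ 4 * (1 - x)) * c ^ 2) *
         (33 - 184 * x + 395 * x ^ 2 - 368 * x ^ 3 + 126 * x ^ 4) := by
    have := npoly x
    calc _ = 1 / 2 * k ^ 3 * ((u + v) ^ 2 * (x ^ 4 * (1 - x)) * c ^ 2) * (3 / 2) := by ring
      _ ≤ _ := by gcongr
  have hts := aux_hts ht
  have t5 : (u + v) * (1 / 2 * ((v - u) ^ 2 * dVf k x) * c ^ 2) ≤ 2 * C ^ 3 * E := by
    calc _ ≤ (u + v) * (1 / 2 * (C * (1 + |v - u|) * (x ^ 3 * (1 - x))) * c ^ 2) := by gcongr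
      _ = 1 / 2 * C * (x ^ 3 * (1 - x)) * ((u + v) * (1 + |v - u|)) * c ^ 2 := by ring
      _ ≤ 1 / 2 * C * (x ^ 3 * (1 - x)) * (3 * (u ^ 2 + v ^ 2 + 2)) * c ^ 2 := by gcongr
      _ = 3 / 2 * C * ((x ^ 3 * (1 - x)) * (u ^ 2 + v ^ 2 + 2) * c ^ 2) := by ring
      _ ≤ 3 / 2 * C * (C ^ 2 * E) := by gcongr
      _ ≤ _ := by
        have : 0 ≤ C * (C ^ 2 * E) := by positivity
        linarith
  have t6 : (u + v) * (2 * (v - u) * Vp k x * fp x * c ^ 2) ≤ 72 * E := by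
    have g : (v - u) * fp x ≤ (1 + |v - u|) * 12 := by
      calc (v - u) * fp x ≤ |(v - u) * fp x| := le_abs_self _
        _ = |v - u| * |fp x| := abs_mul _ _
        _ ≤ (1 + |v - u|) * 12 := by
          apply mul_le_mul (by linarith) (abs_le.2 hf) (abs_nonneg _) (by positivity)
    calc _ = (u + v) * (2 * Vp k x * ((v - u) * fp x) * c ^ 2) := by ring
      _ ≤ (u + v) * (2 * Vp k x * ((1 + |v - u|) * 12) * c ^ 2) := by gcongr
      _ = 24 * Vp k x * ((u + v) * (1 + |v - u|)) * c ^ 2 := by ring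
      _ ≤ 24 * Vp k x * (3 * (u ^ 2 + v ^ 2 + 2)) * c ^ 2 := by gcongr
      _ = 72 * (Vp k x * (u ^ 2 + v ^ 2 + 2) * c ^ 2) := by ring
      _ ≤ _ := by gcongr
  have t7 : (u + v) * (20 * k * ((u + v) * (x ^ 3 * (1 - x)) * (c * ((p + m) / 2)))) ≤
      400 * C ^ 3 * E := by
    calc _ = 20 * k * ((u + v) ^ 2 * (x ^ 3 * (1 - x)) * (c * ((p + m) / 2))) := by ring
      _ ≤ 20 * k * ((u + v) ^ 2 * (x ^ 3 * (1 - x)) * |c * ((p + m) / 2)|) := by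
          gcongr; exact le_abs_self _
      _ ≤ 20 * C * (20 * C ^ 2 * E) := by gcongr
      _ = _ := by ring
  have t0 : 0 ≤ u + v := by linarith
  have u1 := mul_le_mul_of_nonneg_left t1 t0
  have u2 := mul_nonneg t0 t2
  have u4 := mul_le_mul_of_nonneg_left t4 t0
  have c1 : E ≤ C ^ 3 * E := le_mul_of_one_le_left hE (one_le_pow₀ hC)
  have c2 : C ^ 2 * E ≤ C ^ 3 * E := by gcongr; norm_num
  rw [e]
  have c3 : 0 ≤ C ^ 3 * E := by positivity
  linarith

set_option maxHeartbeats 1000000 in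
/-- total bulk bound for one field, without source -/
lemma bulk_le (h : Bg k C (v - u) x) (ht : 1 ≤ u + v) (hτ : 0 < τ) (e0 : 0 ≤ ε) (e1 : ε ≤ 1)
    (hb : 4 * C ≤ k ^ 3 * ((u + v) * τ)) :
    b0F k u v x c + τ * b1F k u v x c p m - ε * τ / (u + v) * e1F k u v x c p m ≤
      -(min (3 * k) (k ^ 3 / 2) * τ * betaF u v x c p m)
        + 2000 * C ^ 3 * (τ / (u + v)) * e0F k u v x c p m := by
  have hC := h.C1
  have hk := h.k0
  have hx0 := h.x0
  have hx1 := h.x1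
  have y0 : 0 < 1 - x := by linarith
  have t0 : 0 < u + v := by linarith
  have hE := e0F_nonneg (k := k) (u := u) (v := v) (c := c) (p := p) (m := m) h.x0 h.x1
  have hb1 := b1F_le (c := c) (p := p) (m := m) h ht
  have he1 := e1F_le (c := c) (p := p) (m := m) h
  have hW := h.W
  set E := e0F k u v x c p m with hEdef
  set t := u + v with htdef
  set Y := x ^ 4 * (1 - x) with hY
  have Y0 : 0 ≤ Y := by positivity
  have a0 : b0F k u v x c ≤ τ * (1 / 4 * k ^ 3 * (t ^ 2 * Y * c ^ 2)) := by
    unfold b0F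
    calc t * Wp k (v - u) x * c ^ 2 ≤ t * (C * Y) * c ^ 2 := by gcongr
      _ = 1 / 4 * (4 * C) * (t * Y * c ^ 2) := by ring
      _ ≤ 1 / 4 * (k ^ 3 * (t * τ)) * (t * Y * c ^ 2) := by gcongr
      _ = _ := by ring
  have a1 : b1F k u v x c p m ≤ -((3 * k * (x ^ 2 * (1 - x)) * (v ^ 2 * p ^ 2 + u ^ 2 * m ^ 2)
        + 3 / 4 * k ^ 3 * (t ^ 2 * Y * c ^ 2))) + 1000 * C ^ 3 * E / t := by
    rw [← sub_nonneg]
    have : 0 ≤ (t)⁻¹ * (-(t * (3 * k * (x ^ 2 * (1 - x)) * (v ^ 2 * p ^ 2 + u ^ 2 * m ^ 2)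
        + 3 / 4 * k ^ 3 * (t ^ 2 * Y * c ^ 2))) + 1000 * C ^ 3 * E - t * b1F k u v x c p m) := by
      apply mul_nonneg (by positivity); linarith
    convert this using 1
    field_simp
  have a2 : - (ε * τ / t * e1F k u v x c p m) ≤ τ / t * ((12 + 200 * C ^ 3) * E) := by
    calc - (ε * τ / t * e1F k u v x c p m) ≤ |ε * τ / t * e1F k u v x c p m| := neg_le_abs _
      _ = ε * τ / t * |e1F k u v x c p m| := by
        rw [abs_mul, abs_of_nonneg (by positivity : 0 ≤ ε * τ / t)]
      _ ≤ 1 * τ / t * ((12 + 200 * C ^ 3) * E) := by gcongr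
      _ = _ := by ring
  have a3 : min (3 * k) (k ^ 3 / 2) * τ * betaF u v x c p m ≤
      τ * (3 * k * (x ^ 2 * (1 - x)) * (v ^ 2 * p ^ 2 + u ^ 2 * m ^ 2)
        + 1 / 2 * k ^ 3 * (t ^ 2 * Y * c ^ 2)) := by
    unfold betaF
    rw [← htdef, ← hY]
    have g1 : min (3 * k) (k ^ 3 / 2) * (x ^ 2 * (1 - x) * (v ^ 2 * p ^ 2 + u ^ 2 * m ^ 2)) ≤
      3 * k * (x ^ 2 * (1 - x) * (v ^ 2 * p ^ 2 + u ^ 2 * m ^ 2)) := by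
      gcongr; exact min_le_left _ _
    have g2 : min (3 * k) (k ^ 3 / 2) * (t ^ 2 * Y * c ^ 2) ≤ k ^ 3 / 2 * (t ^ 2 * Y * c ^ 2) := by
      gcongr; exact min_le_right _ _
    calc _ = τ * (min (3 * k) (k ^ 3 / 2) * (x ^ 2 * (1 - x) * (v ^ 2 * p ^ 2 + u ^ 2 * m ^ 2)) +
        min (3 * k) (k ^ 3 / 2) * (t ^ 2 * Y * c ^ 2)) := by ring
      _ ≤ τ * (3 * k * (x ^ 2 * (1 - x) * (v ^ 2 * p ^ 2 + u ^ 2 * m ^ 2)) +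
          k ^ 3 / 2 * (t ^ 2 * Y * c ^ 2)) := by gcongr
      _ = _ := by ring
  have a1' := mul_le_mul_of_nonneg_left a1 hτ.le
  have c0 : 0 ≤ τ / t * E := by positivity
  have c1 : τ / t * E ≤ C ^ 3 * (τ / t * E) := le_mul_of_one_le_left c0 (one_le_pow₀ hC)
  have e5 : τ * (1000 * C ^ 3 * E / t) = 1000 * (C ^ 3 * (τ / t * E)) := by ring
  have e6 : τ / t * ((12 + 200 * C ^ 3) * E) = 12 * (τ / t * E) + 200 * (C ^ 3 * (τ / t * E)) := by
    ring
  have e7 : 2000 * C ^ 3 * (τ / t) * E = 2000 * (C ^ 3 * (τ / t * E)) := by ring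
  rw [e6] at a2
  rw [mul_add, e5] at a1'
  rw [e7]
  have c2 : 0 ≤ C ^ 3 * (τ / t * E) := by positivity
  linarith

end ptw

section ptw
variable {k C u v x c p m τ ε : ℝ}

lemma aux_abs_src (h : Bg k C (v - u) x) (hτ : 0 < τ) (hτ1 : τ ≤ 1) :
    |s0F u v p m + τ * s1F k u v x c p m| ≤ 26 * ((v ^ 2 + 1) * |p| + (u ^ 2 + 1) * |m|)
      + 10 * k * ((u + v) ^ 2 * (x ^ 3 * (1 - x)) * |c|) := by
  have hk := h.k0
  have h0 := D_nonneg h.x0 h.x1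
  have hf := fp_abs h.x0 h.x1
  have a1 : |s0F u v p m| ≤ 2 * ((v ^ 2 + 1) * |p| + (u ^ 2 + 1) * |m|) := by
    unfold s0F
    rw [abs_neg, abs_mul, abs_of_pos (by norm_num : (0:ℝ) < 2)]
    gcongr
    refine (abs_add_le _ _).trans ?_
    rw [abs_mul, abs_mul, abs_of_nonneg (by positivity : 0 ≤ v ^ 2 + 1),
      abs_of_nonneg (by positivity : 0 ≤ u ^ 2 + 1)]
  have a2 : |s1F k u v x c p m| ≤ 24 * ((v ^ 2 + 1) * |p| + (u ^ 2 + 1) * |m|)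
      + 10 * k * ((u + v) ^ 2 * (x ^ 3 * (1 - x)) * |c|) := by
    unfold s1F
    rw [abs_neg]
    refine (abs_add_le _ _).trans ?_
    apply add_le_add
    · have e : 2 * fp x * (v ^ 2 * p - u ^ 2 * m) = 2 * (fp x * (v ^ 2 * p - u ^ 2 * m)) := by ring
      rw [e, abs_mul, abs_mul, abs_of_pos (by norm_num : (0:ℝ) < 2)]
      have : |v ^ 2 * p - u ^ 2 * m| ≤ (v ^ 2 + 1) * |p| + (u ^ 2 + 1) * |m| := by
        refine (abs_sub _ _).trans ?_
        rw [abs_mul, abs_mul, abs_of_nonneg (sq_nonneg v), abs_of_nonneg (sq_nonneg u)]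
        gcongr <;> linarith
      calc _ ≤ 2 * (12 * ((v ^ 2 + 1) * |p| + (u ^ 2 + 1) * |m|)) := by gcongr
        _ = _ := by ring
    · have e : 1 / 2 * (u + v) ^ 2 * hp k x * c = (10 * k * ((u + v) ^ 2 * (x ^ 3 * (1 - x)))) * c := by
        rw [hp_D]; ring
      rw [e, abs_mul, abs_of_nonneg (by positivity)]
      apply le_of_eq; ring
  refine (abs_add_le _ _).trans ?_
  rw [abs_mul, abs_of_pos hτ]
  have a3 : τ * |s1F k u v x c p m| ≤ |s1F k u v x c p m| :=
    mul_le_of_le_one_left (abs_nonneg _) hτ1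
  linarith

/-- `D v² |c0 p| ≤ ...` -/
lemma aux_i (x0 : 0 < x) (x1 : x < 1) {t c0 l : ℝ} (hv : |v| ≤ t) (hl : 0 < l) :
    (x ^ 3 * (1 - x)) * |c0| * (v ^ 2 * |p|) ≤
      1 / 2 * (l * (x ^ 2 * (1 - x) * (v ^ 2 * p ^ 2)) + l⁻¹ * (t ^ 2 * (x ^ 4 * (1 - x)) * c0 ^ 2)) := by
  have y0 : 0 ≤ 1 - x := by linarith
  have t0 : 0 ≤ t := (abs_nonneg v).trans hv
  have h := amgml (x * v * p) (x ^ 2 * t * c0) l hl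
  rw [abs_mul, abs_mul, abs_mul, abs_mul, abs_of_pos x0, abs_of_nonneg (by positivity : 0 ≤ x ^ 2),
    abs_of_nonneg t0] at h
  calc (x ^ 3 * (1 - x)) * |c0| * (v ^ 2 * |p|) = (x ^ 3 * (1 - x)) * |c0| * (|v| * |v| * |p|) := by
        rw [abs_mul_abs_self]; ring
    _ ≤ (x ^ 3 * (1 - x)) * |c0| * (t * |v| * |p|) := by gcongr
    _ = (1 - x) * (x * |v| * |p| * (x ^ 2 * t * |c0|)) := by ring
    _ ≤ (1 - x) * (1 / 2 * (l * (x * v * p) ^ 2 + l⁻¹ * (x ^ 2 * t * c0) ^ 2)) := by gcongr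
    _ = _ := by ring

lemma aux_iv (x0 : 0 < x) (x1 : x < 1) {t c0 l : ℝ} (hl : 0 < l) :
    (x ^ 3 * (1 - x)) * |c0| * (t ^ 2 * (x ^ 3 * (1 - x)) * |c|) ≤
      1 / 2 * (l * (t ^ 2 * (x ^ 4 * (1 - x)) * c ^ 2) + l⁻¹ * (t ^ 2 * (x ^ 4 * (1 - x)) * c0 ^ 2)) := by
  have y0 : 0 ≤ 1 - x := by linarith
  have h := amgml c c0 l hl
  have h2 : x ^ 2 * (1 - x) ≤ 1 := by
    have : x ^ 2 ≤ 1 := pow_le_one₀ x0.le x1.le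
    calc x ^ 2 * (1 - x) ≤ 1 * (1 - x) := by gcongr
      _ ≤ 1 := by linarith
  calc _ = t ^ 2 * (x ^ 4 * (1 - x)) * (|c| * |c0|) * (x ^ 2 * (1 - x)) := by ring
    _ ≤ t ^ 2 * (x ^ 4 * (1 - x)) * (|c| * |c0|) * 1 := by gcongr
    _ ≤ t ^ 2 * (x ^ 4 * (1 - x)) * (1 / 2 * (l * c ^ 2 + l⁻¹ * c0 ^ 2)) * 1 := by gcongr
    _ = _ := by ring

lemma aux_tt {t : ℝ} (t0 : 0 < t) (h : 1 ≤ t * τ ^ 2) : 1 / t ^ 2 ≤ τ ^ 2 / t := by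
  rw [div_le_div_iff₀ (by positivity) t0]
  calc 1 * t ≤ (t * τ ^ 2) * t := by gcongr
    _ = _ := by ring

set_option maxHeartbeats 1000000 in
lemma src_le {C2 θ c0 p0 m0 : ℝ} (h : Bg k C (v - u) x) (ht : 1 ≤ u + v) (hτ : 0 < τ) (hτ1 : τ ≤ 1)
    (hτt : 1 ≤ (u + v) * τ ^ 2) (hθ : 0 < θ) (hC2 : 1 ≤ C2)
    (hs : (|v - u| ≤ u + v ∧ τ * |Wp k (v - u) x| ≤ C2 * (x ^ 3 * (1 - x))) ∨
      Wp k (v - u) x ^ 2 * (u + v) ^ 2 ≤ C2 * τ ^ 2 * (x ^ 3 * (1 - x))) :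
    τ ^ 4 * (Wp k (v - u) x * c0 * (s0F u v p m + τ * s1F k u v x c p m)) ≤
      θ * τ ^ 5 * betaF u v x c p m
      + C2 ^ 2 * (13 + 5 * C) * (26 + 5 * C) / θ * τ * betaF u v x c0 p0 m0
      + (520 * C2 * C ^ 2 + C2 * C ^ 2 * (52 + 10 * C)) * (τ / (u + v)) *
        (τ ^ 4 * (e0F k u v x c0 p0 m0 + e0F k u v x c p m)) := by
  have hC := h.C1
  have hk := h.k0
  have hkC := h.kC
  have x0 := h.x0
  have x1 := h.x1
  have y0 : 0 < 1 - x := by linarith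
  have t0 : 0 < u + v := by linarith
  have hE := e0F_nonneg (k := k) (u := u) (v := v) (c := c) (p := p) (m := m) x0 x1
  have hE0 := e0F_nonneg (k := k) (u := u) (v := v) (c := c0) (p := p0) (m := m0) x0 x1
  have hX := aux_abs_src (c := c) (p := p) (m := m) h hτ hτ1
  have hD0 := D_nonneg x0 x1
  have hB0 : 0 ≤ betaF u v x c0 p0 m0 := betaF_nonneg x0 x1
  have hB : 0 ≤ betaF u v x c p m := betaF_nonneg x0 x1
  have hcp := tD_cp (c := c0) (p := p0) (m := m0) (c' := c) (p' := p) (m' := m) h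
  have hcm := tD_cm (c := c0) (p := p0) (m := m0) (c' := c) (p' := p) (m' := m) h
  have hc1 := tD_c (c := c) (p := p) (m := m) h
  have hc0 := tD_c (c := c0) (p := p0) (m := m0) h
  have hcD0 := e0F_cD (u := u) (v := v) (c := c0) (p := p0) (m := m0) hk h.kC' x0 x1
  have hp1 := e0F_p (k := k) (u := u) (v := v) (c := c) (p := p) (m := m) x0 x1
  have hm1 := e0F_m (k := k) (u := u) (v := v) (c := c) (p := p) (m := m) x0 x1
  have hD1 := D_le x0 x1
  set E := e0F k u v x c p m with hEd
  set E0 := e0F k u v x c0 p0 m0 with hE0d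
  set W := Wp k (v - u) x with hW
  set X := s0F u v p m + τ * s1F k u v x c p m with hXd
  set t := u + v with htd
  have start : τ ^ 4 * (W * c0 * X) ≤ τ ^ 4 * (|W| * |c0| *
      (26 * ((v ^ 2 + 1) * |p| + (u ^ 2 + 1) * |m|) + 10 * k * (t ^ 2 * (x ^ 3 * (1 - x)) * |c|))) := by
    apply mul_le_mul_of_nonneg_left _ (by positivity)
    calc W * c0 * X ≤ |W * c0 * X| := le_abs_self _
      _ = |W| * |c0| * |X| := by rw [abs_mul, abs_mul]
      _ ≤ _ := by gcongr
  refine start.trans ?_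
  rcases hs with ⟨hs, hw⟩ | hw
  · -- case 1
    have hsa := abs_le.1 hs
    have hv : |v| ≤ t := by rw [abs_le]; constructor <;> linarith
    have hu : |u| ≤ t := by rw [abs_le]; constructor <;> linarith
    set l := θ * τ ^ 2 / (C2 * (13 + 5 * C)) with hl
    have l0 : 0 < l := by positivity
    have i1 := aux_i (p := p) x0 x1 (c0 := c0) hv l0
    have i2 := aux_i (v := u) (p := m) x0 x1 (c0 := c0) hu l0
    have i4 := aux_iv (c := c) (t := t) (c0 := c0) x0 x1 l0
    have i3 : (x ^ 3 * (1 - x)) * |c0| * |p| ≤ 10 * C ^ 2 * (E0 + E) * (τ ^ 2 / t) := by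
      have : (x ^ 3 * (1 - x)) * |c0| * |p| = (t ^ 2 * (x ^ 3 * (1 - x)) * (|c0| * |p|)) * (1 / t ^ 2) := by
        field_simp
      rw [this]
      have g := aux_tt t0 hτt
      gcongr
    have i3' : (x ^ 3 * (1 - x)) * |c0| * |m| ≤ 10 * C ^ 2 * (E0 + E) * (τ ^ 2 / t) := by
      have : (x ^ 3 * (1 - x)) * |c0| * |m| = (t ^ 2 * (x ^ 3 * (1 - x)) * (|c0| * |m|)) * (1 / t ^ 2) := by
        field_simp
      rw [this]
      have g := aux_tt t0 hτt
      gcongr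
    have bd : x ^ 2 * (1 - x) * (v ^ 2 * p ^ 2) + x ^ 2 * (1 - x) * (u ^ 2 * m ^ 2)
        + t ^ 2 * (x ^ 4 * (1 - x)) * c ^ 2 = betaF u v x c p m := by unfold betaF; ring
    have bd0 : t ^ 2 * (x ^ 4 * (1 - x)) * c0 ^ 2 ≤ betaF u v x c0 p0 m0 := by
      unfold betaF
      have : 0 ≤ x ^ 2 * (1 - x) * (v ^ 2 * p0 ^ 2 + u ^ 2 * m0 ^ 2) := by positivity
      linarith
    set D := x ^ 3 * (1 - x)
    set P1 := x ^ 2 * (1 - x) * (v ^ 2 * p ^ 2) with hP1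
    set P2 := x ^ 2 * (1 - x) * (u ^ 2 * m ^ 2) with hP2
    set P3 := t ^ 2 * (x ^ 4 * (1 - x)) * c ^ 2 with hP3
    set P0 := t ^ 2 * (x ^ 4 * (1 - x)) * c0 ^ 2 with hP0
    have P10 : 0 ≤ P1 := by positivity
    have P20 : 0 ≤ P2 := by positivity
    have P30 : 0 ≤ P3 := by positivity
    have P00 : 0 ≤ P0 := by positivity
    set Sg := E0 + E with hSg
    have hSg0 : 0 ≤ Sg := by positivity
    have s1 : D * |c0| * (26 * ((v ^ 2 + 1) * |p| + (u ^ 2 + 1) * |m|) + 10 * k * (t ^ 2 * D * |c|)) ≤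
        (13 + 5 * C) * l * betaF u v x c p m + (26 + 5 * C) * l⁻¹ * P0
          + 520 * C ^ 2 * Sg * (τ ^ 2 / t) := by
      have e : D * |c0| * (26 * ((v ^ 2 + 1) * |p| + (u ^ 2 + 1) * |m|) + 10 * k * (t ^ 2 * D * |c|))
        = 26 * (D * |c0| * (v ^ 2 * |p|)) + 26 * (D * |c0| * (u ^ 2 * |m|)) + 26 * (D * |c0| * |p|)
         + 26 * (D * |c0| * |m|) + 10 * (k * (D * |c0| * (t ^ 2 * D * |c|))) := by ring
      rw [e]
      have j4 : k * (D * |c0| * (t ^ 2 * D * |c|)) ≤ C * (1 / 2 * (l * P3 + l⁻¹ * P0)) := by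
        apply mul_le_mul hkC i4 (by positivity) (by positivity)
      rw [← bd]
      have j5 : 0 ≤ C * l * P1 := by positivity
      have j6 : 0 ≤ C * l * P2 := by positivity
      have j7 : 0 ≤ l * P3 := by positivity
      have e2 : (13 + 5 * C) * l * (P1 + P2 + P3) + (26 + 5 * C) * l⁻¹ * P0
          + 520 * C ^ 2 * Sg * (τ ^ 2 / t) = 13 * (l * P1) + 13 * (l * P2) + 13 * (l * P3) + 5 * (C * l * P1)
          + 5 * (C * l * P2) + 10 * (C * (1 / 2 * (l * P3 + l⁻¹ * P0))) + 26 * (l⁻¹ * P0)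
          + 52 * (10 * C ^ 2 * Sg * (τ ^ 2 / t)) := by ring
      rw [e2]
      linarith
    set Xb := 26 * ((v ^ 2 + 1) * |p| + (u ^ 2 + 1) * |m|) + 10 * k * (t ^ 2 * D * |c|) with hXb
    have hXb0 : 0 ≤ Xb := by positivity
    calc τ ^ 4 * (|W| * |c0| * Xb) = τ ^ 3 * ((τ * |W|) * |c0| * Xb) := by ring
      _ ≤ τ ^ 3 * ((C2 * D) * |c0| * Xb) := by gcongr
      _ = τ ^ 3 * C2 * (D * |c0| * Xb) := by ring
      _ ≤ τ ^ 3 * C2 * ((13 + 5 * C) * l * betaF u v x c p m + (26 + 5 * C) * l⁻¹ * P0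
          + 520 * C ^ 2 * Sg * (τ ^ 2 / t)) := by gcongr
      _ = θ * τ ^ 5 * betaF u v x c p m + C2 ^ 2 * (13 + 5 * C) * (26 + 5 * C) / θ * τ * P0
          + 520 * C2 * C ^ 2 * (τ / t) * (τ ^ 4 * Sg) := by
        rw [hl]; field_simp
      _ ≤ θ * τ ^ 5 * betaF u v x c p m
          + C2 ^ 2 * (13 + 5 * C) * (26 + 5 * C) / θ * τ * betaF u v x c0 p0 m0
          + (520 * C2 * C ^ 2 + C2 * C ^ 2 * (52 + 10 * C)) * (τ / t) * (τ ^ 4 * Sg) := by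
        gcongr
        have : 0 ≤ C2 * C ^ 2 * (52 + 10 * C) := by positivity
        linarith
  · -- case 2
    set D := x ^ 3 * (1 - x)
    set l := τ / t with hl
    have l0 : 0 < l := by positivity
    have hw' : l⁻¹ * W ^ 2 ≤ C2 * l * D := by
      have : l⁻¹ * W ^ 2 = (W ^ 2 * t ^ 2) * (1 / (τ * t)) := by rw [hl]; field_simp
      rw [this]
      calc _ ≤ (C2 * τ ^ 2 * D) * (1 / (τ * t)) := by gcongr
        _ = _ := by rw [hl]; field_simp
    have C21 : 1 ≤ C2 * C ^ 2 := one_le_mul_of_one_le_of_one_le hC2 (one_le_pow₀ hC)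
    set Sg := E0 + E with hSg
    have hSg0 : 0 ≤ Sg := by positivity
    have gen : ∀ w q : ℝ, 0 ≤ w → w * q ^ 2 ≤ 2 * E → D * w * c0 ^ 2 ≤ 2 * C ^ 2 * E0 →
        |W| * |c0| * (w * |q|) ≤ C2 * C ^ 2 * l * Sg := by
      intro w q w0 hq hcc
      have a := amgml q (W * c0) l l0
      rw [abs_mul W c0] at a
      calc |W| * |c0| * (w * |q|) = w * (|q| * (|W| * |c0|)) := by ring
        _ ≤ w * (1 / 2 * (l * q ^ 2 + l⁻¹ * (W * c0) ^ 2)) := by gcongr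
        _ = 1 / 2 * l * (w * q ^ 2) + 1 / 2 * (l⁻¹ * W ^ 2) * (w * c0 ^ 2) := by ring
        _ ≤ 1 / 2 * l * (2 * E) + 1 / 2 * (C2 * l * D) * (w * c0 ^ 2) := by gcongr
        _ = l * E + 1 / 2 * C2 * l * (D * w * c0 ^ 2) := by ring
        _ ≤ l * E + 1 / 2 * C2 * l * (2 * C ^ 2 * E0) := by gcongr
        _ = 1 * (l * E) + C2 * C ^ 2 * (l * E0) := by ring
        _ ≤ C2 * C ^ 2 * (l * E) + C2 * C ^ 2 * (l * E0) := by gcongr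
        _ = _ := by rw [hSg]; ring
    have C2E0 : 0 ≤ C ^ 2 * E0 := by positivity
    have g1 := gen (v ^ 2 + 1) p (by positivity) (by linarith) (by
      calc D * (v ^ 2 + 1) * c0 ^ 2 ≤ D * (u ^ 2 + v ^ 2 + 2) * c0 ^ 2 := by
            gcongr <;> linarith [sq_nonneg u]
        _ ≤ _ := by linarith)
    have g2 := gen (u ^ 2 + 1) m (by positivity) (by linarith) (by
      calc D * (u ^ 2 + 1) * c0 ^ 2 ≤ D * (u ^ 2 + v ^ 2 + 2) * c0 ^ 2 := by
            gcongr <;> linarith [sq_nonneg v]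
        _ ≤ _ := by linarith)
    have g3 : |W| * |c0| * (t ^ 2 * D * |c|) ≤ C2 * C ^ 2 * l * Sg := by
      have a := amgml c (W * c0) l l0
      rw [abs_mul W c0] at a
      calc |W| * |c0| * (t ^ 2 * D * |c|) = t ^ 2 * D * (|c| * (|W| * |c0|)) := by ring
        _ ≤ t ^ 2 * D * (1 / 2 * (l * c ^ 2 + l⁻¹ * (W * c0) ^ 2)) := by gcongr
        _ = 1 / 2 * l * (t ^ 2 * D * c ^ 2) + 1 / 2 * (l⁻¹ * W ^ 2) * (t ^ 2 * D * c0 ^ 2) := by ring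
        _ ≤ 1 / 2 * l * (2 * C ^ 2 * E) + 1 / 2 * (C2 * l * D) * (2 * C ^ 2 * E0) := by gcongr
        _ ≤ 1 / 2 * l * (2 * C ^ 2 * E) + 1 / 2 * (C2 * l * 1) * (2 * C ^ 2 * E0) := by gcongr
        _ = 1 * (C ^ 2 * l * E) + C2 * (C ^ 2 * l * E0) := by ring
        _ ≤ C2 * (C ^ 2 * l * E) + C2 * (C ^ 2 * l * E0) := by gcongr
        _ = _ := by rw [hSg]; ring
    have g3' : k * (|W| * |c0| * (t ^ 2 * D * |c|)) ≤ C * (C2 * C ^ 2 * l * Sg) :=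
      mul_le_mul hkC g3 (by positivity) (by positivity)
    have s1 : |W| * |c0| * (26 * ((v ^ 2 + 1) * |p| + (u ^ 2 + 1) * |m|) + 10 * k * (t ^ 2 * D * |c|)) ≤
        C2 * C ^ 2 * (52 + 10 * C) * l * Sg := by
      calc _ = 26 * (|W| * |c0| * ((v ^ 2 + 1) * |p|)) + 26 * (|W| * |c0| * ((u ^ 2 + 1) * |m|))
          + 10 * (k * (|W| * |c0| * (t ^ 2 * D * |c|))) := by ring
        _ ≤ 26 * (C2 * C ^ 2 * l * Sg) + 26 * (C2 * C ^ 2 * l * Sg) + 10 * (C * (C2 * C ^ 2 * l * Sg)) := by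
          gcongr
        _ = _ := by ring
    calc _ ≤ τ ^ 4 * (C2 * C ^ 2 * (52 + 10 * C) * l * Sg) := by gcongr
      _ = (C2 * C ^ 2 * (52 + 10 * C)) * l * (τ ^ 4 * Sg) := by ring
      _ ≤ (520 * C2 * C ^ 2 + C2 * C ^ 2 * (52 + 10 * C)) * l * (τ ^ 4 * Sg) := by
        gcongr
        have : 0 ≤ 520 * C2 * C ^ 2 := by positivity
        linarith
      _ ≤ _ := by
        have a1 : 0 ≤ θ * τ ^ 5 * betaF u v x c p m := by positivity
        have a2 : 0 ≤ C2 ^ 2 * (13 + 5 * C) * (26 + 5 * C) / θ * τ * betaF u v x c0 p0 m0 := by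
          positivity
        linarith

end ptw


lemma pd_t_mul_s (a : ℝ → ℝ) (f : ℝ → ℝ → ℝ) :
    pd_t (fun t s => a s * f t s) = fun t s => a s * pd_t f t s := by
  funext t s; unfold pd_t; exact deriv_const_mul_field _

/-- the rescaled, time-shifted field -/
def psiF (r : ℝ → ℝ) (φ : ℝ → ℝ → ℝ) (a : ℝ) : ℝ → ℝ → ℝ := fun t s => r s * φ (t - a) s

section field
variable {M : ℝ} {r : ℝ → ℝ} {φ : ℝ → ℝ → ℝ}

lemma pd_t_shift (f : ℝ → ℝ → ℝ) (a : ℝ) :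
    pd_t (fun t s => f (t - a) s) = fun t s => pd_t f (t - a) s := by
  funext t s; unfold pd_t; exact deriv_comp_sub_const (f := fun t => f t s) a t

lemma psiF_t (a : ℝ) : pd_t (psiF r φ a) = psiF r (pd_t φ) a := by
  unfold psiF
  rw [pd_t_mul_s, pd_t_shift]

lemma psiF_s (hr : IsTortoise M r) (h : Sm φ) (a t s : ℝ) :
    pd_s (psiF r φ a) t s = (1 - muS M r s) * φ (t - a) s + r s * pd_s φ (t - a) s :=
  ((bg_r' hr s).mul (h.ds (t - a) s)).deriv

lemma psiF_sm (hM : 0 < M) (hr : IsTortoise M r) (h : Sm φ) (a : ℝ) : Sm (psiF r φ a) :=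
  (Sm.of_s (bg_r_cd hM hr)).mul (h.comp2 (Sm.fst.sub (Sm.const a)) Sm.snd)

lemma psiF_wave (hM : 0 < M) (hr : IsTortoise M r) (h : IsWaveSol r φ) (a t s : ℝ) :
    pd_t (pd_t (psiF r φ a)) t s = pd_s (pd_s (psiF r φ a)) t s
      - Vp (1 / (2 * M)) (muS M r s) * psiF r φ a t s := by
  have hs : Sm φ := h.1
  rw [psiF_t, psiF_t]
  have e : pd_s (psiF r φ a) = fun t s => (1 - muS M r s) * φ (t - a) s + r s * pd_s φ (t - a) s := by
    funext t s; exact psiF_s hr hs a t s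
  rw [e]
  have hx := bg_x' hM hr s
  have h1 : HasDerivAt (fun s => (1 - muS M r s) * φ (t - a) s + r s * pd_s φ (t - a) s) _ s :=
    ((hx.const_sub 1).mul (hs.ds (t - a) s)).add ((bg_r' hr s).mul (hs.pd_s.ds (t - a) s))
  have e1 : pd_s (fun t s => (1 - muS M r s) * φ (t - a) s + r s * pd_s φ (t - a) s) t s = _ := h1.deriv
  rw [e1]
  have h2 : HasDerivAt (fun x => (r x) ^ 2 * pd_s φ (t - a) x) _ s :=
    ((bg_r' hr s).pow 2).mul (hs.pd_s.ds (t - a) s)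
  have h3 := h.2.1 (t - a) s
  rw [h2.deriv] at h3
  unfold psiF
  rw [h3]
  have r0 := bg_rpos hM hr s
  have hrx := bg_r hM hr s
  have hk : Vp (1 / (2 * M)) (muS M r s) * (r s * φ (t - a) s) =
      1 / (2 * M) * muS M r s ^ 2 * (1 - muS M r s) * φ (t - a) s := by
    unfold Vp
    have : (1 / (2 * M)) ^ 2 * muS M r s ^ 3 * (1 - muS M r s) * (r s * φ (t - a) s) =
      (1 / (2 * M)) ^ 2 * muS M r s ^ 2 * (1 - muS M r s) * (r s * muS M r s) * φ (t - a) s := by ring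
    rw [this, hrx]; field_simp
  rw [hk]
  simp only [Pi.pow_apply]
  field_simp
  ring

lemma Vp_deriv {k : ℝ} {x : ℝ → ℝ} {s : ℝ} (hx : HasDerivAt x (-k * x s ^ 2 * (1 - x s)) s) :
    HasDerivAt (fun s => Vp k (x s)) (Vp k (x s) * (k * x s * (4 * x s - 3))) s := by
  unfold Vp
  refine HasDerivAt.congr_deriv (((hx.pow 3).const_mul (k ^ 2)).mul (hx.const_sub 1)) ?_
  simp only [Pi.pow_apply]
  push_cast
  ring

/-- the scaling field commuted equation -/
lemma svf_wave {k : ℝ} {x : ℝ → ℝ} {ψ : ℝ → ℝ → ℝ} (hψ : Sm ψ)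
    (hx : ∀ s, HasDerivAt x (-k * x s ^ 2 * (1 - x s)) s)
    (hw : ∀ t s, pd_t (pd_t ψ) t s = pd_s (pd_s ψ) t s - Vp k (x s) * ψ t s) (t s : ℝ) :
    pd_t (pd_t (Svf ψ)) t s = pd_s (pd_s (Svf ψ)) t s - Vp k (x s) * Svf ψ t s
      - Wp k s (x s) * ψ t s := by
  have a1 : pd_t (Svf ψ) = fun t s => pd_t ψ t s + t * pd_t (pd_t ψ) t s + s * pd_t (pd_s ψ) t s := by
    funext t s
    refine HasDerivAt.deriv (HasDerivAt.congr_deriv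
      (((hasDerivAt_id t).mul (hψ.pd_t.dt t s)).add ((hψ.pd_s.dt t s).const_mul s)) ?_)
    simp
  have a2 : pd_s (Svf ψ) = fun t s => t * pd_t (pd_s ψ) t s + pd_s ψ t s + s * pd_s (pd_s ψ) t s := by
    funext t s
    refine HasDerivAt.deriv (HasDerivAt.congr_deriv
      (((hψ.pd_t.ds t s).const_mul t).add ((hasDerivAt_id s).mul (hψ.pd_s.ds t s))) ?_)
    rw [hψ.comm]
    simp; ring
  have b1 : pd_t (pd_t (Svf ψ)) t s = 2 * pd_t (pd_t ψ) t s + t * pd_t (pd_t (pd_t ψ)) t s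
      + s * pd_t (pd_t (pd_s ψ)) t s := by
    rw [a1]
    refine HasDerivAt.deriv (HasDerivAt.congr_deriv
      (((hψ.pd_t.dt t s).add ((hasDerivAt_id t).mul (hψ.pd_t.pd_t.dt t s))).add
        ((hψ.pd_s.pd_t.dt t s).const_mul s)) ?_)
    simp; ring
  have b2 : pd_s (pd_s (Svf ψ)) t s = 2 * pd_s (pd_s ψ) t s + t * pd_s (pd_t (pd_s ψ)) t s
      + s * pd_s (pd_s (pd_s ψ)) t s := by
    rw [a2]
    refine HasDerivAt.deriv (HasDerivAt.congr_deriv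
      ((((hψ.pd_s.pd_t.ds t s).const_mul t).add (hψ.pd_s.ds t s)).add
        ((hasDerivAt_id s).mul (hψ.pd_s.pd_s.ds t s))) ?_)
    simp; ring
  have hw' : pd_t (pd_t ψ) = fun t s => pd_s (pd_s ψ) t s - Vp k (x s) * ψ t s := by
    funext t s; exact hw t s
  have c1 : pd_t (pd_t (pd_t ψ)) t s = pd_s (pd_t (pd_s ψ)) t s - Vp k (x s) * pd_t ψ t s := by
    rw [hw', hψ.pd_s.comm]
    exact ((hψ.pd_s.pd_s.dt t s).sub ((hψ.dt t s).const_mul _)).deriv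
  have c2 : pd_t (pd_t (pd_s ψ)) t s = pd_s (pd_s (pd_s ψ)) t s
      - (Vp k (x s) * (k * x s * (4 * x s - 3)) * ψ t s + Vp k (x s) * pd_s ψ t s) := by
    rw [← hψ.comm, ← hψ.pd_t.comm, hw']
    exact ((hψ.pd_s.pd_s.ds t s).sub ((Vp_deriv (hx s)).mul (hψ.ds t s))).deriv
  rw [b1, b2, c1, c2, hw]
  unfold Svf Wp
  ring

end field

section energy
variable {k : ℝ} {x : ℝ → ℝ} {χ ρ : ℝ → ℝ → ℝ}

/-- evaluation of a density along a field -/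
def ev (F : ℝ → ℝ → ℝ → ℝ → ℝ → ℝ → ℝ) (x : ℝ → ℝ) (χ : ℝ → ℝ → ℝ) (t s : ℝ) : ℝ :=
  F ((t - s) / 2) ((t + s) / 2) (x s) (χ t s) (pd_t χ t s + pd_s χ t s) (pd_t χ t s - pd_s χ t s)

def q0F' (k u v x c p _m : ℝ) : ℝ := q0F k u v x c p
def q1F' (k u v x c p _m : ℝ) : ℝ := q1F k u v x c p

lemma Sm.half {a : ℝ → ℝ → ℝ} (ha : Sm a) : Sm (fun t s => a t s / 2) := by
  simpa [div_eq_mul_inv] using ha.mul (Sm.const 2⁻¹)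

lemma Sm.cmul {a : ℝ → ℝ → ℝ} (c : ℝ) (ha : Sm a) : Sm (fun t s => c * a t s) :=
  (Sm.const c).mul ha

/-- a polynomial density gives smooth functions -/
lemma ev_sm {F : ℝ → ℝ → ℝ → ℝ → ℝ → ℝ → ℝ}
    (hF : ∀ {u v x c p m : ℝ → ℝ → ℝ}, Sm u → Sm v → Sm x → Sm c → Sm p → Sm m →
      Sm (fun t s => F (u t s) (v t s) (x t s) (c t s) (p t s) (m t s)))
    (hx : ContDiff ℝ (⊤ : ℕ∞) x) (h : Sm χ) : Sm (ev F x χ) :=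
  hF (Sm.fst.sub Sm.snd).half (Sm.fst.add Sm.snd).half (Sm.of_s hx) h (h.pd_t.add h.pd_s)
    (h.pd_t.sub h.pd_s)


end energy

section sm
variable (k : ℝ) {u v x c p m : ℝ → ℝ → ℝ}
lemma e0F_sm (hu : Sm u) (hv : Sm v) (hx : Sm x) (hc : Sm c) (hp : Sm p) (hm : Sm m) :
      Sm (fun t s => e0F k (u t s) (v t s) (x t s) (c t s) (p t s) (m t s)) := by
  unfold Sm Function.uncurry at *
  simp only [e0F, Vp]
  fun_prop
lemma e1F_sm (hu : Sm u) (hv : Sm v) (hx : Sm x) (hc : Sm c) (hp : Sm p) (hm : Sm m) :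
      Sm (fun t s => e1F k (u t s) (v t s) (x t s) (c t s) (p t s) (m t s)) := by
  unfold Sm Function.uncurry at *
  simp only [e1F, _root_.hp, fp, Vp]
  fun_prop
lemma q0F_sm (hu : Sm u) (hv : Sm v) (hx : Sm x) (hc : Sm c) (hp : Sm p) (hm : Sm m) :
      Sm (fun t s => q0F' k (u t s) (v t s) (x t s) (c t s) (p t s) (m t s)) := by
  unfold Sm Function.uncurry at *
  simp only [q0F', q0F, Vp]
  fun_prop
lemma q1F_sm (hu : Sm u) (hv : Sm v) (hx : Sm x) (hc : Sm c) (hp : Sm p) (hm : Sm m) :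
      Sm (fun t s => q1F' k (u t s) (v t s) (x t s) (c t s) (p t s) (m t s)) := by
  unfold Sm Function.uncurry at *
  simp only [q1F', q1F, _root_.hp, dhp, fp, Vp]
  fun_prop
lemma betaF_sm (hu : Sm u) (hv : Sm v) (hx : Sm x) (hc : Sm c) (hp : Sm p) (hm : Sm m) :
      Sm (fun t s => betaF (u t s) (v t s) (x t s) (c t s) (p t s) (m t s)) := by
  unfold Sm Function.uncurry at *
  simp only [betaF]
  fun_prop
end sm

section der
variable {k : ℝ} {u v x c p m : ℝ → ℝ} {z u' v' x' c' p' m' : ℝ}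

lemma fp_has (hx : HasDerivAt x x' z) :
    HasDerivAt (fun z => fp (x z)) (-(5 + 54 * x z ^ 2) * x') z := by
  unfold fp
  refine HasDerivAt.congr_deriv (((hx.const_mul 5).const_sub 11).sub ((hx.pow 3).const_mul 18)) ?_
  push_cast; ring

lemma Vp_has (hx : HasDerivAt x x' z) :
    HasDerivAt (fun z => Vp k (x z)) (k ^ 2 * (3 * x z ^ 2 - 4 * x z ^ 3) * x') z := by
  unfold Vp
  refine HasDerivAt.congr_deriv (((hx.pow 3).const_mul (k ^ 2)).mul (hx.const_sub 1)) ?_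
  simp only [Pi.pow_apply]; push_cast; ring

lemma hp_has (hx : HasDerivAt x x' z) :
    HasDerivAt (fun z => hp k (x z)) (20 * k * (3 * x z ^ 2 - 4 * x z ^ 3) * x') z := by
  unfold hp
  refine HasDerivAt.congr_deriv (((hx.pow 3).const_mul (20 * k)).mul (hx.const_sub 1)) ?_
  simp only [Pi.pow_apply]; push_cast; ring

lemma dhp_has (hx : HasDerivAt x x' z) :
    HasDerivAt (fun z => dhp k (x z))
      (-(20 * k ^ 2 * (12 * x z ^ 3 - 35 * x z ^ 4 + 24 * x z ^ 5) * x')) z := by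
  have e : (fun z => dhp k (x z)) =
      fun z => -(20 * k ^ 2) * (3 * x z ^ 4 - 7 * x z ^ 5 + 4 * x z ^ 6) := by
    funext z; unfold dhp; ring
  rw [e]
  refine HasDerivAt.congr_deriv (((((hx.pow 4).const_mul 3).sub ((hx.pow 5).const_mul 7)).add
    ((hx.pow 6).const_mul 4)).const_mul _) ?_
  push_cast; ring


lemma e0F_has (hu : HasDerivAt u u' z) (hv : HasDerivAt v v' z) (hx : HasDerivAt x x' z)
    (hc : HasDerivAt c c' z) (hp : HasDerivAt p p' z) (hm : HasDerivAt m m' z) :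
    HasDerivAt (fun z => e0F k (u z) (v z) (x z) (c z) (p z) (m z))
     (2 * v z * v' * p z ^ 2 + 2 * (v z ^ 2 + 1) * p z * p'
      + 2 * u z * u' * m z ^ 2 + 2 * (u z ^ 2 + 1) * m z * m'
      + (k ^ 2 * (3 * x z ^ 2 - 4 * x z ^ 3) * x') * (u z ^ 2 + v z ^ 2 + 2) * c z ^ 2
      + Vp k (x z) * (2 * u z * u' + 2 * v z * v') * c z ^ 2
      + 2 * Vp k (x z) * (u z ^ 2 + v z ^ 2 + 2) * c z * c') z := by
  unfold e0F
  refine HasDerivAt.congr_deriv (((((hv.pow 2).add_const 1).mul (hp.pow 2)).add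
    (((hu.pow 2).add_const 1).mul (hm.pow 2))).add
    (((Vp_has hx).mul (((hu.pow 2).add (hv.pow 2)).add_const 2)).mul (hc.pow 2))) ?_
  simp only [Pi.pow_apply, Pi.add_apply, Pi.mul_apply]; push_cast; ring

lemma q0F_has (hu : HasDerivAt u u' z) (hv : HasDerivAt v v' z) (hx : HasDerivAt x x' z)
    (hc : HasDerivAt c c' z) (hp : HasDerivAt p p' z) :
    HasDerivAt (fun z => q0F k (u z) (v z) (x z) (c z) (p z))
     (4 * v z * v' * p z ^ 2 + 4 * (v z ^ 2 + 1) * p z * p'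
      + 2 * (k ^ 2 * (3 * x z ^ 2 - 4 * x z ^ 3) * x') * (u z ^ 2 + 1) * c z ^ 2
      + 2 * Vp k (x z) * (2 * u z * u') * c z ^ 2
      + 4 * Vp k (x z) * (u z ^ 2 + 1) * c z * c') z := by
  unfold q0F
  refine HasDerivAt.congr_deriv (((((hv.pow 2).add_const 1).const_mul 2).mul (hp.pow 2)).add
    ((((Vp_has hx).const_mul 2).mul ((hu.pow 2).add_const 1)).mul (hc.pow 2))) ?_
  simp only [Pi.pow_apply, Pi.add_apply, Pi.mul_apply]; push_cast; ring

lemma e1F_has (hu : HasDerivAt u u' z) (hv : HasDerivAt v v' z) (hx : HasDerivAt x x' z)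
    (hc : HasDerivAt c c' z) (hp : HasDerivAt p p' z) (hm : HasDerivAt m m' z) :
    HasDerivAt (fun z => e1F k (u z) (v z) (x z) (c z) (p z) (m z))
     ((-(5 + 54 * x z ^ 2) * x') * (v z ^ 2 * p z ^ 2 - u z ^ 2 * m z ^ 2)
      + fp (x z) * (2 * v z * v' * p z ^ 2 + 2 * v z ^ 2 * p z * p' - 2 * u z * u' * m z ^ 2
        - 2 * u z ^ 2 * m z * m')
      + (k ^ 2 * (3 * x z ^ 2 - 4 * x z ^ 3) * x') * fp (x z) * (v z ^ 2 - u z ^ 2) * c z ^ 2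
      + Vp k (x z) * (-(5 + 54 * x z ^ 2) * x') * (v z ^ 2 - u z ^ 2) * c z ^ 2
      + Vp k (x z) * fp (x z) * (2 * v z * v' - 2 * u z * u') * c z ^ 2
      + Vp k (x z) * fp (x z) * (v z ^ 2 - u z ^ 2) * (2 * c z * c')
      + (u z + v z) * (u' + v') * _root_.hp k (x z) * c z * ((p z + m z) / 2)
      + 1 / 2 * (u z + v z) ^ 2 * (20 * k * (3 * x z ^ 2 - 4 * x z ^ 3) * x') * c z * ((p z + m z) / 2)
      + 1 / 2 * (u z + v z) ^ 2 * _root_.hp k (x z) * c' * ((p z + m z) / 2)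
      + 1 / 2 * (u z + v z) ^ 2 * _root_.hp k (x z) * c z * ((p' + m') / 2)) z := by
  unfold e1F
  refine HasDerivAt.congr_deriv ((((fp_has hx).mul (((hv.pow 2).mul (hp.pow 2)).sub
    ((hu.pow 2).mul (hm.pow 2)))).add ((((Vp_has hx).mul (fp_has hx)).mul
      ((hv.pow 2).sub (hu.pow 2))).mul (hc.pow 2))).add
      ((((((hu.add hv).pow 2).const_mul (1 / 2)).mul (hp_has hx)).mul hc).mul
        ((hp.add hm).div_const 2))) ?_
  simp only [Pi.pow_apply, Pi.add_apply, Pi.mul_apply, Pi.sub_apply]; push_cast; ring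

lemma q1F_has (hu : HasDerivAt u u' z) (hv : HasDerivAt v v' z) (hx : HasDerivAt x x' z)
    (hc : HasDerivAt c c' z) (hp : HasDerivAt p p' z) :
    HasDerivAt (fun z => q1F k (u z) (v z) (x z) (c z) (p z))
     (2 * (-(5 + 54 * x z ^ 2) * x') * v z ^ 2 * p z ^ 2
      + 4 * fp (x z) * v z * v' * p z ^ 2 + 4 * fp (x z) * v z ^ 2 * p z * p'
      - 2 * (k ^ 2 * (3 * x z ^ 2 - 4 * x z ^ 3) * x') * fp (x z) * u z ^ 2 * c z ^ 2
      - 2 * Vp k (x z) * (-(5 + 54 * x z ^ 2) * x') * u z ^ 2 * c z ^ 2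
      - 4 * Vp k (x z) * fp (x z) * u z * u' * c z ^ 2
      - 4 * Vp k (x z) * fp (x z) * u z ^ 2 * c z * c'
      + (u z + v z) * (u' + v') * (_root_.hp k (x z) * c z * p z - 1 / 2 * dhp k (x z) * c z ^ 2)
      + 1 / 2 * (u z + v z) ^ 2 * ((20 * k * (3 * x z ^ 2 - 4 * x z ^ 3) * x') * c z * p z
         + _root_.hp k (x z) * c' * p z + _root_.hp k (x z) * c z * p'
         - 1 / 2 * (-(20 * k ^ 2 * (12 * x z ^ 3 - 35 * x z ^ 4 + 24 * x z ^ 5) * x')) * c z ^ 2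
         - dhp k (x z) * c z * c')) z := by
  unfold q1F
  refine HasDerivAt.congr_deriv ((((((fp_has hx).const_mul 2).mul (hv.pow 2)).mul (hp.pow 2)).sub
    (((((Vp_has hx).const_mul 2).mul (fp_has hx)).mul (hu.pow 2)).mul (hc.pow 2))).add
    ((((hu.add hv).pow 2).const_mul (1 / 2)).mul ((((hp_has hx).mul hc).mul hp).sub
      ((((dhp_has hx).const_mul (1 / 2))).mul (hc.pow 2))))) ?_
  simp only [Pi.pow_apply, Pi.add_apply, Pi.mul_apply, Pi.sub_apply]; push_cast; ring
end der

section energy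
variable {k : ℝ} {x : ℝ → ℝ} {χ ρ : ℝ → ℝ → ℝ}
  
lemma ident0 (hx : ∀ s, HasDerivAt x (-k * x s ^ 2 * (1 - x s)) s) (h : Sm χ)
    (hw : ∀ t s, pd_t (pd_t χ) t s = pd_s (pd_s χ) t s - Vp k (x s) * χ t s - ρ t s) (t s : ℝ) :
    pd_t (ev (e0F k) x χ) t s + pd_s (ev (e0F k) x χ) t s = pd_s (ev (q0F' k) x χ) t s
      + (ev (fun u v x c _ _ => b0F k u v x c) x χ t s + ρ t s * ev (fun u v _ _ p m => s0F u v p m) x χ t s) := by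
  have ut : HasDerivAt (fun t => (t - s) / 2) (1 / 2) t := ((hasDerivAt_id t).sub_const s).div_const 2
  have vt : HasDerivAt (fun t => (t + s) / 2) (1 / 2) t := ((hasDerivAt_id t).add_const s).div_const 2
  have us : HasDerivAt (fun s => (t - s) / 2) (-1 / 2) s := ((hasDerivAt_id s).const_sub t).div_const 2
  have vs : HasDerivAt (fun s => (t + s) / 2) (1 / 2) s := ((hasDerivAt_id s).const_add t).div_const 2
  have d1 := e0F_has (k := k) ut vt (hasDerivAt_const t (x s)) (h.dt t s)
    ((h.pd_t.dt t s).add (h.pd_s.dt t s)) ((h.pd_t.dt t s).sub (h.pd_s.dt t s))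
  have d2 := e0F_has (k := k) us vs (hx s) (h.ds t s)
    ((h.pd_t.ds t s).add (h.pd_s.ds t s)) ((h.pd_t.ds t s).sub (h.pd_s.ds t s))
  have d3 := q0F_has (k := k) us vs (hx s) (h.ds t s) ((h.pd_t.ds t s).add (h.pd_s.ds t s))
  have e1 : pd_t (ev (e0F k) x χ) t s = _ := d1.deriv
  have e2 : pd_s (ev (e0F k) x χ) t s = _ := d2.deriv
  have e3 : pd_s (ev (q0F' k) x χ) t s = _ := d3.deriv
  rw [e1, e2, e3, hw, h.comm]
  simp only [ev, b0F, s0F, Wp, Vp, Pi.add_apply, Pi.sub_apply]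
  ring

set_option maxHeartbeats 1000000 in
lemma ident1 (hx : ∀ s, HasDerivAt x (-k * x s ^ 2 * (1 - x s)) s) (h : Sm χ)
    (hw : ∀ t s, pd_t (pd_t χ) t s = pd_s (pd_s χ) t s - Vp k (x s) * χ t s - ρ t s) (t s : ℝ) :
    pd_t (ev (e1F k) x χ) t s + pd_s (ev (e1F k) x χ) t s = pd_s (ev (q1F' k) x χ) t s
      + (ev (b1F k) x χ t s + ρ t s * ev (s1F k) x χ t s) := by
  have ut : HasDerivAt (fun t => (t - s) / 2) (1 / 2) t := ((hasDerivAt_id t).sub_const s).div_const 2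
  have vt : HasDerivAt (fun t => (t + s) / 2) (1 / 2) t := ((hasDerivAt_id t).add_const s).div_const 2
  have us : HasDerivAt (fun s => (t - s) / 2) (-1 / 2) s := ((hasDerivAt_id s).const_sub t).div_const 2
  have vs : HasDerivAt (fun s => (t + s) / 2) (1 / 2) s := ((hasDerivAt_id s).const_add t).div_const 2
  have d1 := e1F_has (k := k) ut vt (hasDerivAt_const t (x s)) (h.dt t s)
    ((h.pd_t.dt t s).add (h.pd_s.dt t s)) ((h.pd_t.dt t s).sub (h.pd_s.dt t s))
  have d2 := e1F_has (k := k) us vs (hx s) (h.ds t s)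
    ((h.pd_t.ds t s).add (h.pd_s.ds t s)) ((h.pd_t.ds t s).sub (h.pd_s.ds t s))
  have d3 := q1F_has (k := k) us vs (hx s) (h.ds t s) ((h.pd_t.ds t s).add (h.pd_s.ds t s))
  have e1 : pd_t (ev (e1F k) x χ) t s = _ := d1.deriv
  have e2 : pd_s (ev (e1F k) x χ) t s = _ := d2.deriv
  have e3 : pd_s (ev (q1F' k) x χ) t s = _ := d3.deriv
  rw [e1, e2, e3, hw, h.comm]
  simp only [ev, b1F, s1F, Wp, Vp, Pi.add_apply, Pi.sub_apply, hp, dhp, ddhp, dfp, dVf, fp]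
  ring

lemma energy_deriv {e q b : ℝ → ℝ → ℝ} (he : Sm e) (hq : Sm q)
    (hid : ∀ t s, pd_t e t s + pd_s e t s = pd_s q t s + b t s) (α β t : ℝ) :
    HasDerivAt (fun t => ∫ y in α..β, e t (t + y))
      (q t (t + β) - q t (t + α) + ∫ y in α..β, b t (t + y)) t := by
  have hg : Sm (fun t y => e t (t + y)) := he.comp2 Sm.fst (Sm.fst.add Sm.snd)
  refine (hg.param α β t).congr_deriv ?_
  have e1 : ∀ y, pd_t (fun t y => e t (t + y)) t y = pd_s q t (t + y) + b t (t + y) := by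
    intro y
    rw [← hid]
    exact (he.diag t y).deriv
  have cq : Continuous (fun y => pd_s q t (t + y)) :=
    hq.pd_s.cont_comp continuous_const (continuous_const.add continuous_id)
  have cb : Continuous (fun y => b t (t + y)) := by
    have : (fun y => b t (t + y)) = fun y => pd_t (fun t y => e t (t + y)) t y - pd_s q t (t + y) := by
      funext y; rw [e1]; ring
    rw [this]
    exact (hg.pd_t.cont_comp continuous_const continuous_id).sub cq
  simp only [e1]
  rw [intervalIntegral.integral_add (cq.intervalIntegrable _ _) (cb.intervalIntegrable _ _)]
  congr 1
  apply intervalIntegral.integral_eq_sub_of_hasDerivAt (f := fun y => q t (t + y)) _ (cq.intervalIntegrable _ _)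
  intro y _
  exact HasDerivAt.congr_deriv ((hq.ds t (t + y)).comp y ((hasDerivAt_id y).const_add t)) (mul_one _)

end energy


/-- background and parameter conditions -/
structure Par (k C C2 ε T0 : ℝ) (x : ℝ → ℝ) : Prop where
  bg : ∀ s, Bg k C s (x s)
  C21 : 1 ≤ C2
  src : ∀ t s, 1 ≤ t → (|s| ≤ t ∧ t ^ (-ε) * |Wp k s (x s)| ≤ C2 * (x s ^ 3 * (1 - x s))) ∨
      Wp k s (x s) ^ 2 * t ^ 2 ≤ C2 * (t ^ (-ε)) ^ 2 * (x s ^ 3 * (1 - x s))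
  xc : ContDiff ℝ (⊤ : ℕ∞) x
  x' : ∀ s, HasDerivAt x (-k * x s ^ 2 * (1 - x s)) s
  e0 : 0 < ε
  e1 : ε ≤ 1 / 4
  T1 : 1 ≤ T0
  a1 : ∀ t, T0 ≤ t → t ^ (-ε) * (1000 * C ^ 3) ≤ 1
  a2 : ∀ t, T0 ≤ t → t ^ (-ε) * (12 + 200 * C ^ 3) ≤ 1 / 2
  a3 : ∀ t, T0 ≤ t → 4 * C ≤ k ^ 3 * (t * t ^ (-ε))
  a4 : ∀ t, T0 ≤ t → 1 ≤ t * (t ^ (-ε)) ^ 2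

lemma uv_add (t s : ℝ) : (t - s) / 2 + (t + s) / 2 = t := by ring
lemma uv_sub (t s : ℝ) : (t + s) / 2 - (t - s) / 2 = s := by ring

section
variable {k C C2 ε T0 : ℝ} {x : ℝ → ℝ} (P : Par k C C2 ε T0 x) {χ ψ ρ : ℝ → ℝ → ℝ} {t s : ℝ}

lemma Par.tau0 (P : Par k C C2 ε T0 x) (ht : T0 ≤ t) : 0 < t ^ (-ε) :=
  rpow_pos_of_pos (by linarith [P.T1]) _
lemma Par.tau1 (P : Par k C C2 ε T0 x) (ht : T0 ≤ t) : t ^ (-ε) ≤ 1 :=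
  rpow_le_one_of_one_le_of_nonpos (by linarith [P.T1]) (by linarith [P.e0])

lemma Par.bulk (P : Par k C C2 ε T0 x) (ht : T0 ≤ t) :
    ev (fun u v x c _ _ => b0F k u v x c) x χ t s + t ^ (-ε) * ev (b1F k) x χ t s
      - ε * t ^ (-ε) / t * ev (e1F k) x χ t s ≤
      -(min (3 * k) (k ^ 3 / 2) * t ^ (-ε) * ev betaF x χ t s)
        + 2000 * C ^ 3 * (t ^ (-ε) / t) * ev (e0F k) x χ t s := by
  have h := bulk_le (k := k) (C := C) (u := (t - s) / 2) (v := (t + s) / 2) (x := x s) (c := χ t s)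
    (p := pd_t χ t s + pd_s χ t s) (m := pd_t χ t s - pd_s χ t s) (τ := t ^ (-ε)) (ε := ε)
    (by rw [uv_sub]; exact P.bg s) (by rw [uv_add]; linarith [P.T1]) (P.tau0 ht) P.e0.le
    (by linarith [P.e1]) (by rw [uv_add]; exact P.a3 t ht)
  rw [uv_add] at h
  exact h

lemma Par.source (P : Par k C C2 ε T0 x) (ht : T0 ≤ t) {θ : ℝ} (hθ : 0 < θ) :
    (t ^ (-ε)) ^ 4 * (Wp k s (x s) * ψ t s * (ev (fun u v _ _ p m => s0F u v p m) x χ t s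
        + t ^ (-ε) * ev (s1F k) x χ t s)) ≤
      θ * (t ^ (-ε)) ^ 5 * ev betaF x χ t s
      + C2 ^ 2 * (13 + 5 * C) * (26 + 5 * C) / θ * t ^ (-ε) * ev betaF x ψ t s
      + (520 * C2 * C ^ 2 + C2 * C ^ 2 * (52 + 10 * C)) * (t ^ (-ε) / t) *
        ((t ^ (-ε)) ^ 4 * (ev (e0F k) x ψ t s + ev (e0F k) x χ t s)) := by
  have h := src_le (k := k) (C := C) (u := (t - s) / 2) (v := (t + s) / 2) (x := x s) (c := χ t s)
    (p := pd_t χ t s + pd_s χ t s) (m := pd_t χ t s - pd_s χ t s) (c0 := ψ t s)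
    (p0 := pd_t ψ t s + pd_s ψ t s) (m0 := pd_t ψ t s - pd_s ψ t s) (τ := t ^ (-ε)) (C2 := C2) (θ := θ)
    (by rw [uv_sub]; exact P.bg s) (by rw [uv_add]; linarith [P.T1]) (P.tau0 ht) (P.tau1 ht)
    (by rw [uv_add]; exact P.a4 t ht) hθ P.C21
    (by rw [uv_add, uv_sub]; exact P.src t s (by linarith [P.T1]))
  rw [uv_add, uv_sub] at h
  exact h

lemma Par.qn (P : Par k C C2 ε T0 x) (ht : T0 ≤ t) (hs : s ≤ 0) :
    0 ≤ ev (q0F' k) x χ t s + t ^ (-ε) * ev (q1F' k) x χ t s := by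
  exact q_nonneg (k := k) (C := C) (u := (t - s) / 2) (v := (t + s) / 2) (x := x s) (c := χ t s)
    (p := pd_t χ t s + pd_s χ t s) (τ := t ^ (-ε)) (by rw [uv_sub]; exact P.bg s)
    (by linarith) (by rw [uv_add]; linarith [P.T1]) (P.tau0 ht).le (P.a1 t ht)

lemma Par.e1_le (P : Par k C C2 ε T0 x) (ht : T0 ≤ t) :
    t ^ (-ε) * |ev (e1F k) x χ t s| ≤ 1 / 2 * ev (e0F k) x χ t s := by
  have h := e1F_le (k := k) (C := C) (u := (t - s) / 2) (v := (t + s) / 2) (x := x s) (c := χ t s)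
    (p := pd_t χ t s + pd_s χ t s) (m := pd_t χ t s - pd_s χ t s) (by rw [uv_sub]; exact P.bg s)
  have h0 : 0 ≤ ev (e0F k) x χ t s := e0F_nonneg (P.bg s).x0 (P.bg s).x1
  calc t ^ (-ε) * |ev (e1F k) x χ t s| ≤ t ^ (-ε) * ((12 + 200 * C ^ 3) * ev (e0F k) x χ t s) :=
        mul_le_mul_of_nonneg_left h (P.tau0 ht).le
    _ = t ^ (-ε) * (12 + 200 * C ^ 3) * ev (e0F k) x χ t s := by ring
    _ ≤ _ := mul_le_mul_of_nonneg_right (P.a2 t ht) h0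

/-- integrated densities -/
def EI (F : ℝ → ℝ → ℝ → ℝ → ℝ → ℝ → ℝ) (x : ℝ → ℝ) (χ : ℝ → ℝ → ℝ) (L X t : ℝ) : ℝ :=
  ∫ y in (-L)..X, ev F x χ t (t + y)

lemma ev_cont {F : ℝ → ℝ → ℝ → ℝ → ℝ → ℝ → ℝ} (h : Sm (ev F x χ)) (t : ℝ) :
    Continuous (fun y => ev F x χ t (t + y)) :=
  h.cont_comp continuous_const (continuous_const.add continuous_id)

section sm
variable {u v x c p m : ℝ → ℝ → ℝ}
lemma b0F_sm (k : ℝ) (hu : Sm u) (hv : Sm v) (hx : Sm x) (hc : Sm c) (_ : Sm p) (_ : Sm m) :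
      Sm (fun t s => (fun u v x c (_ _ : ℝ) => b0F k u v x c) (u t s) (v t s) (x t s) (c t s) (p t s) (m t s)) := by
  unfold Sm Function.uncurry at *
  simp only [b0F, Wp, Vp]
  fun_prop
lemma b1F_sm (k : ℝ) (hu : Sm u) (hv : Sm v) (hx : Sm x) (hc : Sm c) (hp : Sm p) (hm : Sm m) :
      Sm (fun t s => b1F k (u t s) (v t s) (x t s) (c t s) (p t s) (m t s)) := by
  unfold Sm Function.uncurry at *
  simp only [b1F, _root_.hp, ddhp, dVf, dfp, fp, Vp]
  fun_prop
lemma s0F_sm (hu : Sm u) (hv : Sm v) (_ : Sm x) (_ : Sm c) (hp : Sm p) (hm : Sm m) :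
      Sm (fun t s => (fun u v (_ _ : ℝ) p m => s0F u v p m) (u t s) (v t s) (x t s) (c t s) (p t s) (m t s)) := by
  unfold Sm Function.uncurry at *
  simp only [s0F]
  fun_prop
lemma s1F_sm (k : ℝ) (hu : Sm u) (hv : Sm v) (hx : Sm x) (hc : Sm c) (hp : Sm p) (hm : Sm m) :
      Sm (fun t s => s1F k (u t s) (v t s) (x t s) (c t s) (p t s) (m t s)) := by
  unfold Sm Function.uncurry at *
  simp only [s1F, _root_.hp, fp]
  fun_prop
end sm

lemma tau_deriv (t0 : 0 < t) (ε : ℝ) : HasDerivAt (fun t : ℝ => t ^ (-ε)) (-(ε * t ^ (-ε) / t)) t := by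
  refine (Real.hasDerivAt_rpow_const (p := -ε) (Or.inl t0.ne')).congr_deriv ?_
  rw [rpow_sub_one t0.ne']; ring

lemma int_key {b0 b1 s0 s1 e0 e1 be ρ : ℝ → ℝ} {α β A B D τ : ℝ} (hab : α ≤ β)
    (hb0 : Continuous b0) (hb1 : Continuous b1) (hs0 : Continuous s0) (hs1 : Continuous s1)
    (he0 : Continuous e0) (he1 : Continuous e1) (hbe : Continuous be) (hρ : Continuous ρ)
    (h : ∀ y, b0 y + τ * b1 y - A * e1 y ≤ -(B * be y) + D * e0 y) :
    (∫ y in α..β, (b0 y + ρ y * s0 y)) + τ * (∫ y in α..β, (b1 y + ρ y * s1 y))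
      - A * (∫ y in α..β, e1 y) ≤ -(B * (∫ y in α..β, be y)) + D * (∫ y in α..β, e0 y)
        + ∫ y in α..β, ρ y * (s0 y + τ * s1 y) := by
  have i0 : ∀ {f : ℝ → ℝ}, Continuous f → IntervalIntegrable f volume α β :=
    fun hf => hf.intervalIntegrable _ _
  rw [← intervalIntegral.integral_const_mul, ← intervalIntegral.integral_const_mul,
      ← intervalIntegral.integral_const_mul, ← intervalIntegral.integral_const_mul,
      ← intervalIntegral.integral_neg,
      ← intervalIntegral.integral_add (i0 (by fun_prop)) (i0 (by fun_prop)),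
      ← intervalIntegral.integral_sub (i0 (by fun_prop)) (i0 (by fun_prop)),
      ← intervalIntegral.integral_add (i0 (by fun_prop)) (i0 (by fun_prop)),
      ← intervalIntegral.integral_add (i0 (by fun_prop)) (i0 (by fun_prop))]
  apply intervalIntegral.integral_mono_on hab (i0 (by fun_prop)) (i0 (by fun_prop))
  intro y _
  have := h y
  linarith

/-- derivative of the modified energy of one field -/
lemma Par.field (P : Par k C C2 ε T0 x) (h : Sm χ) (hρ : Sm ρ)
    (hw : ∀ t s, pd_t (pd_t χ) t s = pd_s (pd_s χ) t s - Vp k (x s) * χ t s - ρ t s) {L X : ℝ}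
    (ht : T0 ≤ t) (hL : t ≤ L) (hX : -L ≤ X) (z0 : χ t (t + X) = 0) (z1 : pd_t χ t (t + X) = 0)
    (z2 : pd_s χ t (t + X) = 0) :
    ∃ D, HasDerivAt (fun t => EI (e0F k) x χ L X t + t ^ (-ε) * EI (e1F k) x χ L X t) D t ∧
      D ≤ -(min (3 * k) (k ^ 3 / 2) * t ^ (-ε) * EI betaF x χ L X t)
        + 2000 * C ^ 3 * (t ^ (-ε) / t) * EI (e0F k) x χ L X t
        + ∫ y in (-L)..X, ρ t (t + y) * (ev (fun u v _ _ p m => s0F u v p m) x χ t (t + y)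
        + t ^ (-ε) * ev (s1F k) x χ t (t + y)) := by
  have t0 : 0 < t := by linarith [P.T1]
  have he0 : Sm (ev (e0F k) x χ) := ev_sm (e0F_sm k) P.xc h
  have he1 : Sm (ev (e1F k) x χ) := ev_sm (e1F_sm k) P.xc h
  have hq0 : Sm (ev (q0F' k) x χ) := ev_sm (q0F_sm k) P.xc h
  have hq1 : Sm (ev (q1F' k) x χ) := ev_sm (q1F_sm k) P.xc h
  have hb0 : Sm (ev (fun u v x c _ _ => b0F k u v x c) x χ) := ev_sm (b0F_sm k) P.xc h
  have hb1 : Sm (ev (b1F k) x χ) := ev_sm (b1F_sm k) P.xc h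
  have hs0 : Sm (ev (fun u v _ _ p m => s0F u v p m) x χ) := ev_sm s0F_sm P.xc h
  have hs1 : Sm (ev (s1F k) x χ) := ev_sm (s1F_sm k) P.xc h
  have hbe : Sm (ev betaF x χ) := ev_sm betaF_sm P.xc h
  have d0 := energy_deriv he0 hq0 (ident0 P.x' h hw) (-L) X t
  have d1 := energy_deriv he1 hq1 (ident1 P.x' h hw) (-L) X t
  refine ⟨_, d0.add ((tau_deriv t0 ε).mul d1), ?_⟩
  have qX0 : ev (q0F' k) x χ t (t + X) = 0 := by
    simp only [ev, q0F', q0F, z0, z1, z2]; ring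
  have qX1 : ev (q1F' k) x χ t (t + X) = 0 := by
    simp only [ev, q1F', q1F, z0, z1, z2]; ring
  have qL := P.qn (χ := χ) ht (s := t + -L) (by linarith)
  rw [qX0, qX1]
  have cρ : Continuous (fun y => ρ t (t + y)) :=
    hρ.cont_comp continuous_const (continuous_const.add continuous_id)
  have cb0 := ev_cont hb0 t
  have cb1 := ev_cont hb1 t
  have cs0 := ev_cont hs0 t
  have cs1 := ev_cont hs1 t
  have ce0 := ev_cont he0 t
  have ce1 := ev_cont he1 t
  have cbe := ev_cont hbe t
  set τ := t ^ (-ε) with hτ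
  have key : (∫ y in (-L)..X, (ev (fun u v x c _ _ => b0F k u v x c) x χ t (t + y)
        + ρ t (t + y) * ev (fun u v _ _ p m => s0F u v p m) x χ t (t + y)))
      + τ * (∫ y in (-L)..X, (ev (b1F k) x χ t (t + y) + ρ t (t + y) * ev (s1F k) x χ t (t + y)))
      - ε * τ / t * EI (e1F k) x χ L X t ≤
      -(min (3 * k) (k ^ 3 / 2) * τ * EI betaF x χ L X t)
        + 2000 * C ^ 3 * (τ / t) * EI (e0F k) x χ L X t
        + ∫ y in (-L)..X, ρ t (t + y) * (ev (fun u v _ _ p m => s0F u v p m) x χ t (t + y)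
        + τ * ev (s1F k) x χ t (t + y)) := by
    refine int_key hX cb0 cb1 cs0 cs1 ce0 ce1 cbe cρ fun y => ?_
    have := P.bulk (χ := χ) (s := t + y) ht
    rw [← hτ] at this
    exact this
  have e : (fun t => ∫ y in (-L)..X, ev (e1F k) x χ t (t + y)) t = EI (e1F k) x χ L X t := rfl
  simp only [zero_sub]
  change _ + (-(ε * τ / t) * EI (e1F k) x χ L X t + _) ≤ _
  linarith
end


lemma van_t {ξ : ℝ → ℝ → ℝ} (h : Sm ξ) {z : ℝ × ℝ} (hz : ∀ᶠ w in nhds z, Function.uncurry ξ w = 0) :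
    ∀ᶠ w in nhds z, Function.uncurry (pd_t ξ) w = 0 := by
  filter_upwards [eventually_eventually_nhds.2 hz] with w hw
  have : Function.uncurry ξ =ᶠ[nhds w] fun _ => 0 := hw
  change pd_t ξ w.1 w.2 = 0
  rw [h.pd_t_eq, this.fderiv_eq]; simp

lemma van_s {ξ : ℝ → ℝ → ℝ} (h : Sm ξ) {z : ℝ × ℝ} (hz : ∀ᶠ w in nhds z, Function.uncurry ξ w = 0) :
    ∀ᶠ w in nhds z, Function.uncurry (pd_s ξ) w = 0 := by
  filter_upwards [eventually_eventually_nhds.2 hz] with w hw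
  have : Function.uncurry ξ =ᶠ[nhds w] fun _ => 0 := hw
  change pd_s ξ w.1 w.2 = 0
  rw [h.pd_s_eq, this.fderiv_eq]; simp

lemma van_svf {ξ : ℝ → ℝ → ℝ} (h : Sm ξ) {z : ℝ × ℝ} (hz : ∀ᶠ w in nhds z, Function.uncurry ξ w = 0) :
    ∀ᶠ w in nhds z, Function.uncurry (Svf ξ) w = 0 := by
  filter_upwards [van_t h hz, van_s h hz] with w h1 h2
  change w.1 * pd_t ξ w.1 w.2 + w.2 * pd_s ξ w.1 w.2 = 0
  have h1' : pd_t ξ w.1 w.2 = 0 := h1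
  have h2' : pd_s ξ w.1 w.2 = 0 := h2
  rw [h1', h2']; ring

lemma comb_arith {c K0 K1 K2 Λ τ σ Ap Az Bp Bz Fp Fz Dp Dz S G : ℝ} (hc : 0 < c) (hK0 : 0 ≤ K0)
    (hK1 : 0 ≤ K1) (hK2 : 0 ≤ K2) (hΛ : Λ = (K1 + 1) / c + 1) (hτ : 0 < τ) (hτ1 : τ ≤ 1) (hσ : 0 ≤ σ)
    (hAp : 0 ≤ Ap) (hAz : 0 ≤ Az) (hBp : 0 ≤ Bp) (hBz : 0 ≤ Bz)
    (h1 : Dp ≤ -(c * τ * Bp) + K0 * σ * Ap) (h2 : Dz ≤ -(c * τ * Bz) + K0 * σ * Az + S)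
    (h3 : τ ^ 4 * S ≤ c / 2 * τ ^ 5 * Bz + K1 * τ * Bp + K2 * σ * (τ ^ 4 * (Ap + Az)))
    (h4 : 1 / 2 * Ap ≤ Fp) (h5 : 1 / 2 * Az ≤ Fz) (hG : G * Fz ≤ 0) :
    Λ * Dp + (G * Fz + τ ^ 4 * Dz) ≤ 2 * (K0 + K2) * σ * (Λ * Fp + τ ^ 4 * Fz)
      - min 1 (c / 2) * τ ^ 5 * (Bp + Bz) := by
  have hΛ1 : 1 ≤ Λ := by
    rw [hΛ]; have : 0 ≤ (K1 + 1) / c := by positivity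
    linarith
  have hΛc : K1 + 1 ≤ Λ * c := by
    rw [hΛ]; have : ((K1 + 1) / c + 1) * c = K1 + 1 + c := by field_simp
    rw [this]; linarith
  have t4 : 0 < τ ^ 4 := by positivity
  have t41 : τ ^ 4 ≤ 1 := pow_le_one₀ hτ.le hτ1
  have t5 : τ ^ 5 ≤ τ := by
    calc τ ^ 5 = τ ^ 4 * τ := by ring
      _ ≤ 1 * τ := by gcongr
      _ = τ := one_mul _
  have a1 : Λ * Dp ≤ -((K1 + 1) * (τ * Bp)) + K0 * σ * (Λ * Ap) := by
    have := mul_le_mul_of_nonneg_left h1 (by linarith : 0 ≤ Λ)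
    have h' := mul_le_mul_of_nonneg_right hΛc (by positivity : 0 ≤ τ * Bp)
    linarith
  have a2 : τ ^ 4 * Dz ≤ -(c * τ ^ 5 * Bz) + K0 * σ * (τ ^ 4 * Az) + τ ^ 4 * S := by
    have := mul_le_mul_of_nonneg_left h2 t4.le
    linarith
  have a3 : τ ^ 4 * Ap ≤ Λ * Ap := mul_le_mul_of_nonneg_right (t41.trans hΛ1) hAp
  have a4 : K2 * σ * (τ ^ 4 * (Ap + Az)) ≤ K2 * σ * (Λ * Ap + τ ^ 4 * Az) := by
    apply mul_le_mul_of_nonneg_left _ (by positivity); linarith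
  have a5 : (K0 + K2) * σ * (Λ * Ap + τ ^ 4 * Az) ≤ (K0 + K2) * σ * (2 * (Λ * Fp + τ ^ 4 * Fz)) := by
    apply mul_le_mul_of_nonneg_left _ (by positivity)
    have := mul_le_mul_of_nonneg_left h4 (by linarith : 0 ≤ Λ)
    have := mul_le_mul_of_nonneg_left h5 t4.le
    linarith
  have a6 : min 1 (c / 2) * τ ^ 5 * Bp ≤ τ * Bp := by
    apply mul_le_mul_of_nonneg_right _ hBp
    calc min 1 (c / 2) * τ ^ 5 ≤ 1 * τ ^ 5 := by gcongr; exact min_le_left _ _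
      _ ≤ τ := by linarith
  have a7 : min 1 (c / 2) * τ ^ 5 * Bz ≤ c / 2 * τ ^ 5 * Bz := by
    gcongr; exact min_le_right _ _
  linarith

section
variable {k C C2 ε T0 : ℝ} {x : ℝ → ℝ} {χ ψ ρ : ℝ → ℝ → ℝ} {t s : ℝ}

/-- the total energy -/
def En (k : ℝ) (x : ℝ → ℝ) (ε Λ : ℝ) (ψ : ℝ → ℝ → ℝ) (L X t : ℝ) : ℝ :=
  Λ * (EI (e0F k) x ψ L X t + t ^ (-ε) * EI (e1F k) x ψ L X t)
   + (t ^ (-ε)) ^ 4 * (EI (e0F k) x (Svf ψ) L X t + t ^ (-ε) * EI (e1F k) x (Svf ψ) L X t)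

lemma Par.EI0 (P : Par k C C2 ε T0 x) {L X : ℝ} (hX : -L ≤ X) : 0 ≤ EI (e0F k) x χ L X t :=
  intervalIntegral.integral_nonneg hX fun y _ => e0F_nonneg (P.bg (t + y)).x0 (P.bg (t + y)).x1

lemma Par.EIb (P : Par k C C2 ε T0 x) {L X : ℝ} (hX : -L ≤ X) : 0 ≤ EI betaF x χ L X t :=
  intervalIntegral.integral_nonneg hX fun y _ => betaF_nonneg (P.bg (t + y)).x0 (P.bg (t + y)).x1

lemma Par.EI1 (P : Par k C C2 ε T0 x) (h : Sm χ) {L X : ℝ} (hX : -L ≤ X) (ht : T0 ≤ t) :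
    |t ^ (-ε) * EI (e1F k) x χ L X t| ≤ 1 / 2 * EI (e0F k) x χ L X t := by
  have ce0 := ev_cont (ev_sm (e0F_sm k) P.xc h) t
  have ce1 := ev_cont (ev_sm (e1F_sm k) P.xc h) t
  unfold EI
  rw [← intervalIntegral.integral_const_mul, ← intervalIntegral.integral_const_mul]
  refine (intervalIntegral.abs_integral_le_integral_abs hX).trans ?_
  apply intervalIntegral.integral_mono_on hX
    ((continuous_const.mul ce1).abs.intervalIntegrable _ _)
    ((continuous_const.mul ce0).intervalIntegrable _ _)
  intro y _
  have := P.e1_le (χ := χ) (s := t + y) ht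
  change |t ^ (-ε) * ev (e1F k) x χ t (t + y)| ≤ 1 / 2 * ev (e0F k) x χ t (t + y)
  rw [abs_mul, abs_of_pos (P.tau0 ht)]
  exact this

lemma int_key2 {f bz b e ez : ℝ → ℝ} {α β A B D τ A' : ℝ} (hab : α ≤ β)
    (hf : Continuous f) (hbz : Continuous bz) (hb : Continuous b) (he : Continuous e) (hez : Continuous ez)
    (h : ∀ y, τ * f y ≤ A * bz y + B * b y + D * (A' * (e y + ez y))) :
    τ * (∫ y in α..β, f y) ≤ A * (∫ y in α..β, bz y) + B * (∫ y in α..β, b y)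
      + D * (A' * ((∫ y in α..β, e y) + ∫ y in α..β, ez y)) := by
  have i0 : ∀ {f : ℝ → ℝ}, Continuous f → IntervalIntegrable f volume α β :=
    fun hf => hf.intervalIntegrable _ _
  rw [← intervalIntegral.integral_const_mul, ← intervalIntegral.integral_const_mul,
      ← intervalIntegral.integral_const_mul,
      ← intervalIntegral.integral_add (i0 (by fun_prop)) (i0 (by fun_prop)),
      ← intervalIntegral.integral_add (i0 he) (i0 hez),
      ← intervalIntegral.integral_const_mul, ← intervalIntegral.integral_const_mul,
      ← intervalIntegral.integral_add (i0 (by fun_prop)) (i0 (by fun_prop))]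
  apply intervalIntegral.integral_mono_on hab (i0 (by fun_prop)) (i0 (by fun_prop))
  intro y _
  exact h y

lemma Wp_sm (k : ℝ) {X ψ Y : ℝ → ℝ → ℝ} (hX : Sm X) (hY : Sm Y) (hψ : Sm ψ) :
    Sm (fun t s => Wp k (Y t s) (X t s) * ψ t s) := by
  unfold Sm Function.uncurry at *
  simp only [Wp, Vp]
  fun_prop

lemma Par.combined (P : Par k C C2 ε T0 x) :
    ∃ Λ K c : ℝ, 1 ≤ Λ ∧ 0 ≤ K ∧ 0 < c ∧ ∀ (ψ : ℝ → ℝ → ℝ), Sm ψ →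
      (∀ t s, pd_t (pd_t ψ) t s = pd_s (pd_s ψ) t s - Vp k (x s) * ψ t s) → ∀ L X t, T0 ≤ t → t ≤ L →
      -L ≤ X → (∀ᶠ w in nhds (t, t + X), Function.uncurry ψ w = 0) →
      ∃ D, HasDerivAt (En k x ε Λ ψ L X) D t ∧ D ≤ K * (t ^ (-ε) / t) * En k x ε Λ ψ L X t
        - c * (t ^ (-ε)) ^ 5 * (EI betaF x ψ L X t + EI betaF x (Svf ψ) L X t) := by
  have hk := (P.bg 0).k0
  have hC := (P.bg 0).C1
  have hC2 := P.C21
  set c := min (3 * k) (k ^ 3 / 2) with hc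
  have c0 : 0 < c := by rw [hc]; exact lt_min (by positivity) (by positivity)
  set K0 := 2000 * C ^ 3 with hK0
  set K1 := C2 ^ 2 * (13 + 5 * C) * (26 + 5 * C) / (c / 2) with hK1
  set K2 := 520 * C2 * C ^ 2 + C2 * C ^ 2 * (52 + 10 * C) with hK2
  have K00 : 0 ≤ K0 := by positivity
  have K10 : 0 ≤ K1 := by positivity
  have K20 : 0 ≤ K2 := by positivity
  have hΛ1 : 1 ≤ (K1 + 1) / c + 1 := by
    have : 0 ≤ (K1 + 1) / c := by positivity
    linarith
  refine ⟨(K1 + 1) / c + 1, 2 * (K0 + K2), min 1 (c / 2), hΛ1, by positivity, by positivity, ?_⟩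
  intro ψ hψ hw L X t ht hL hX hz
  have t0 : 0 < t := by linarith [P.T1]
  have hZ : Sm (Svf ψ) := hψ.svf
  have hρ : Sm (fun t s => Wp k s (x s) * ψ t s) := Wp_sm k (Sm.of_s P.xc) Sm.snd hψ
  have hwZ := svf_wave hψ P.x' hw
  have z0 := (hz).self_of_nhds
  have z1 := (van_t hψ hz).self_of_nhds
  have z2 := (van_s hψ hz).self_of_nhds
  have hzZ := van_svf hψ hz
  have y0 := (hzZ).self_of_nhds
  have y1 := (van_t hZ hzZ).self_of_nhds
  have y2 := (van_s hZ hzZ).self_of_nhds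
  obtain ⟨Dp, hDp, hDp'⟩ := P.field (ρ := fun _ _ => 0) hψ (Sm.const 0) (by intro t s; rw [hw]; ring)
    ht hL hX z0 z1 z2
  obtain ⟨Dz, hDz, hDz'⟩ := P.field hZ hρ hwZ ht hL hX y0 y1 y2
  have hτ := tau_deriv t0 ε
  have hD := (hDp.const_mul ((K1 + 1) / c + 1)).add ((hτ.pow 4).mul hDz)
  refine ⟨_, hD, ?_⟩
  have ep := abs_le.1 (P.EI1 hψ hX ht)
  have ez := abs_le.1 (P.EI1 hZ hX ht)
  simp only [zero_mul, intervalIntegral.integral_zero, add_zero] at hDp'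
  have hS := fun s => P.source (χ := Svf ψ) (ψ := ψ) (t := t) (s := s) ht (half_pos c0)
  have hE0p := P.EI0 (χ := ψ) (t := t) hX
  have hE0z := P.EI0 (χ := Svf ψ) (t := t) hX
  have τ0 := P.tau0 ht
  have τ1 := P.tau1 ht
  have i0 : ∀ {f : ℝ → ℝ}, Continuous f → IntervalIntegrable f volume (-L) X :=
    fun hf => hf.intervalIntegrable _ _
  have ce0 := ev_cont (ev_sm (e0F_sm k) P.xc hψ) t
  have ce0z := ev_cont (ev_sm (e0F_sm k) P.xc hZ) t
  have cb := ev_cont (ev_sm betaF_sm P.xc hψ) t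
  have cbz := ev_cont (ev_sm betaF_sm P.xc hZ) t
  have cs0 : Continuous fun y => ev (fun u v _ _ p m => s0F u v p m) x (Svf ψ) t (t + y) :=
    ev_cont (ev_sm s0F_sm P.xc hZ) t
  have cs1 := ev_cont (ev_sm (s1F_sm k) P.xc hZ) t
  have cρ : Continuous (fun y => Wp k (t + y) (x (t + y)) * ψ t (t + y)) :=
    hρ.cont_comp continuous_const (continuous_const.add continuous_id)
  have hS' : (t ^ (-ε)) ^ 4 * (∫ y in (-L)..X, (Wp k (t + y) (x (t + y)) * ψ t (t + y)) *
      (ev (fun u v _ _ p m => s0F u v p m) x (Svf ψ) t (t + y)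
        + t ^ (-ε) * ev (s1F k) x (Svf ψ) t (t + y))) ≤
      c / 2 * (t ^ (-ε)) ^ 5 * EI betaF x (Svf ψ) L X t + K1 * t ^ (-ε) * EI betaF x ψ L X t
        + K2 * (t ^ (-ε) / t) * ((t ^ (-ε)) ^ 4 * (EI (e0F k) x ψ L X t + EI (e0F k) x (Svf ψ) L X t)) := by
    exact int_key2 hX (cρ.mul (cs0.add (continuous_const.mul cs1))) cbz cb ce0 ce0z fun y => hS (t + y)
  refine comb_arith c0 K00 K10 K20 rfl τ0 τ1 (by positivity) hE0p hE0z (P.EIb hX) (P.EIb hX)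
    hDp' hDz' hS' (by linarith) (by linarith) ?_
  apply mul_nonpos_of_nonpos_of_nonneg _ (by linarith)
  have : 0 ≤ (t ^ (-ε)) ^ 3 * (ε * t ^ (-ε) / t) := by have := P.e0; positivity
  push_cast
  have e : (4:ℝ) * (fun t : ℝ => t ^ (-ε)) t ^ (4 - 1) * -(ε * t ^ (-ε) / t)
    = -(4 * ((t ^ (-ε)) ^ 3 * (ε * t ^ (-ε) / t))) := by norm_num; ring
  linarith

lemma Par.En_le (P : Par k C C2 ε T0 x) (hψ : Sm ψ) {L X Λ : ℝ} (hX : -L ≤ X) (ht : T0 ≤ t) (hΛ : 1 ≤ Λ) :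
    0 ≤ En k x ε Λ ψ L X t ∧
    En k x ε Λ ψ L X t ≤ 2 * Λ * (EI (e0F k) x ψ L X t + EI (e0F k) x (Svf ψ) L X t) := by
  have ep := abs_le.1 (P.EI1 hψ hX ht)
  have ez := abs_le.1 (P.EI1 hψ.svf hX ht)
  have hE0p := P.EI0 (χ := ψ) (t := t) hX
  have hE0z := P.EI0 (χ := Svf ψ) (t := t) hX
  have τ0 := P.tau0 ht
  have τ1 := P.tau1 ht
  unfold En
  set A := EI (e0F k) x ψ L X t
  set B := EI (e0F k) x (Svf ψ) L X t
  have t4 : (t ^ (-ε)) ^ 4 ≤ 1 := pow_le_one₀ τ0.le τ1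
  constructor
  · apply add_nonneg
    · apply mul_nonneg <;> linarith
    · apply mul_nonneg (by positivity); linarith
  · have h1 : Λ * (A + t ^ (-ε) * EI (e1F k) x ψ L X t) ≤ Λ * (2 * A) :=
      mul_le_mul_of_nonneg_left (by linarith) (by linarith)
    have h2 : (t ^ (-ε)) ^ 4 * (B + t ^ (-ε) * EI (e1F k) x (Svf ψ) L X t) ≤ Λ * (2 * B) :=
      mul_le_mul (t4.trans hΛ) (by linarith) (by linarith) (by linarith)
    linarith
end


section
variable {k C C2 ε T0 : ℝ} {x : ℝ → ℝ} {χ ψ : ℝ → ℝ → ℝ} {t s : ℝ}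

/-- cutoff -/
def etaF (sa sb s : ℝ) : ℝ := ((s - sa) * (sb - s)) ^ 2

/-- localized norm -/
def Yf (sa sb : ℝ) (ψ : ℝ → ℝ → ℝ) (t : ℝ) : ℝ :=
  ∫ s in sa..sb, etaF sa sb s * (ψ t s ^ 2 + pd_s ψ t s ^ 2)

def dse (sa sb s : ℝ) : ℝ :=
  ((s - sa) * (sb - s)) ^ 2 + s * (2 * ((s - sa) * (sb - s)) * (sb + sa - 2 * s))

lemma dse_has (sa sb s : ℝ) : HasDerivAt (fun s => etaF sa sb s * s) (dse sa sb s) s := by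
  have h1 : HasDerivAt (fun s : ℝ => (s - sa) * (sb - s)) (1 * (sb - s) + (s - sa) * -1) s :=
    ((hasDerivAt_id s).sub_const sa).mul ((hasDerivAt_id s).const_sub sb)
  refine ((h1.pow 2).mul (hasDerivAt_id s)).congr_deriv ?_
  simp only [dse, Pi.pow_apply, id]
  push_cast
  ring

lemma etaF_sm (sa sb : ℝ) : ContDiff ℝ (⊤ : ℕ∞) (etaF sa sb) := by
  unfold etaF; fun_prop

/-- the time derivative of the localized density -/
def Gf (sa sb : ℝ) (ψ : ℝ → ℝ → ℝ) (t s : ℝ) : ℝ :=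
  etaF sa sb s * (2 * ψ t s * (Svf ψ t s - s * pd_s ψ t s)
    + 2 * pd_s ψ t s * (pd_s (Svf ψ) t s - pd_s ψ t s)) + dse sa sb s * pd_s ψ t s ^ 2

lemma svf_s (h : Sm ψ) (t s : ℝ) :
    pd_s (Svf ψ) t s = t * pd_t (pd_s ψ) t s + (pd_s ψ t s + s * pd_s (pd_s ψ) t s) := by
  have := ((h.pd_t.ds t s).const_mul t).add ((hasDerivAt_id s).mul (h.pd_s.ds t s))
  rw [← h.comm]
  refine this.deriv.trans ?_
  simp

lemma Gf_sm (sa sb : ℝ) (h : Sm ψ) : Sm (Gf sa sb ψ) := by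
  have a1 : Sm (fun _ s => etaF sa sb s) := Sm.of_s (etaF_sm sa sb)
  have a2 : Sm (fun _ s => dse sa sb s) := Sm.of_s (by unfold dse; fun_prop)
  have h1 := h.pd_s
  have h2 := h.svf
  have h3 := h2.pd_s
  exact (a1.mul ((((Sm.const 2).mul h).mul (h2.sub (Sm.snd.mul h1))).add
    (((Sm.const 2).mul h1).mul (h3.sub h1)))).add (a2.mul (h1.pow 2))

lemma Yf_deriv (sa sb : ℝ) (h : Sm ψ) (t0 : 0 < t) :
    HasDerivAt (Yf sa sb ψ) ((∫ s in sa..sb, Gf sa sb ψ t s) / t) t := by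
  have a1 : Sm (fun _ s => etaF sa sb s) := Sm.of_s (etaF_sm sa sb)
  have hg : Sm (fun t s => etaF sa sb s * (ψ t s ^ 2 + pd_s ψ t s ^ 2)) :=
    a1.mul ((h.pow 2).add (h.pd_s.pow 2))
  refine (hg.param sa sb t).congr_deriv ?_
  have hB : ∀ s, HasDerivAt (fun s => etaF sa sb s * s * pd_s ψ t s ^ 2)
      (Gf sa sb ψ t s - t * pd_t (fun t s => etaF sa sb s * (ψ t s ^ 2 + pd_s ψ t s ^ 2)) t s) s := by
    intro s
    refine ((dse_has sa sb s).mul ((h.pd_s.ds t s).pow 2)).congr_deriv ?_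
    have e : pd_t (fun t s => etaF sa sb s * (ψ t s ^ 2 + pd_s ψ t s ^ 2)) t s =
        etaF sa sb s * (2 * ψ t s * pd_t ψ t s + 2 * pd_s ψ t s * pd_t (pd_s ψ) t s) := by
      have := (((h.dt t s).pow 2).add ((h.pd_s.dt t s).pow 2)).const_mul (etaF sa sb s)
      refine this.deriv.trans ?_
      push_cast; ring
    rw [e]
    unfold Gf
    rw [svf_s h]
    unfold Svf
    simp only [Pi.pow_apply]
    push_cast
    ring
  have cG : Continuous (fun s => Gf sa sb ψ t s) := (Gf_sm sa sb h).cont_comp continuous_const continuous_id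
  have cg : Continuous (fun s => pd_t (fun t s => etaF sa sb s * (ψ t s ^ 2 + pd_s ψ t s ^ 2)) t s) :=
    hg.pd_t.cont_comp continuous_const continuous_id
  have ctg : Continuous (fun s => t * pd_t (fun t s => etaF sa sb s * (ψ t s ^ 2 + pd_s ψ t s ^ 2)) t s) :=
    continuous_const.mul cg
  have key := intervalIntegral.integral_eq_sub_of_hasDerivAt (a := sa) (b := sb) (fun s _ => hB s)
    ((cG.sub ctg).intervalIntegrable _ _)
  rw [intervalIntegral.integral_sub (cG.intervalIntegrable _ _)
    (ctg.intervalIntegrable _ _), intervalIntegral.integral_const_mul] at key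
  have : etaF sa sb sb * sb * pd_s ψ t sb ^ 2 - etaF sa sb sa * sa * pd_s ψ t sa ^ 2 = 0 := by
    unfold etaF; ring
  rw [this] at key
  rw [eq_div_iff t0.ne']
  linarith

lemma G_arith {e d s m a b z w : ℝ} (he : 0 ≤ e) (he' : e ≤ m) (hd : |d| ≤ m) (hs : |s| ≤ m) :
    e * (2 * a * (z - s * b) + 2 * b * (w - b)) + d * b ^ 2 ≤ (4 * m + m ^ 2) * (a ^ 2 + b ^ 2 + z ^ 2 + w ^ 2) := by
  have m0 : 0 ≤ m := he.trans he'
  have h1 : 2 * a * (z - s * b) + 2 * b * (w - b) ≤ (2 + m) * (a ^ 2 + b ^ 2 + z ^ 2 + w ^ 2) := by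
    have : -(2 * a * (s * b)) ≤ m * (a ^ 2 + b ^ 2) := by
      calc -(2 * a * (s * b)) ≤ |2 * a * b * s| := by
            have := neg_abs_le (2 * a * b * s); linarith
        _ = |2 * a * b| * |s| := abs_mul _ _
        _ ≤ (a ^ 2 + b ^ 2) * m := by
            apply mul_le_mul _ hs (abs_nonneg _) (by positivity)
            rw [abs_le]; constructor <;> nlinarith [sq_nonneg (a + b), sq_nonneg (a - b)]
        _ = _ := by ring
    nlinarith [sq_nonneg (a - z), sq_nonneg (b - w), sq_nonneg b, mul_nonneg m0 (sq_nonneg z), mul_nonneg m0 (sq_nonneg w), sq_nonneg a, sq_nonneg z, sq_nonneg w]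
  have h2 : d * b ^ 2 ≤ m * (a ^ 2 + b ^ 2 + z ^ 2 + w ^ 2) := by
    calc d * b ^ 2 ≤ m * b ^ 2 := by gcongr; exact (le_abs_self d).trans hd
      _ ≤ _ := by gcongr; nlinarith [sq_nonneg a, sq_nonneg z, sq_nonneg w]
  have h3 : e * (2 * a * (z - s * b) + 2 * b * (w - b)) ≤ m * ((2 + m) * (a ^ 2 + b ^ 2 + z ^ 2 + w ^ 2)) := by
    calc _ ≤ e * ((2 + m) * (a ^ 2 + b ^ 2 + z ^ 2 + w ^ 2)) := by gcongr
      _ ≤ _ := by gcongr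
  nlinarith [mul_nonneg m0 (by positivity : 0 ≤ a ^ 2 + b ^ 2 + z ^ 2 + w ^ 2)]

/-- lower bound for the Morawetz density on compact sets -/
lemma beta_low {b X c p m : ℝ} (x0 : 0 < X) (x1 : X < 1) (hb : 16 * b ≤ X ^ 4 * (1 - X))
    (hs1 : 2 * |s| ≤ t) :
    b * t ^ 2 * (c ^ 2 + ((p - m) / 2) ^ 2) ≤ betaF ((t - s) / 2) ((t + s) / 2) X c p m := by
  unfold betaF
  have hs := abs_le.1 (le_refl |s|)
  have t0 : 0 ≤ t := by linarith [abs_nonneg s]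
  have y : X ^ 4 * (1 - X) ≤ X ^ 2 * (1 - X) := by
    have : X ^ 4 ≤ X ^ 2 := pow_le_pow_of_le_one x0.le x1.le (by norm_num)
    apply mul_le_mul_of_nonneg_right this (by linarith)
  have hu : t ^ 2 / 16 ≤ ((t - s) / 2) ^ 2 := by
    have : t / 4 ≤ (t - s) / 2 := by linarith
    calc t ^ 2 / 16 = (t / 4) ^ 2 := by ring
      _ ≤ _ := by gcongr
  have hv : t ^ 2 / 16 ≤ ((t + s) / 2) ^ 2 := by
    have : t / 4 ≤ (t + s) / 2 := by linarith
    calc t ^ 2 / 16 = (t / 4) ^ 2 := by ring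
      _ ≤ _ := by gcongr
  have y0 : 0 ≤ X ^ 4 * (1 - X) := by
    have : 0 ≤ 1 - X := by linarith
    positivity
  have a1 : X ^ 4 * (1 - X) * (t ^ 2 / 16 * p ^ 2 + t ^ 2 / 16 * m ^ 2) ≤
      X ^ 2 * (1 - X) * (((t + s) / 2) ^ 2 * p ^ 2 + ((t - s) / 2) ^ 2 * m ^ 2) := by
    apply mul_le_mul y _ (by positivity) (y0.trans y)
    gcongr
  have a2 : ((p - m) / 2) ^ 2 ≤ p ^ 2 + m ^ 2 := by nlinarith [sq_nonneg (p + m), sq_nonneg p, sq_nonneg m]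
  have a3 : 16 * b * (t ^ 2 * (c ^ 2 + (p ^ 2 + m ^ 2))) ≤ X ^ 4 * (1 - X) * (t ^ 2 * (c ^ 2 + (p ^ 2 + m ^ 2))) := by
    gcongr
  have e : (t - s) / 2 + (t + s) / 2 = t := by ring
  rw [e]
  by_cases hb0 : 0 ≤ b
  · have a4 : b * t ^ 2 * (c ^ 2 + ((p - m) / 2) ^ 2) ≤ b * t ^ 2 * (c ^ 2 + (p ^ 2 + m ^ 2)) := by
      gcongr
    have a5 : 0 ≤ X ^ 4 * (1 - X) * (t ^ 2 * c ^ 2) := by positivity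
    linarith
  · have a4 : b * t ^ 2 * (c ^ 2 + ((p - m) / 2) ^ 2) ≤ 0 := by
      apply mul_nonpos_of_nonpos_of_nonneg _ (by positivity)
      apply mul_nonpos_of_nonpos_of_nonneg (by linarith) (by positivity)
    have a5 : 0 ≤ X ^ 2 * (1 - X) := y0.trans y
    have a6 : 0 ≤ X ^ 2 * (1 - X) * (((t + s) / 2) ^ 2 * p ^ 2 + ((t - s) / 2) ^ 2 * m ^ 2) := by positivity
    have a5 : 0 ≤ t ^ 2 * (X ^ 4 * (1 - X)) * c ^ 2 := by positivity
    linarith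

lemma beta_up {u v X c p m : ℝ} (hk : 0 < k) (x0 : 0 < X) (x1 : X < 1) :
    betaF u v X c p m ≤ (1 + 2 / k ^ 2) * e0F k u v X c p m := by
  unfold betaF e0F Vp
  have y : 0 ≤ 1 - X := by linarith
  have a1 : X ^ 2 * (1 - X) * (v ^ 2 * p ^ 2 + u ^ 2 * m ^ 2) ≤ 1 * ((v ^ 2 + 1) * p ^ 2 + (u ^ 2 + 1) * m ^ 2) := by
    apply mul_le_mul _ _ (by positivity) (by norm_num)
    · exact mul_le_one₀ (pow_le_one₀ x0.le x1.le) y (by linarith)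
    · gcongr <;> linarith
  have a2 : (u + v) ^ 2 * (X ^ 4 * (1 - X)) * c ^ 2 ≤ 2 / k ^ 2 * (k ^ 2 * X ^ 3 * (1 - X) * (u ^ 2 + v ^ 2 + 2) * c ^ 2) := by
    have : 2 / k ^ 2 * (k ^ 2 * X ^ 3 * (1 - X) * (u ^ 2 + v ^ 2 + 2) * c ^ 2) =
      2 * (u ^ 2 + v ^ 2 + 2) * (X ^ 3 * (1 - X)) * c ^ 2 := by field_simp
    rw [this]
    have h1 : (u + v) ^ 2 ≤ 2 * (u ^ 2 + v ^ 2 + 2) := by nlinarith [sq_nonneg (u - v)]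
    have h2 : X ^ 4 ≤ X ^ 3 := pow_le_pow_of_le_one x0.le x1.le (by norm_num)
    gcongr
  have a3 : 0 ≤ 2 / k ^ 2 * ((v ^ 2 + 1) * p ^ 2 + (u ^ 2 + 1) * m ^ 2) := by positivity
  have a4 : 0 ≤ k ^ 2 * X ^ 3 * (1 - X) * (u ^ 2 + v ^ 2 + 2) * c ^ 2 := by positivity
  linarith

end


section
variable {k C C2 ε T0 : ℝ} {x : ℝ → ℝ} {χ ψ : ℝ → ℝ → ℝ} {t s : ℝ}

lemma EI_eq (F : ℝ → ℝ → ℝ → ℝ → ℝ → ℝ → ℝ) (L X : ℝ) :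
    EI F x χ L X t = ∫ s in (t - L)..(t + X), ev F x χ t s := by
  unfold EI
  rw [intervalIntegral.integral_comp_add_left (fun s => ev F x χ t s) t, ← sub_eq_add_neg]

lemma Par.beta_int (P : Par k C C2 ε T0 x) (h : Sm χ) {L X sa sb : ℝ} (hab : sa ≤ sb)
    (h1 : t - L ≤ sa) (h2 : sb ≤ t + X) :
    ∫ s in sa..sb, ev betaF x χ t s ≤ EI betaF x χ L X t := by
  rw [EI_eq]
  have c : Continuous (fun s => ev betaF x χ t s) :=
    (ev_sm betaF_sm P.xc h).cont_comp continuous_const continuous_id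
  apply intervalIntegral.integral_mono_interval h1 hab h2 _ (c.intervalIntegrable _ _)
  exact Filter.Eventually.of_forall fun s => betaF_nonneg (P.bg s).x0 (P.bg s).x1

/-- integral comparison on the compact region -/
lemma Par.cmp (P : Par k C C2 ε T0 x) (h : Sm ψ) {L X sa sb A : ℝ} (hab : sa ≤ sb) (hA : 0 ≤ A)
    (h1 : t - L ≤ sa) (h2 : sb ≤ t + X) {f : ℝ → ℝ} (hf : Continuous f)
    (hle : ∀ s ∈ Set.Icc sa sb, f s ≤ A * (ev betaF x ψ t s + ev betaF x (Svf ψ) t s)) :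
    ∫ s in sa..sb, f s ≤ A * (EI betaF x ψ L X t + EI betaF x (Svf ψ) L X t) := by
  have c1 : Continuous (fun s => ev betaF x ψ t s) :=
    (ev_sm betaF_sm P.xc h).cont_comp continuous_const continuous_id
  have c2 : Continuous (fun s => ev betaF x (Svf ψ) t s) :=
    (ev_sm betaF_sm P.xc h.svf).cont_comp continuous_const continuous_id
  have c3 : Continuous (fun s => A * (ev betaF x ψ t s + ev betaF x (Svf ψ) t s)) :=
    continuous_const.mul (c1.add c2)
  calc _ ≤ ∫ s in sa..sb, A * (ev betaF x ψ t s + ev betaF x (Svf ψ) t s) :=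
        intervalIntegral.integral_mono_on hab (hf.intervalIntegrable _ _) (c3.intervalIntegrable _ _) hle
    _ = A * ((∫ s in sa..sb, ev betaF x ψ t s) + ∫ s in sa..sb, ev betaF x (Svf ψ) t s) := by
        rw [intervalIntegral.integral_const_mul, intervalIntegral.integral_add (c1.intervalIntegrable _ _)
          (c2.intervalIntegrable _ _)]
    _ ≤ _ := mul_le_mul_of_nonneg_left
        (add_le_add (P.beta_int h hab h1 h2) (P.beta_int h.svf hab h1 h2)) hA

lemma Par.YB (P : Par k C C2 ε T0 x) {sa sb : ℝ} (hab : sa < sb) (ha : 2 * |sa| ≤ T0) (hb : 2 * |sb| ≤ T0) :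
    ∃ K : ℝ, 0 ≤ K ∧ ∀ ψ, Sm ψ → ∀ t L X, T0 ≤ t → t - L ≤ sa → sb ≤ t + X →
      0 ≤ Yf sa sb ψ t ∧
      Yf sa sb ψ t ≤ K / t ^ 2 * (EI betaF x ψ L X t + EI betaF x (Svf ψ) L X t) ∧
      ∫ s in sa..sb, Gf sa sb ψ t s ≤ K / t ^ 2 * (EI betaF x ψ L X t + EI betaF x (Svf ψ) L X t) := by
  have xcont : Continuous x := P.xc.continuous
  obtain ⟨z, hz, hzm⟩ := (isCompact_Icc (a := sa) (b := sb)).exists_isMinOn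
    (f := fun s => x s ^ 4 * (1 - x s)) ⟨sa, ⟨le_rfl, hab.le⟩⟩ (by fun_prop)
  obtain ⟨m1, hm1⟩ := (isCompact_Icc (a := sa) (b := sb)).exists_bound_of_continuousOn
    (f := etaF sa sb) (etaF_sm sa sb).continuous.continuousOn
  obtain ⟨m2, hm2⟩ := (isCompact_Icc (a := sa) (b := sb)).exists_bound_of_continuousOn
    (f := dse sa sb) (by unfold dse; fun_prop)
  set b0 := x z ^ 4 * (1 - x z) with hb0
  have b00 : 0 < b0 := by
    have h1 := (P.bg z).x0
    have h2 := (P.bg z).x1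
    have : 0 < 1 - x z := by linarith
    positivity
  set b := b0 / 16 with hbd
  have b1 : 0 < b := by positivity
  set m := max (max m1 m2) T0 with hm
  have T1 := P.T1
  have hs2 : ∀ s ∈ Set.Icc sa sb, 2 * |s| ≤ T0 := by
    intro s hs
    have := abs_le_max_abs_abs hs.1 hs.2
    rcases max_choice |sa| |sb| with h | h <;> rw [h] at this <;> linarith
  have m0 : 0 ≤ m := by
    have : T0 ≤ m := le_max_right _ _
    linarith
  refine ⟨(4 * m + m ^ 2) / b, by positivity, ?_⟩
  intro ψ h t L X ht h1 h2
  have t0 : 0 < t := by linarith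
  have low : ∀ χ : ℝ → ℝ → ℝ, ∀ s ∈ Set.Icc sa sb,
      χ t s ^ 2 + pd_s χ t s ^ 2 ≤ 1 / (b * t ^ 2) * ev betaF x χ t s := by
    intro χ s hs
    have hbl := beta_low (t := t) (s := s) (c := χ t s) (p := pd_t χ t s + pd_s χ t s)
      (m := pd_t χ t s - pd_s χ t s) (b := b) (P.bg s).x0 (P.bg s).x1
      (by have : b0 ≤ x s ^ 4 * (1 - x s) := hzm hs
          rw [hbd]; linarith)
      (by have := hs2 s hs; linarith)
    have e : (pd_t χ t s + pd_s χ t s - (pd_t χ t s - pd_s χ t s)) / 2 = pd_s χ t s := by ring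
    rw [e] at hbl
    rw [one_div, ← div_eq_inv_mul, le_div_iff₀ (by positivity)]
    calc _ = b * t ^ 2 * (χ t s ^ 2 + pd_s χ t s ^ 2) := by ring
      _ ≤ _ := hbl
  have eK : (4 * m + m ^ 2) / b / t ^ 2 = (4 * m + m ^ 2) * (1 / (b * t ^ 2)) := by field_simp
  have hm1' : ∀ s ∈ Set.Icc sa sb, etaF sa sb s ≤ m := fun s hs =>
    (le_abs_self _).trans ((hm1 s hs).trans ((le_max_left _ _).trans (le_max_left _ _)))
  have hm2' : ∀ s ∈ Set.Icc sa sb, |dse sa sb s| ≤ m := fun s hs =>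
    (hm2 s hs).trans ((le_max_right _ _).trans (le_max_left _ _))
  have hms : ∀ s ∈ Set.Icc sa sb, |s| ≤ m := fun s hs => by
    have := hs2 s hs
    have h' : T0 ≤ m := le_max_right _ _
    linarith [abs_nonneg s]
  have eta0 : ∀ s, 0 ≤ etaF sa sb s := fun s => by unfold etaF; positivity
  have be0 : ∀ χ : ℝ → ℝ → ℝ, ∀ s, 0 ≤ ev betaF x χ t s := fun χ s => betaF_nonneg (P.bg s).x0 (P.bg s).x1
  refine ⟨intervalIntegral.integral_nonneg hab.le fun s _ => mul_nonneg (eta0 s) (by positivity), ?_, ?_⟩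
  · refine P.cmp h hab.le (by positivity) h1 h2 ?_ ?_
    · exact (((Sm.of_s (etaF_sm sa sb)).mul ((h.pow 2).add (h.pd_s.pow 2))).cont_comp
        (continuous_const (y := t)) continuous_id)
    · intro s hs
      have l1 := low ψ s hs
      have l2 := low (Svf ψ) s hs
      rw [eK, mul_assoc]
      apply mul_le_mul _ _ (by positivity) (by positivity)
      · nlinarith [hm1' s hs]
      · have : 0 ≤ 1 / (b * t ^ 2) * ev betaF x (Svf ψ) t s := mul_nonneg (by positivity) (be0 _ s)
        linarith
  · refine P.cmp h hab.le (by positivity) h1 h2 ?_ ?_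
    · exact ((Gf_sm sa sb h).cont_comp (continuous_const (y := t)) continuous_id)
    · intro s hs
      have l1 := low ψ s hs
      have l2 := low (Svf ψ) s hs
      rw [eK, mul_assoc]
      refine (G_arith (eta0 s) (hm1' s hs) (hm2' s hs) (hms s hs)).trans ?_
      apply mul_le_mul_of_nonneg_left _ (by positivity)
      linarith

lemma H_arith {A c K σ τ5 B E E' G Y Yd Kp q : ℝ} (hA : A * c = 4 * Kp) (hG : 1 ≤ G) (hA0 : 0 ≤ A)
    (hc : 0 ≤ c) (hB : 0 ≤ B) (hτ : 0 ≤ τ5) (hE' : E' ≤ K * σ * E - c * τ5 * B)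
    (hY : q * Y ≤ 3 * (Kp * τ5 * B)) (hYd : Yd ≤ Kp * τ5 * B) :
    A * (-(K * σ * G) * E + G * E') + (q * Y + Yd) ≤ 0 := by
  have h1 : A * (G * E') ≤ A * (G * (K * σ * E - c * τ5 * B)) := by gcongr
  have h2 : A * c * (τ5 * B) ≤ A * c * (G * (τ5 * B)) := by
    apply mul_le_mul_of_nonneg_left _ (by positivity)
    have : 0 ≤ τ5 * B := by positivity
    nlinarith
  have h3 : A * c * (τ5 * B) = 4 * (Kp * τ5 * B) := by rw [hA]; ring
  nlinarith

/-- decay in a compact region -/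
lemma Par.compact (P : Par k C C2 ε T0 x) {sa sb : ℝ} (hab : sa < sb) (ha : 2 * |sa| ≤ T0) (hb : 2 * |sb| ≤ T0) :
    ∃ K : ℝ, 0 ≤ K ∧ ∀ ψ, Sm ψ → 
      (∀ t s, pd_t (pd_t ψ) t s = pd_s (pd_s ψ) t s - Vp k (x s) * ψ t s) → ∀ T L X, T0 ≤ T → T ≤ L →
      T - L ≤ sa → sb ≤ T0 + X → -L ≤ X →
      (∀ t ∈ Set.Icc T0 T, ∀ᶠ w in nhds (t, t + X), Function.uncurry ψ w = 0) →
      T ^ (3 - 5 * ε) * Yf sa sb ψ T ≤ K * (EI (e0F k) x ψ L X T0 + EI (e0F k) x (Svf ψ) L X T0) := by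
  obtain ⟨Λ, K, c, hΛ, hK, hc, hcomb⟩ := P.combined
  obtain ⟨Kp, hKp, hY⟩ := P.YB hab ha hb
  have T1 := P.T1
  have hk := (P.bg 0).k0
  have e0 := P.e0
  have e1 := P.e1
  set A := 4 * Kp / c with hAd
  have A0 : 0 ≤ A := by positivity
  have hA : A * c = 4 * Kp := by rw [hAd]; field_simp
  set Γ : ℝ → ℝ := fun t => exp (K / ε * t ^ (-ε)) with hΓ
  have Γ1 : ∀ t, T0 ≤ t → 1 ≤ Γ t := fun t ht => by
    apply Real.one_le_exp
    have := P.tau0 ht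
    positivity
  refine ⟨A * Γ T0 * (2 * Λ) + T0 ^ 3 * Kp * (1 + 2 / k ^ 2), by positivity, ?_⟩
  intro ψ h hw T L X hT hL hLa hXb hLX hz
  have hLX' := hLX
  have hY' : ∀ t ∈ Set.Icc T0 T, _ := fun t (ht : t ∈ Set.Icc T0 T) => 
    hY ψ h t L X ht.1 (by linarith [ht.2]) (by linarith [ht.1])
  set q := 3 - 5 * ε with hq
  set H : ℝ → ℝ := fun t => A * (Γ t * En k x ε Λ ψ L X t) + t ^ q * Yf sa sb ψ t with hH
  have hd : ∀ t ∈ Set.Icc T0 T, ∃ D, HasDerivAt H D t ∧ D ≤ 0 := by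
    intro t ht
    obtain ⟨D, hD, hDle⟩ := hcomb ψ h hw L X t ht.1 (by linarith [ht.2]) hLX (hz t ht)
    have t0 : 0 < t := by linarith [ht.1]
    have hτ := tau_deriv t0 ε
    have hΓd : HasDerivAt Γ (-(K * (t ^ (-ε) / t) * Γ t)) t := by
      refine (hτ.const_mul (K / ε)).exp.congr_deriv ?_
      simp only [hΓ]; field_simp
    have hqd : HasDerivAt (fun t : ℝ => t ^ q) (q * t ^ (q - 1)) t :=
      Real.hasDerivAt_rpow_const (Or.inl t0.ne')
    refine ⟨_, ((hΓd.mul hD).const_mul A).add (hqd.mul (Yf_deriv sa sb h t0)), ?_⟩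
    obtain ⟨y0, y1, y2⟩ := hY' t ht
    set B := EI betaF x ψ L X t + EI betaF x (Svf ψ) L X t with hB
    have B0 : 0 ≤ B := add_nonneg (P.EIb hLX) (P.EIb hLX)
    have eτ : t ^ (q - 1) = (t ^ (-ε)) ^ 5 * t ^ 2 := by
      rw [← rpow_natCast, ← rpow_natCast, ← rpow_mul t0.le, ← rpow_add t0, hq]
      congr 1; push_cast; ring
    have eq : t ^ q = t ^ (q - 1) * t := by
      rw [← rpow_add_one t0.ne']; congr 1; ring
    have τ5 : 0 ≤ (t ^ (-ε)) ^ 5 := by have := P.tau0 ht.1; positivity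
    have p0 : 0 ≤ t ^ (q - 1) := by positivity
    have a1 : t ^ (q - 1) * Yf sa sb ψ t ≤ Kp * (t ^ (-ε)) ^ 5 * B := by
      calc _ ≤ t ^ (q - 1) * (Kp / t ^ 2 * B) := by gcongr
        _ = _ := by rw [eτ]; field_simp
    have a2 : t ^ q * ((∫ s in sa..sb, Gf sa sb ψ t s) / t) ≤ Kp * (t ^ (-ε)) ^ 5 * B := by
      calc _ = t ^ (q - 1) * (∫ s in sa..sb, Gf sa sb ψ t s) := by rw [eq]; field_simp
        _ ≤ t ^ (q - 1) * (Kp / t ^ 2 * B) := by gcongr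
        _ = _ := by rw [eτ]; field_simp
    have a3 : q * (t ^ (q - 1) * Yf sa sb ψ t) ≤ 3 * (Kp * (t ^ (-ε)) ^ 5 * B) := by
      have : 0 ≤ t ^ (q - 1) * Yf sa sb ψ t := by positivity
      calc _ ≤ 3 * (t ^ (q - 1) * Yf sa sb ψ t) := by gcongr; linarith
        _ ≤ _ := by gcongr
    have := H_arith (q := q) hA (Γ1 t ht.1) A0 hc.le B0 τ5 hDle a3 a2
    rw [← mul_assoc q] at this
    exact this
  choose! D hD hD0 using hd
  have anti : AntitoneOn H (Set.Icc T0 T) := by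
    apply antitoneOn_of_deriv_nonpos (convex_Icc _ _)
    · intro t ht; exact (hD t ht).continuousAt.continuousWithinAt
    · intro t ht; exact (hD t (interior_subset ht)).differentiableAt.differentiableWithinAt
    · intro t ht; rw [(hD t (interior_subset ht)).deriv]; exact hD0 t (interior_subset ht)
  have hfin := anti ⟨le_rfl, hT⟩ ⟨hT, le_rfl⟩ hT
  have enT := P.En_le (t := T) h hLX hT hΛ
  have en0 := P.En_le (t := T0) h hLX le_rfl hΛ
  obtain ⟨_, y1, _⟩ := hY' T0 ⟨le_rfl, hT⟩
  have hΓT := Γ1 T hT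
  have hΓ0 := Γ1 T0 le_rfl
  have i1 : 0 ≤ A * (Γ T * En k x ε Λ ψ L X T) := mul_nonneg A0 (mul_nonneg (by linarith) enT.1)
  have hbe : ∀ χ, Sm χ → EI betaF x χ L X T0 ≤ (1 + 2 / k ^ 2) * EI (e0F k) x χ L X T0 := by
    intro χ hχ
    have ce := ev_cont (ev_sm (e0F_sm k) P.xc hχ) T0
    have cb := ev_cont (ev_sm betaF_sm P.xc hχ) T0
    unfold EI
    rw [← intervalIntegral.integral_const_mul]
    apply intervalIntegral.integral_mono_on hLX (cb.intervalIntegrable _ _)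
      ((continuous_const.mul ce).intervalIntegrable _ _)
    intro y _
    exact beta_up hk (P.bg (T0 + y)).x0 (P.bg (T0 + y)).x1
  have b1 := hbe ψ h
  have b2 := hbe (Svf ψ) h.svf
  set Q := EI (e0F k) x ψ L X T0 + EI (e0F k) x (Svf ψ) L X T0 with hQ
  have Q0 : 0 ≤ Q := add_nonneg (P.EI0 hLX) (P.EI0 hLX)
  have i2 : A * (Γ T0 * En k x ε Λ ψ L X T0) ≤ A * Γ T0 * (2 * Λ) * Q := by
    calc _ ≤ A * (Γ T0 * (2 * Λ * Q)) := by gcongr; exact en0.2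
      _ = _ := by ring
  have i3 : T0 ^ q * Yf sa sb ψ T0 ≤ T0 ^ 3 * Kp * (1 + 2 / k ^ 2) * Q := by
    have hTq : T0 ^ q ≤ T0 ^ 3 := by
      rw [← rpow_natCast]; apply rpow_le_rpow_of_exponent_le T1; push_cast; linarith
    have hy : Yf sa sb ψ T0 ≤ Kp * ((1 + 2 / k ^ 2) * Q) := by
      refine y1.trans ?_
      have : Kp / T0 ^ 2 ≤ Kp := div_le_self hKp (one_le_pow₀ T1)
      have hs : EI betaF x ψ L X T0 + EI betaF x (Svf ψ) L X T0 ≤ (1 + 2 / k ^ 2) * Q := by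
        rw [hQ]; linarith
      exact mul_le_mul this hs (add_nonneg (P.EIb hLX) (P.EIb hLX)) hKp
    calc _ ≤ T0 ^ 3 * (Kp * ((1 + 2 / k ^ 2) * Q)) :=
          mul_le_mul hTq hy (by assumption) (by positivity)
      _ = _ := by ring
  simp only [hH] at hfin
  linarith

/-- one-dimensional Sobolev -/
lemma sobolev {f f' : ℝ → ℝ} {a b : ℝ} (hab : a + 1 ≤ b) (hf : ∀ s, HasDerivAt f (f' s) s) (hc : Continuous f')
    {s : ℝ} (hs : s ∈ Set.Icc a b) : f s ^ 2 ≤ 2 * ∫ y in a..b, (f y ^ 2 + f' y ^ 2) := by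
  have cf : Continuous f := continuous_iff_continuousAt.2 fun s => (hf s).continuousAt
  have cF : Continuous (fun y => f y ^ 2 + f' y ^ 2) := by fun_prop
  set D := ∫ y in a..b, (f y ^ 2 + f' y ^ 2) with hD
  have D0 : 0 ≤ D := intervalIntegral.integral_nonneg (by linarith) fun y _ => by positivity
  have h1 : ∀ y ∈ Set.Icc a b, f s ^ 2 - D ≤ f y ^ 2 := by
    intro y hy
    have hd : ∀ z ∈ Set.uIcc y s, HasDerivAt (fun z => f z ^ 2) (2 * f z * f' z) z := by
      intro z _
      refine ((hf z).pow 2).congr_deriv (by push_cast; ring)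
    have e := intervalIntegral.integral_eq_sub_of_hasDerivAt hd
      ((by fun_prop : Continuous fun z => 2 * f z * f' z).intervalIntegrable _ _)
    have : |∫ z in y..s, 2 * f z * f' z| ≤ D := by
      calc _ ≤ |∫ z in y..s, (f z ^ 2 + f' z ^ 2)| := by
            refine intervalIntegral.norm_integral_le_abs_of_norm_le (μ := volume)
              (f := fun z => 2 * f z * f' z) (g := fun z => f z ^ 2 + f' z ^ 2)
              (Filter.Eventually.of_forall fun z => ?_) (cF.intervalIntegrable _ _)
            rw [Real.norm_eq_abs, abs_le]
            constructor <;> nlinarith [sq_nonneg (f z + f' z), sq_nonneg (f z - f' z)]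
        _ ≤ D := by
            have := intervalIntegral.abs_integral_mono_interval (a := y) (b := s) (c := a) (d := b)
              (f := fun z => f z ^ 2 + f' z ^ 2) (μ := volume)
              (by
                rw [Set.uIoc_of_le (by linarith : a ≤ b)]
                intro z hz
                rcases Set.mem_uIoc.1 hz with h | h
                · exact ⟨by linarith [hy.1, h.1], by linarith [hs.2, h.2]⟩
                · exact ⟨by linarith [hs.1, h.1], by linarith [hy.2, h.2]⟩)
              (Filter.Eventually.of_forall fun z => by simp only [Pi.zero_apply]; positivity)
              (cF.intervalIntegrable _ _)
            rw [← hD, abs_of_nonneg D0] at this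
            exact this
    have := (abs_le.1 this).2
    linarith
  have h2 : ∫ y in a..b, (f s ^ 2 - D) ≤ ∫ y in a..b, f y ^ 2 :=
    intervalIntegral.integral_mono_on (by linarith) (continuous_const.intervalIntegrable _ _)
      ((by fun_prop : Continuous fun z => f z ^ 2).intervalIntegrable _ _) h1
  have h3 : ∫ y in a..b, f y ^ 2 ≤ D :=
    intervalIntegral.integral_mono_on (by linarith)
      ((by fun_prop : Continuous fun z => f z ^ 2).intervalIntegrable _ _) (cF.intervalIntegrable _ _)
      fun y _ => by nlinarith [sq_nonneg (f' y)]
  rw [intervalIntegral.integral_const, smul_eq_mul] at h2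
  by_contra hcon
  rw [not_le] at hcon
  nlinarith

lemma Yf_sup {sa sb : ℝ} (h : Sm ψ) (hab : sa + 3 ≤ sb) (hs : s ∈ Set.Icc (sa + 1) (sb - 1)) :
    ψ t s ^ 2 ≤ 2 * Yf sa sb ψ t := by
  have c1 : Continuous (fun s => pd_s ψ t s) := h.pd_s.cont_comp continuous_const continuous_id
  have c0 : Continuous (fun s => ψ t s) := h.cont_comp continuous_const continuous_id
  have c2 : Continuous (etaF sa sb) := (etaF_sm sa sb).continuous
  refine (sobolev (a := sa + 1) (b := sb - 1) (f := fun s => ψ t s) (by linarith) (h.ds t) c1 hs).trans ?_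
  have cF : Continuous (fun s => etaF sa sb s * (ψ t s ^ 2 + pd_s ψ t s ^ 2)) :=
    c2.mul ((c0.pow 2).add (c1.pow 2))
  apply mul_le_mul_of_nonneg_left _ (by norm_num)
  calc _ ≤ ∫ s in (sa + 1)..(sb - 1), etaF sa sb s * (ψ t s ^ 2 + pd_s ψ t s ^ 2) := by
        apply intervalIntegral.integral_mono_on (by linarith)
          (((c0.pow 2).add (c1.pow 2)).intervalIntegrable _ _) (cF.intervalIntegrable _ _)
        intro y hy
        apply le_mul_of_one_le_left (add_nonneg (sq_nonneg _) (sq_nonneg _))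
        unfold etaF
        apply one_le_pow₀
        nlinarith [hy.1, hy.2]
    _ ≤ _ := by
        apply intervalIntegral.integral_mono_interval (by linarith) (by linarith) (by linarith) _
          (cF.intervalIntegrable _ _)
        exact Filter.Eventually.of_forall fun s => by
          simp only [Pi.zero_apply]; unfold etaF; positivity

lemma par_exists {M : ℝ} {r : ℝ → ℝ} (hM : 0 < M) (hr : IsTortoise M r) (e0 : 0 < ε) (e1 : ε ≤ 1 / 4) (B : ℝ) :
    ∃ C C2 T0, B ≤ T0 ∧ Par (1 / (2 * M)) C C2 ε T0 (muS M r) := by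
  obtain ⟨C, hC⟩ := bg_exists hM hr
  obtain ⟨C2, hC2, hsrc⟩ := src_exists hM hr e0 e1
  have C1 := (hC 0).C1
  have hk := (hC 0).k0
  have l0 := tendsto_rpow_neg_atTop e0
  have l1 : Filter.Tendsto (fun t : ℝ => t * t ^ (-ε)) Filter.atTop Filter.atTop := by
    refine (tendsto_rpow_atTop (by linarith : 0 < 1 - ε)).congr' ?_
    filter_upwards [Filter.eventually_gt_atTop 0] with t t0
    rw [sub_eq_add_neg, rpow_add t0, rpow_one]
  have l2 : Filter.Tendsto (fun t : ℝ => t * (t ^ (-ε)) ^ 2) Filter.atTop Filter.atTop := by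
    refine (tendsto_rpow_atTop (by linarith : 0 < 1 - 2 * ε)).congr' ?_
    filter_upwards [Filter.eventually_gt_atTop 0] with t t0
    rw [← rpow_natCast, ← rpow_mul t0.le, ← rpow_one_add' t0.le (by push_cast; linarith)]
    congr 1; push_cast; ring
  have f1 : ∀ D : ℝ, 0 < D → ∀ᶠ t : ℝ in Filter.atTop, t ^ (-ε) * D ≤ 1 / 2 := fun D hD => by
    filter_upwards [l0.eventually (ge_mem_nhds (by positivity : 0 < 1 / 2 / D))] with t ht
    rwa [le_div_iff₀ hD] at ht
  obtain ⟨a, ha⟩ := Filter.eventually_atTop.1 ((f1 (1000 * C ^ 3) (by positivity)).and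
    ((f1 (12 + 200 * C ^ 3) (by positivity)).and
    ((l1.eventually_ge_atTop (4 * C / (1 / (2 * M)) ^ 3)).and (l2.eventually_ge_atTop 1))))
  refine ⟨C, C2, max a (max 1 B), (le_max_right _ _).trans (le_max_right _ _), ?_⟩
  have hta : ∀ t, max a (max 1 B) ≤ t → a ≤ t := fun t ht => (le_max_left _ _).trans ht
  exact
  { bg := hC
    C21 := hC2
    src := hsrc
    xc := bg_x_cd hM hr
    x' := bg_x' hM hr
    e0 := e0
    e1 := e1
    T1 := (le_max_left _ _).trans (le_max_right _ _)
    a1 := fun t ht => by linarith [(ha t (hta t ht)).1]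
    a2 := fun t ht => (ha t (hta t ht)).2.1
    a3 := fun t ht => by
      have := (ha t (hta t ht)).2.2.1
      rwa [div_le_iff₀' (by positivity)] at this
    a4 := fun t ht => (ha t (hta t ht)).2.2.2 }
end


section
variable {M : ℝ} {r : ℝ → ℝ} {φ ξ : ℝ → ℝ → ℝ}

lemma E0I_nonneg (hM : 0 < M) (hr : IsTortoise M r) (ξ : ℝ → ℝ → ℝ) (s : ℝ) : 0 ≤ E0Integrand M r ξ s := by
  have h1 : 0 < 1 - muS M r s := by linarith [bg_x1 hM hr s]
  have := bg_rpos hM hr s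
  unfold E0Integrand
  positivity

lemma E0_nonneg (hM : 0 < M) (hr : IsTortoise M r) (ξ : ℝ → ℝ → ℝ) : 0 ≤ E0 M r ξ :=
  integral_nonneg (E0I_nonneg hM hr ξ)

lemma E1_nonneg (hM : 0 < M) (hr : IsTortoise M r) (ξ : ℝ → ℝ → ℝ) : 0 ≤ E1 M r ξ :=
  add_nonneg (add_nonneg (E0_nonneg hM hr _) (E0_nonneg hM hr _)) (E0_nonneg hM hr _)

lemma E1_le_E2 (hM : 0 < M) (hr : IsTortoise M r) (ξ : ℝ → ℝ → ℝ) : E1 M r ξ ≤ E2 M r ξ := by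
  unfold E2
  linarith [E1_nonneg hM hr (pd_t ξ), E1_nonneg hM hr (pd_t (pd_t ξ))]

lemma weight_aux (w a : ℝ) : (w + a / 2) ^ 2 + 1 ≤ (2 + a ^ 2) * (w ^ 2 + 1) := by
  nlinarith [sq_nonneg (w - a / 2), mul_nonneg (sq_nonneg a) (sq_nonneg w), sq_nonneg a, sq_nonneg w]

lemma quad_aux {W Q G r G' K y P c A w z : ℝ} (hW : W ≤ A * w) (hW' : W ≤ A * z) (W0 : 0 ≤ W)
    (hG : G ^ 2 ≤ K * r ^ 2) (hG' : G' ^ 2 ≤ K * y) (hQ : Q ^ 2 ≤ 2 * ((G * P) ^ 2 + (G' * c) ^ 2))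
     :
    W * Q ^ 2 ≤ 2 * (K * A) * (w * P ^ 2 * r ^ 2) + 2 * (K * A) * (z * y * c ^ 2) := by
  have a1 : G ^ 2 * (W * P ^ 2) ≤ K * r ^ 2 * (A * w * P ^ 2) := by
    have h0 : 0 ≤ K * r ^ 2 := (sq_nonneg G).trans hG
    have : W * P ^ 2 ≤ A * w * P ^ 2 := by gcongr
    calc _ ≤ K * r ^ 2 * (W * P ^ 2) := by gcongr
      _ ≤ _ := by gcongr
  have a2 : G' ^ 2 * (W * c ^ 2) ≤ K * y * (A * z * c ^ 2) := by
    have h0 : 0 ≤ K * y := (sq_nonneg G').trans hG'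
    have : W * c ^ 2 ≤ A * z * c ^ 2 := by gcongr
    calc _ ≤ K * y * (W * c ^ 2) := by gcongr
      _ ≤ _ := by gcongr
  have a3 := mul_le_mul_of_nonneg_left hQ W0
  linarith

lemma init_ptw {k x r s a c P Q G G' K : ℝ} (x0 : 0 < x) (x1 : x < 1) (r0 : 0 < r) (hK : 0 ≤ K)
    (hG : G ^ 2 ≤ K * r ^ 2) (hG' : G' ^ 2 ≤ K * (1 - x)) (hV : Vp k x * G ^ 2 ≤ K * (1 - x)) :
    e0F k ((1 + a - s) / 2) ((1 + a + s) / 2) x (G * c) (G * P + G' * c) (G * Q - G' * c) ≤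
    12 * (K * (2 * (2 + a ^ 2))) *
     (((1 - x)⁻¹ * Q ^ 2 + P ^ 2 + ((1 - s) / 2) ^ 2 * Q ^ 2 + ((1 + s) / 2) ^ 2 * P ^ 2
    + (1 - x) * ((1 + s ^ 2) / r ^ 2) * c ^ 2) * r ^ 2) := by
  have y0 : 0 < 1 - x := by linarith
  have yi : 1 ≤ (1 - x)⁻¹ := (one_le_inv₀ y0).2 (by linarith)
  set A := 2 * (2 + a ^ 2) with hA
  have A0 : 0 ≤ A := by positivity
  have hp := weight_aux ((1 + s) / 2) a
  have hm := weight_aux ((1 - s) / 2) a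
  have ep : (1 + s) / 2 + a / 2 = (1 + a + s) / 2 := by ring
  have em : (1 - s) / 2 + a / 2 = (1 + a - s) / 2 := by ring
  rw [ep] at hp
  rw [em] at hm
  have wp : ((1 + s) / 2) ^ 2 + 1 ≤ 2 * (1 + s ^ 2) := by nlinarith [sq_nonneg (1 - s), sq_nonneg s]
  have wm : ((1 - s) / 2) ^ 2 + 1 ≤ 2 * (1 + s ^ 2) := by nlinarith [sq_nonneg (1 + s), sq_nonneg s]
  have a0 : 0 ≤ 2 + a ^ 2 := by positivity
  have hp1 : ((1 + a + s) / 2) ^ 2 + 1 ≤ A * (((1 + s) / 2) ^ 2 + 1) := by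
    have : 0 ≤ (2 + a ^ 2) * (((1 + s) / 2) ^ 2 + 1) := by positivity
    rw [hA]; linarith
  have hm1 : ((1 + a - s) / 2) ^ 2 + 1 ≤ A * (((1 - s) / 2) ^ 2 + 1) := by
    have : 0 ≤ (2 + a ^ 2) * (((1 - s) / 2) ^ 2 + 1) := by positivity
    rw [hA]; linarith
  have hp2 : ((1 + a + s) / 2) ^ 2 + 1 ≤ A * (1 + s ^ 2) := by
    have := mul_le_mul_of_nonneg_left wp a0
    rw [hA]; linarith
  have hm2 : ((1 + a - s) / 2) ^ 2 + 1 ≤ A * (1 + s ^ 2) := by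
    have := mul_le_mul_of_nonneg_left wm a0
    rw [hA]; linarith
  have b1 := quad_aux (P := P) (c := c) (Q := G * P + G' * c) hp1 hp2 (by positivity) hG hG'
    (by nlinarith [sq_nonneg (G * P - G' * c)])
  have b2 := quad_aux (P := Q) (c := c) (Q := G * Q - G' * c) hm1 hm2 (by positivity) hG hG'
    (by nlinarith [sq_nonneg (G * Q + G' * c)])
  have b3 : Vp k x * (((1 + a - s) / 2) ^ 2 + ((1 + a + s) / 2) ^ 2 + 2) * (G * c) ^ 2 ≤
      2 * (K * A) * ((1 + s ^ 2) * (1 - x) * c ^ 2) := by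
    have h0 : 0 ≤ K * (1 - x) := by positivity
    calc _ = (Vp k x * G ^ 2) * ((((1 + a - s) / 2) ^ 2 + ((1 + a + s) / 2) ^ 2 + 2) * c ^ 2) := by ring
      _ ≤ (K * (1 - x)) * ((((1 + a - s) / 2) ^ 2 + ((1 + a + s) / 2) ^ 2 + 2) * c ^ 2) := by gcongr
      _ ≤ (K * (1 - x)) * ((2 * (A * (1 + s ^ 2))) * c ^ 2) := by gcongr; linarith
      _ = _ := by ring
  have KA : 0 ≤ K * A := by positivity
  have e : (((1 - x)⁻¹ * Q ^ 2 + P ^ 2 + ((1 - s) / 2) ^ 2 * Q ^ 2 + ((1 + s) / 2) ^ 2 * P ^ 2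
    + (1 - x) * ((1 + s ^ 2) / r ^ 2) * c ^ 2) * r ^ 2) =
     ((1 - x)⁻¹ - 1) * Q ^ 2 * r ^ 2 + (((1 + s) / 2) ^ 2 + 1) * P ^ 2 * r ^ 2
      + (((1 - s) / 2) ^ 2 + 1) * Q ^ 2 * r ^ 2 + (1 + s ^ 2) * (1 - x) * c ^ 2 := by
    field_simp; ring
  rw [e]
  have n1 : 0 ≤ ((1 - x)⁻¹ - 1) * Q ^ 2 * r ^ 2 := by
    have : 0 ≤ (1 - x)⁻¹ - 1 := by linarith
    positivity
  have n2 : 0 ≤ (((1 + s) / 2) ^ 2 + 1) * P ^ 2 * r ^ 2 := by positivity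
  have n3 : 0 ≤ (((1 - s) / 2) ^ 2 + 1) * Q ^ 2 * r ^ 2 := by positivity
  have n4 : 0 ≤ (1 + s ^ 2) * (1 - x) * c ^ 2 := by positivity
  unfold e0F
  have m1 := mul_nonneg KA n1
  have m2 := mul_nonneg KA n2
  have m3 := mul_nonneg KA n3
  have m4 := mul_nonneg KA n4
  linarith

/-- product fields at initial time -/
lemma start_prod (hM : 0 < M) (hr : IsTortoise M r) (h : Sm ξ) (k a : ℝ) {G G' : ℝ → ℝ} {K : ℝ}
    (hd : ∀ s, HasDerivAt G (G' s) s) (hK : 0 ≤ K)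
    (hG : ∀ s, G s ^ 2 ≤ K * r s ^ 2) (hG' : ∀ s, G' s ^ 2 ≤ K * (1 - muS M r s))
    (hV : ∀ s, Vp k (muS M r s) * G s ^ 2 ≤ K * (1 - muS M r s)) (s : ℝ) :
    ev (e0F k) (muS M r) (fun t s => G s * ξ (t - a) s) (1 + a) s ≤
      12 * (K * (2 * (2 + a ^ 2))) * E0Integrand M r ξ s := by
  have e1 : pd_t (fun t s => G s * ξ (t - a) s) (1 + a) s = G s * pd_t ξ 1 s := by
    have := pd_t_mul_s G (fun t s => ξ (t - a) s)
    rw [this, pd_t_shift]; simp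
  have e2 : pd_s (fun t s => G s * ξ (t - a) s) (1 + a) s = G' s * ξ 1 s + G s * pd_s ξ 1 s := by
    have := ((hd s).mul (h.ds 1 s)).deriv
    rw [← this]
    unfold pd_s; simp; rfl
  have := init_ptw (k := k) (a := a) (s := s) (c := ξ 1 s) (P := pd_t ξ 1 s + pd_s ξ 1 s)
    (Q := pd_t ξ 1 s - pd_s ξ 1 s) (bg_x0 hM hr s) (bg_x1 hM hr s) (bg_rpos hM hr s) hK (hG s) (hG' s) (hV s)
  unfold ev E0Integrand
  rw [e1, e2]
  have e3 : (1 : ℝ) + a - a = 1 := by ring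
  simp only [e3]
  convert this using 2 <;> ring

lemma Vr (hM : 0 < M) (hr : IsTortoise M r) (s : ℝ) :
    Vp (1 / (2 * M)) (muS M r s) * r s ^ 2 ≤ 1 - muS M r s := by
  have h := bg_r hM hr s
  have h0 := bg_x0 hM hr s
  have h1 := bg_x1 hM hr s
  have : Vp (1 / (2 * M)) (muS M r s) * r s ^ 2 = muS M r s * (1 - muS M r s) := by
    unfold Vp
    calc _ = (1 / (2 * M)) ^ 2 * (r s * muS M r s) ^ 2 * (muS M r s * (1 - muS M r s)) := by ring
      _ = _ := by rw [h]; field_simp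
  rw [this]; nlinarith

/-- coefficient bounds for `g = s (1 - μ)` -/
lemma g_bounds (hM : 0 < M) (hr : IsTortoise M r) : ∃ K : ℝ, 0 ≤ K ∧ 
    (∀ s, (s * (1 - muS M r s)) ^ 2 ≤ K * r s ^ 2) ∧
    (∀ s, ((1 - muS M r s) + s * (1 / (2 * M) * muS M r s ^ 2 * (1 - muS M r s))) ^ 2 ≤ K * (1 - muS M r s)) ∧
    (∀ s, Vp (1 / (2 * M)) (muS M r s) * (s * (1 - muS M r s)) ^ 2 ≤ K * (1 - muS M r s)) := by
  obtain ⟨C1, hC1, h1⟩ := bg_yn hM hr 2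
  obtain ⟨C, hC⟩ := bg_exists hM hr
  have C10 := (hC 0).C1
  set k := 1 / (2 * M) with hk
  have k0 : 0 < k := by positivity
  refine ⟨C1 / (2 * M) ^ 2 + 9 + 2 + 2 * k ^ 2 * C, by positivity, ?_, ?_, ?_⟩
  · intro s
    have hr0 := hr.1 s
    have x0 := bg_x0 hM hr s
    have x1 := bg_x1 hM hr s
    have n1 : 0 ≤ 2 + 2 * k ^ 2 * C := by positivity
    have n2 : 0 ≤ C1 / (2 * M) ^ 2 := by positivity
    have r2 := sq_nonneg (r s)
    rcases le_total s 0 with hs | hs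
    · have := h1 s hs
      have a1 : (s * (1 - muS M r s)) ^ 2 ≤ C1 := by
        have : (s * (1 - muS M r s)) ^ 2 = (-s) ^ 2 * (1 - muS M r s) * (1 - muS M r s) := by ring
        rw [this]
        have h0 : 0 ≤ (-s) ^ 2 * (1 - muS M r s) := mul_nonneg (sq_nonneg _) (by linarith)
        nlinarith
      have a2 : C1 ≤ C1 / (2 * M) ^ 2 * r s ^ 2 := by
        rw [div_mul_eq_mul_div, le_div_iff₀ (by positivity)]
        gcongr
      nlinarith [mul_nonneg n1 r2]
    · have h3 := bg_low hM hr hs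
      have a1 : s * (1 - muS M r s) ≤ 3 * r s := by nlinarith
      have a0 : 0 ≤ s * (1 - muS M r s) := mul_nonneg hs (by linarith)
      have : (s * (1 - muS M r s)) ^ 2 ≤ (3 * r s) ^ 2 := by gcongr
      nlinarith [mul_nonneg n1 r2, mul_nonneg n2 r2]
  · intro s
    have x0 := bg_x0 hM hr s
    have x1 := bg_x1 hM hr s
    have hb := (hC s).sV
    set x := muS M r s
    have y0 : 0 < 1 - x := by linarith
    have a1 : ((1 - x) + s * (k * x ^ 2 * (1 - x))) ^ 2 ≤ 2 * (1 - x) ^ 2 + 2 * (k ^ 2 * (s ^ 2 * (x ^ 3 * (1 - x)))) * (x * (1 - x)) := by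
      nlinarith [sq_nonneg ((1 - x) - s * (k * x ^ 2 * (1 - x)))]
    have a2 : (k ^ 2 * (s ^ 2 * (x ^ 3 * (1 - x)))) * (x * (1 - x)) ≤ (k ^ 2 * C) * (1 * (1 - x)) := by
      gcongr
    have a3 : (1 - x) ^ 2 ≤ 1 - x := by nlinarith
    have n2 : 0 ≤ C1 / (2 * M) ^ 2 * (1 - x) := by positivity
    linarith
  · intro s
    have x0 := bg_x0 hM hr s
    have x1 := bg_x1 hM hr s
    have hb := (hC s).sV
    set x := muS M r s
    have y0 : 0 < 1 - x := by linarith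
    have n2 : 0 ≤ C1 / (2 * M) ^ 2 * (1 - x) := by positivity
    have n3 : 0 ≤ k ^ 2 * C * (1 - x) := by positivity
    have a3 : (1 - x) ^ 2 ≤ 1 - x := by nlinarith
    have : Vp k x * (s * (1 - x)) ^ 2 ≤ k ^ 2 * C * (1 - x) := by
      unfold Vp
      calc _ = k ^ 2 * (s ^ 2 * (x ^ 3 * (1 - x))) * (1 - x) ^ 2 := by ring
        _ ≤ k ^ 2 * C * (1 - x) := by gcongr
    linarith

lemma e0F_add3 {k u v x c1 c2 c3 p1 p2 p3 m1 m2 m3 : ℝ} (x0 : 0 < x) (x1 : x < 1) :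
    e0F k u v x (c1 + c2 + c3) (p1 + p2 + p3) (m1 + m2 + m3) ≤
      3 * (e0F k u v x c1 p1 m1 + e0F k u v x c2 p2 m2 + e0F k u v x c3 p3 m3) := by
  have key : ∀ W a b c : ℝ, 0 ≤ W → W * (a + b + c) ^ 2 ≤ 3 * (W * a ^ 2 + W * b ^ 2 + W * c ^ 2) := by
    intro W a b c hW
    have : (a + b + c) ^ 2 ≤ 3 * (a ^ 2 + b ^ 2 + c ^ 2) := by
      nlinarith [sq_nonneg (a - b), sq_nonneg (b - c), sq_nonneg (a - c)]
    nlinarith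
  have hV := Vp_nonneg (k := k) x0 x1
  unfold e0F
  have h1 := key (v ^ 2 + 1) p1 p2 p3 (by positivity)
  have h2 := key (u ^ 2 + 1) m1 m2 m3 (by positivity)
  have h3 := key (Vp k x * (u ^ 2 + v ^ 2 + 2)) c1 c2 c3 (by positivity)
  linarith

lemma ev_add3 {k : ℝ} {x : ℝ → ℝ} {A B D : ℝ → ℝ → ℝ} (hA : Sm A) (hB : Sm B) (hD : Sm D) (t s : ℝ)
    (x0 : 0 < x s) (x1 : x s < 1) :
    ev (e0F k) x (fun t s => A t s + B t s + D t s) t s ≤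
      3 * (ev (e0F k) x A t s + ev (e0F k) x B t s + ev (e0F k) x D t s) := by
  have e1 : pd_t (fun t s => A t s + B t s + D t s) t s = pd_t A t s + pd_t B t s + pd_t D t s :=
    (((hA.dt t s).add (hB.dt t s)).add (hD.dt t s)).deriv
  have e2 : pd_s (fun t s => A t s + B t s + D t s) t s = pd_s A t s + pd_s B t s + pd_s D t s :=
    (((hA.ds t s).add (hB.ds t s)).add (hD.ds t s)).deriv
  unfold ev
  rw [e1, e2]
  have := e0F_add3 (k := k) (u := (t - s) / 2) (v := (t + s) / 2) (c1 := A t s) (c2 := B t s) (c3 := D t s)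
    (p1 := pd_t A t s + pd_s A t s) (p2 := pd_t B t s + pd_s B t s) (p3 := pd_t D t s + pd_s D t s)
    (m1 := pd_t A t s - pd_s A t s) (m2 := pd_t B t s - pd_s B t s) (m3 := pd_t D t s - pd_s D t s) x0 x1
  convert this using 2 <;> ring

lemma EI_start {k : ℝ} (hM : 0 < M) (hr : IsTortoise M r) {χ : ℝ → ℝ → ℝ} (hχ : Sm χ) {F : ℝ → ℝ} (hF : Integrable F)
    (F0 : ∀ s, 0 ≤ F s) {T L X : ℝ} (hX : -L ≤ X) (hle : ∀ s, ev (e0F k) (muS M r) χ T s ≤ F s) :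
    EI (e0F k) (muS M r) χ L X T ≤ ∫ s, F s := by
  rw [EI_eq]
  have c : Continuous (fun s => ev (e0F k) (muS M r) χ T s) :=
    (ev_sm (e0F_sm k) (bg_x_cd hM hr) hχ).cont_comp continuous_const continuous_id
  calc _ ≤ ∫ s in (T - L)..(T + X), F s :=
        intervalIntegral.integral_mono_on (by linarith) (c.intervalIntegrable _ _)
          hF.intervalIntegrable fun s _ => hle s
    _ ≤ _ := by
        rw [intervalIntegral.integral_of_le (by linarith)]
        exact setIntegral_le_integral hF (Filter.Eventually.of_forall F0)

lemma start_energy (hM : 0 < M) (hr : IsTortoise M r) (a : ℝ) : ∃ K : ℝ, 0 ≤ K ∧ ∀ φ, Sm φ → FinE1 M r φ →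
    ∀ L X, -L ≤ X → EI (e0F (1 / (2 * M))) (muS M r) (psiF r φ a) L X (1 + a) +
      EI (e0F (1 / (2 * M))) (muS M r) (Svf (psiF r φ a)) L X (1 + a) ≤ K * E1 M r φ := by
  obtain ⟨Kg, Kg0, g1, g2, g3⟩ := g_bounds hM hr
  set k := 1 / (2 * M) with hk
  have rd : ∀ s, HasDerivAt (fun s => a * r s) (a * (1 - muS M r s)) s := fun s => (bg_r' hr s).const_mul a
  have gd : ∀ s, HasDerivAt (fun s => s * (1 - muS M r s))
      ((1 - muS M r s) + s * (k * muS M r s ^ 2 * (1 - muS M r s))) s := by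
    intro s
    refine ((hasDerivAt_id s).mul ((bg_x' hM hr s).const_sub 1)).congr_deriv ?_
    simp only [id]; ring
  have y2 : ∀ s, (1 - muS M r s) ^ 2 ≤ 1 - muS M r s := fun s => by
    have x0 := bg_x0 hM hr s
    have x1 := bg_x1 hM hr s
    nlinarith
  set A := 12 * (2 * (2 + a ^ 2)) with hA
  have A0 : 0 ≤ A := by positivity
  have bd1 : ∀ ξ, Sm ξ → ∀ s, ev (e0F k) (muS M r) (fun t s => r s * ξ (t - a) s) (1 + a) s ≤ A * E0Integrand M r ξ s := by
    intro ξ h s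
    have := start_prod hM hr h k a (G := r) (G' := fun s => 1 - muS M r s) (K := 1) (bg_r' hr) zero_le_one
      (fun s => by linarith) (fun s => by linarith [y2 s]) (fun s => by linarith [Vr hM hr s]) s
    rw [hA]; linarith
  have bd2 : ∀ ξ, Sm ξ → ∀ s, ev (e0F k) (muS M r) (fun t s => (a * r s) * ξ (t - a) s) (1 + a) s ≤ a ^ 2 * A * E0Integrand M r ξ s := by
    intro ξ h s
    have := start_prod hM hr h k a (G := fun s => a * r s) (K := a ^ 2) rd (sq_nonneg a)
      (fun s => by nlinarith) (fun s => by nlinarith [mul_le_mul_of_nonneg_left (y2 s) (sq_nonneg a)])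
      (fun s => by nlinarith [mul_le_mul_of_nonneg_left (Vr hM hr s) (sq_nonneg a)]) s
    rw [hA]; linarith
  have bd3 : ∀ ξ, Sm ξ → ∀ s, ev (e0F k) (muS M r) (fun t s => (s * (1 - muS M r s)) * ξ (t - a) s) (1 + a) s ≤ Kg * A * E0Integrand M r ξ s := by
    intro ξ h s
    have := start_prod hM hr h k a (K := Kg) gd Kg0 g1 g2 g3 s
    rw [hA]; linarith
  refine ⟨A + 3 * (A + a ^ 2 * A + Kg * A), by positivity, ?_⟩
  intro φ h hf L X hX
  have sr := Sm.of_s (bg_r_cd hM hr)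
  have sg : Sm (fun _ s => s * (1 - muS M r s)) := Sm.snd.mul ((Sm.const 1).sub (Sm.of_s (bg_x_cd hM hr)))
  have sh : ∀ {ξ}, Sm ξ → Sm (fun t s => ξ (t - a) s) := fun hξ => hξ.comp2 (Sm.fst.sub (Sm.const a)) Sm.snd
  have eZ : Svf (psiF r φ a) = fun t s => r s * Svf φ (t - a) s + (a * r s) * pd_t φ (t - a) s
      + (s * (1 - muS M r s)) * φ (t - a) s := by
    funext t s
    unfold Svf
    rw [psiF_t, psiF_s hr h]
    unfold psiF
    ring
  have n0 := E0_nonneg hM hr φ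
  have n1 := E0_nonneg hM hr (Svf φ)
  have n2 := E0_nonneg hM hr (pd_t φ)
  have k1 : EI (e0F k) (muS M r) (psiF r φ a) L X (1 + a) ≤ A * E0 M r φ := by
    have := EI_start hM hr (psiF_sm hM hr h a) (hf.2.1.const_mul A) (fun s => mul_nonneg A0 (E0I_nonneg hM hr φ s)) hX
      (bd1 φ h)
    rw [integral_const_mul] at this
    exact this
  have k2 : EI (e0F k) (muS M r) (Svf (psiF r φ a)) L X (1 + a) ≤
      3 * (A * E0 M r (Svf φ) + a ^ 2 * A * E0 M r (pd_t φ) + Kg * A * E0 M r φ) := by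
    have i1 := hf.1.const_mul A
    have i2 := hf.2.2.const_mul (a ^ 2 * A)
    have i3 := hf.2.1.const_mul (Kg * A)
    have := EI_start (k := k) hM hr (psiF_sm hM hr h a).svf (((i1.add i2).add i3).const_mul 3) (fun s => by
        have q1 := E0I_nonneg hM hr φ s
        have q2 := E0I_nonneg hM hr (Svf φ) s
        have q3 := E0I_nonneg hM hr (pd_t φ) s
        simp only [Pi.add_apply]
        positivity) hX (T := 1 + a) (fun s => by
        rw [eZ]
        refine (ev_add3 (sr.mul (sh h.svf)) (((Sm.const a).mul sr).mul (sh h.pd_t)) (sg.mul (sh h)) (1 + a) s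
          (bg_x0 hM hr s) (bg_x1 hM hr s)).trans ?_
        have q1 := bd1 (Svf φ) h.svf s
        have q2 := bd2 (pd_t φ) h.pd_t s
        have q3 := bd3 φ h s
        simp only [Pi.add_apply]
        linarith)
    rw [integral_const_mul, integral_add' (i1.add i2) i3, integral_add' i1 i2, integral_const_mul,
      integral_const_mul, integral_const_mul] at this
    exact this
  unfold E1
  have m1 := mul_nonneg A0 n0
  have m2 := mul_nonneg A0 n1
  have m3 := mul_nonneg A0 n2
  have a2 := sq_nonneg a
  have p1 := mul_nonneg a2 m1
  have p2 := mul_nonneg a2 m2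
  have p3 := mul_nonneg a2 m3
  have p4 := mul_nonneg Kg0 m1
  have p5 := mul_nonneg Kg0 m2
  have p6 := mul_nonneg Kg0 m3
  linarith
end

section
variable {M : ℝ} {r : ℝ → ℝ}

/-- pointwise decay on compact ranges of the tortoise coordinate -/
lemma compact_decay (hM : 0 < M) (hr : IsTortoise M r) {δ : ℝ} (hδ0 : 0 < δ) (hδ1 : δ < 1)
    {sa sb : ℝ} (hab : sa + 3 ≤ sb) :
    ∃ C, 0 ≤ C ∧ ∀ φ, IsWaveSol r φ → FinE2 M r φ → ∀ t s, 1 ≤ t → s ∈ Set.Icc (sa + 1) (sb - 1) →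
      |φ t s| ≤ C * t ^ (-(3 : ℝ) / 2 + δ) * Real.sqrt (E2 M r φ) := by
  set ε : ℝ := min (2 * δ / 5) (1 / 4) with hε
  have e0 : 0 < ε := lt_min (by positivity) (by norm_num)
  have e1 : ε ≤ 1 / 4 := min_le_right _ _
  have e2 : ε ≤ 2 * δ / 5 := min_le_left _ _
  obtain ⟨C, C2, T0, hB, P⟩ := par_exists hM hr e0 e1 (max (2 * |sa|) (2 * |sb|))
  obtain ⟨K, K0, hK⟩ := P.compact (by linarith : sa < sb) ((le_max_left _ _).trans hB)
    ((le_max_right _ _).trans hB)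
  obtain ⟨K', K'0, hK'⟩ := start_energy hM hr (T0 - 1)
  have T1 := P.T1
  refine ⟨Real.sqrt (2 * K * K') / (2 * M), by positivity, ?_⟩
  intro φ hφ hf t s ht hs
  have hS := hφ.1
  obtain ⟨S0, hS0⟩ := hφ.2.2
  set ψ := psiF r φ (T0 - 1) with hψ
  have hsm : Sm ψ := psiF_sm hM hr hS _
  set T := t + (T0 - 1) with hT
  set X := max (S0 - T0 + 1) sb with hX
  set L := max T (max (T - sa) (-X)) with hL
  have tt : 1 + (T0 - 1) = T0 := by ring
  have LX : -L ≤ X := by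
    have : -X ≤ L := (le_max_right _ _).trans (le_max_right _ _)
    linarith
  have h1 := hK ψ hsm (psiF_wave hM hr hφ (T0 - 1)) T L X (by linarith) (le_max_left _ _)
    (by have : T - sa ≤ L := (le_max_left _ _).trans (le_max_right _ _)
        linarith) (by have : sb ≤ X := le_max_right _ _
                      linarith) LX (by
      intro t' ht'
      have ho : IsOpen {w : ℝ × ℝ | S0 + |w.1 - T0| < w.2} :=
        isOpen_lt (by fun_prop) (by fun_prop)
      have hm : (t', t' + X) ∈ {w : ℝ × ℝ | S0 + |w.1 - T0| < w.2} := by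
        have : S0 - T0 + 1 ≤ X := le_max_left _ _
        show S0 + |t' - T0| < t' + X
        rw [abs_of_nonneg (by linarith [ht'.1])]
        linarith
      filter_upwards [ho.mem_nhds hm] with w hw
      have hw' : S0 + |w.1 - T0| < w.2 := hw
      show r w.2 * φ (w.1 - (T0 - 1)) w.2 = 0
      rw [hS0 _ _ (by
        have : w.1 - (T0 - 1) - 1 = w.1 - T0 := by ring
        rw [this]; exact hw'.le), mul_zero])
  have h2 := hK' φ hS hf.1 L X LX
  rw [tt] at h2
  have h3 := Yf_sup hsm hab hs (t := T)
  have h4 := E1_le_E2 hM hr φ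
  have T0' : 0 < T := by linarith
  have t0 : 0 < t := by linarith
  set E := E2 M r φ with hE
  have E1n := E1_nonneg hM hr φ
  have E0' : 0 ≤ E := by linarith
  have h5 : T ^ (3 - 5 * ε) * Yf sa sb ψ T ≤ K * (K' * E) :=
    h1.trans (mul_le_mul_of_nonneg_left (h2.trans (mul_le_mul_of_nonneg_left h4 K'0)) K0)
  have h6 : ψ T s = r s * φ t s := by
    show r s * φ (T - (T0 - 1)) s = _
    rw [hT]; congr 2; ring
  rw [h6] at h3
  have hp : 0 < T ^ (3 - 5 * ε) := rpow_pos_of_pos T0' _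
  have h7 : (r s * φ t s) ^ 2 * T ^ (3 - 5 * ε) ≤ 2 * K * K' * E := by nlinarith
  have h8 : t ^ (3 - 2 * δ) ≤ T ^ (3 - 5 * ε) :=
    (rpow_le_rpow_of_exponent_le ht (by linarith)).trans (rpow_le_rpow t0.le (by linarith) (by linarith))
  have h9 : (2 * M * |φ t s|) ^ 2 * t ^ (3 - 2 * δ) ≤ 2 * K * K' * E := by
    refine le_trans (mul_le_mul ?_ h8 (by positivity) (by positivity)) h7
    rw [mul_pow (2 * M), mul_pow (r s), sq_abs]
    exact mul_le_mul_of_nonneg_right (pow_le_pow_left₀ (by positivity) (hr.1 s).le 2) (by positivity)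
  have q : t ^ (3 - 2 * δ) * (t ^ (-(3 : ℝ) / 2 + δ)) ^ 2 = 1 := by
    rw [← rpow_natCast, ← rpow_mul t0.le, ← rpow_add t0]
    rw [show 3 - 2 * δ + (-(3 : ℝ) / 2 + δ) * ((2 : ℕ) : ℝ) = 0 by push_cast; ring, rpow_zero]
  have w0 : 0 < t ^ (-(3 : ℝ) / 2 + δ) := rpow_pos_of_pos t0 _
  set w := t ^ (-(3 : ℝ) / 2 + δ)
  have h10 : (2 * M * |φ t s|) ^ 2 ≤ (Real.sqrt (2 * K * K') * w * Real.sqrt E) ^ 2 := by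
    rw [mul_pow (Real.sqrt (2 * K * K') * w), mul_pow (Real.sqrt (2 * K * K')), sq_sqrt (by positivity), sq_sqrt E0']
    calc (2 * M * |φ t s|) ^ 2 = (2 * M * |φ t s|) ^ 2 * t ^ (3 - 2 * δ) * w ^ 2 := by
          rw [mul_assoc ((2 * M * |φ t s|) ^ 2), q, mul_one]
      _ ≤ 2 * K * K' * E * w ^ 2 := mul_le_mul_of_nonneg_right h9 (by positivity)
      _ = _ := by ring
  have h11 := abs_le_of_sq_le_sq h10 (by positivity)
  have h12 := (le_abs_self _).trans h11
  rw [div_mul_eq_mul_div, div_mul_eq_mul_div, le_div_iff₀ (by positivity)]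
  linarith
end

section
variable {M : ℝ} {r : ℝ → ℝ}

/-- the lapse decays exponentially towards the horizon -/
lemma bg_ymono (hM : 0 < M) (hr : IsTortoise M r) {σ s : ℝ} (hσ : σ ≤ s) (hs : s ≤ 0) :
    1 - muS M r σ ≤ (1 - muS M r s) * Real.exp (-(2 / (9 * M) * (s - σ))) := by
  have : MonotoneOn (fun s => (1 - muS M r s) * Real.exp (-(2 / (9 * M) * s))) (Set.Iic 0) := by
    have hd : ∀ s, HasDerivAt (fun s => (1 - muS M r s) * Real.exp (-(2 / (9 * M) * s)))
        (((1 / (2 * M)) * muS M r s ^ 2 - 2 / (9 * M)) * (1 - muS M r s)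
          * Real.exp (-(2 / (9 * M) * s))) s := by
      intro s
      have h1 := (bg_x' hM hr s).const_sub 1
      have h2 := (((hasDerivAt_id s).const_mul (2 / (9 * M))).neg).exp
      have := h1.mul h2
      refine HasDerivAt.congr_deriv this ?_
      simp only [id, Pi.neg_apply]
      ring
    apply monotoneOn_of_deriv_nonneg (convex_Iic 0)
    · intro s _; exact (hd s).continuousAt.continuousWithinAt
    · intro s _; exact (hd s).differentiableAt.differentiableWithinAt
    · intro s h
      rw [interior_Iic, Set.mem_Iio] at h
      rw [(hd s).deriv]
      have h1 := bg_x23' hM hr h.le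
      have h2 := bg_x1 hM hr s
      have h3 : 0 ≤ (1 / (2 * M)) * muS M r s ^ 2 - 2 / (9 * M) := by
        have : (1 / (2 * M)) * muS M r s ^ 2 - 2 / (9 * M) = (muS M r s ^ 2 - 4/9) / (2 * M) := by
          field_simp; ring
        rw [this]; apply div_nonneg _ (by positivity); nlinarith
      have h4 : 0 ≤ 1 - muS M r s := by linarith
      positivity
  have h := this (Set.mem_Iic.2 (hσ.trans hs)) (Set.mem_Iic.2 hs) hσ
  simp only at h
  have hp := Real.exp_pos (2 / (9 * M) * σ)
  have e1 : Real.exp (-(2 / (9 * M) * (s - σ))) = Real.exp (-(2 / (9 * M) * s)) * Real.exp (2 / (9 * M) * σ) := by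
    rw [← Real.exp_add]; congr 1; ring
  have e2 : Real.exp (-(2 / (9 * M) * σ)) * Real.exp (2 / (9 * M) * σ) = 1 := by
    rw [← Real.exp_add]; simp
  rw [e1]
  have h3 := mul_le_mul_of_nonneg_right h hp.le
  rw [mul_assoc, e2, mul_one, mul_assoc] at h3
  exact h3

/-- comparison of increments -/
lemma comp_le {f f' B B' : ℝ → ℝ} {a b : ℝ} (hab : a ≤ b) (hf : ∀ x, HasDerivAt f (f' x) x)
    (hB : ∀ x, HasDerivAt B (B' x) x) (h : ∀ x ∈ Set.Icc a b, |f' x| ≤ B' x) :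
    |f b - f a| ≤ B b - B a := by
  have m1 : MonotoneOn (fun x => B x - f x) (Set.Icc a b) := by
    apply monotoneOn_of_deriv_nonneg (convex_Icc a b)
    · intro s _; exact ((hB s).sub (hf s)).continuousAt.continuousWithinAt
    · intro s _; exact ((hB s).sub (hf s)).differentiableAt.differentiableWithinAt
    · intro s hs
      have : deriv (fun x => B x - f x) s = B' s - f' s := ((hB s).sub (hf s)).deriv
      rw [this]
      linarith [le_abs_self (f' s), h s (interior_subset hs)]
  have m2 : MonotoneOn (fun x => B x + f x) (Set.Icc a b) := by
    apply monotoneOn_of_deriv_nonneg (convex_Icc a b)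
    · intro s _; exact ((hB s).add (hf s)).continuousAt.continuousWithinAt
    · intro s _; exact ((hB s).add (hf s)).differentiableAt.differentiableWithinAt
    · intro s hs
      have : deriv (fun x => B x + f x) s = B' s + f' s := ((hB s).add (hf s)).deriv
      rw [this]
      linarith [neg_abs_le (f' s), h s (interior_subset hs)]
  have h1 := m1 (Set.left_mem_Icc.2 hab) (Set.right_mem_Icc.2 hab) hab
  have h2 := m2 (Set.left_mem_Icc.2 hab) (Set.right_mem_Icc.2 hab) hab
  simp only at h1 h2
  rw [abs_le]; constructor <;> linarith

/-- weighted Cauchy-Schwarz against the initial energy -/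
lemma data_int (hM : 0 < M) (hr : IsTortoise M r) {φ : ℝ → ℝ → ℝ} (hf : FinE0 M r φ) {F w : ℝ → ℝ}
    (hF : Continuous F) (hw : Continuous w) {a b S B l : ℝ} (hab : a ≤ b) (hl : 0 < l)
    (hw0 : ∀ y ∈ Set.Icc a b, 0 < w y)
    (hE : ∀ y ∈ Set.Icc a b, F y ^ 2 ≤ w y * E0Integrand M r φ y) (hB : ∫ y in a..b, w y ≤ B)
    (hS : E0 M r φ ≤ S ^ 2) : ∫ y in a..b, |F y| ≤ (S ^ 2 / l + l * B) / 2 := by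
  have i1 : IntervalIntegrable (E0Integrand M r φ) volume a b := hf.intervalIntegrable
  have i2 : IntervalIntegrable w volume a b := hw.intervalIntegrable _ _
  have h1 : ∫ y in a..b, |F y| ≤ ∫ y in a..b, ((1 / (2 * l)) * E0Integrand M r φ y + (l / 2) * w y) := by
    apply intervalIntegral.integral_mono_on hab (hF.abs.intervalIntegrable _ _)
      ((i1.const_mul _).add (i2.const_mul _))
    intro y hy
    have e := hE y hy
    have w0 := hw0 y hy
    set G := E0Integrand M r φ y
    have q : 2 * l * |F y| * w y ≤ w y * G + (l * w y) ^ 2 := by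
      have := sq_nonneg (|F y| - l * w y)
      have h2 := sq_abs (F y)
      nlinarith
    have q2 : 2 * l * |F y| ≤ G + l ^ 2 * w y := by
      by_contra hc
      have hc' := not_le.1 hc
      nlinarith [mul_lt_mul_of_pos_right hc' w0]
    have e3 : 1 / (2 * l) * G + l / 2 * w y = (G + l ^ 2 * w y) / (2 * l) := by field_simp
    rw [e3, le_div_iff₀ (by positivity)]
    linarith
  have h2 : ∫ y in a..b, ((1 / (2 * l)) * E0Integrand M r φ y + (l / 2) * w y) =
      (1 / (2 * l)) * (∫ y in a..b, E0Integrand M r φ y) + (l / 2) * ∫ y in a..b, w y := by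
    rw [intervalIntegral.integral_add (i1.const_mul _) (i2.const_mul _), intervalIntegral.integral_const_mul,
      intervalIntegral.integral_const_mul]
  have h3 : ∫ y in a..b, E0Integrand M r φ y ≤ E0 M r φ := by
    rw [intervalIntegral.integral_of_le hab]
    exact setIntegral_le_integral hf (Filter.Eventually.of_forall (E0I_nonneg hM hr φ))
  have h4 : (1 / (2 * l)) * (∫ y in a..b, E0Integrand M r φ y) ≤ (1 / (2 * l)) * S ^ 2 :=
    mul_le_mul_of_nonneg_left (h3.trans hS) (by positivity)
  have h5 : (l / 2) * (∫ y in a..b, w y) ≤ (l / 2) * B := mul_le_mul_of_nonneg_left hB (by positivity)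
  have e : (S ^ 2 / l + l * B) / 2 = (1 / (2 * l)) * S ^ 2 + (l / 2) * B := by field_simp
  rw [e]
  linarith

/-- transversal data near the horizon -/
lemma data_u (hM : 0 < M) (hr : IsTortoise M r) {φ : ℝ → ℝ → ℝ} (h : Sm φ) (hf : FinE0 M r φ)
    {a b S : ℝ} (hab : a ≤ b) (hb : b ≤ 0) (hS0 : 0 < S) (hS : E0 M r φ ≤ S ^ 2) :
    ∫ y in a..b, |r y * (pd_t φ 1 y - pd_s φ 1 y)| ≤ S * (1 / 2 + 9 * M / 4) * Real.exp (1 / (9 * M) * b) := by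
  have hc : Continuous (fun y => r y * (pd_t φ 1 y - pd_s φ 1 y)) :=
    (bg_r_cd hM hr).continuous.mul ((h.pd_t.cont_comp continuous_const continuous_id).sub
      (h.pd_s.cont_comp continuous_const continuous_id))
  have hw : Continuous (fun y => 1 - muS M r y) := continuous_const.sub (bg_x_cd hM hr).continuous
  have hB : ∫ y in a..b, (1 - muS M r y) ≤ (9 * M / 2) * Real.exp (2 / (9 * M) * b) := by
    have h1 : ∫ y in a..b, (1 - muS M r y) ≤ ∫ y in a..b, Real.exp (2 / (9 * M) * y) := by
      apply intervalIntegral.integral_mono_on hab (hw.intervalIntegrable _ _)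
        ((by fun_prop : Continuous fun y => Real.exp (2 / (9 * M) * y)).intervalIntegrable _ _)
      intro y hy
      exact bg_y hM hr (hy.2.trans hb)
    have h2 : ∫ y in a..b, Real.exp (2 / (9 * M) * y) = (9 * M / 2) * Real.exp (2 / (9 * M) * b)
        - (9 * M / 2) * Real.exp (2 / (9 * M) * a) := by
      apply intervalIntegral.integral_eq_sub_of_hasDerivAt (f := fun y => (9 * M / 2) * Real.exp (2 / (9 * M) * y))
      · intro y _
        refine HasDerivAt.congr_deriv ((((hasDerivAt_id y).const_mul (2 / (9 * M))).exp).const_mul (9 * M / 2)) ?_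
        simp only [id]; field_simp
      · exact ((by fun_prop : Continuous fun y => Real.exp (2 / (9 * M) * y)).intervalIntegrable _ _)
    have := Real.exp_pos (2 / (9 * M) * a)
    have : 0 ≤ (9 * M / 2) * Real.exp (2 / (9 * M) * a) := by positivity
    linarith
  have := data_int hM hr hf hc hw hab (l := S * Real.exp (-(1 / (9 * M) * b))) (by positivity)
    (fun y _ => by linarith [bg_x1 hM hr y]) (fun y _ => by
      have y0 : 0 < 1 - muS M r y := by linarith [bg_x1 hM hr y]
      have r0 := bg_rpos hM hr y
      unfold E0Integrand
      set m := pd_t φ 1 y - pd_s φ 1 y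
      set p := pd_t φ 1 y + pd_s φ 1 y
      have e : (r y * m) ^ 2 = (1 - muS M r y) * (((1 - muS M r y)⁻¹ * m ^ 2) * r y ^ 2) := by
        field_simp
      rw [e]
      apply mul_le_mul_of_nonneg_left _ y0.le
      apply mul_le_mul_of_nonneg_right _ (by positivity)
      have q1 : 0 ≤ p ^ 2 := by positivity
      have q2 : 0 ≤ ((1 - y) / 2) ^ 2 * m ^ 2 := by positivity
      have q3 : 0 ≤ ((1 + y) / 2) ^ 2 * p ^ 2 := by positivity
      have q4 : 0 ≤ (1 - muS M r y) * ((1 + y ^ 2) / r y ^ 2) * φ 1 y ^ 2 := by positivity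
      linarith) hB hS
  refine this.trans (le_of_eq ?_)
  have e1 : Real.exp (-(1 / (9 * M) * b)) = (Real.exp (1 / (9 * M) * b))⁻¹ := Real.exp_neg _
  have e2 : Real.exp (2 / (9 * M) * b) = Real.exp (1 / (9 * M) * b) ^ 2 := by
    rw [← Real.exp_nat_mul]; congr 1; push_cast; ring
  have p0 := Real.exp_pos (1 / (9 * M) * b)
  rw [e1, e2]
  field_simp
  ring

/-- the initial datum is bounded near the horizon -/
lemma data_0 (hM : 0 < M) (hr : IsTortoise M r) {φ : ℝ → ℝ → ℝ} (h : Sm φ) (hf : FinE0 M r φ)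
    {a b S : ℝ} (hab : a ≤ b) (hb : b ≤ 0) (hS0 : 0 < S) (hS : E0 M r φ ≤ S ^ 2) :
    |φ 1 b - φ 1 a| ≤ S * (1 + 2 * π / (2 * M) ^ 2) / 2 := by
  have hc : Continuous (fun y => pd_s φ 1 y) := h.pd_s.cont_comp continuous_const continuous_id
  have hw : Continuous (fun y : ℝ => (1 / (2 * M) ^ 2) * (1 / (1 + ((1 + y) / 2) ^ 2))) := by
    apply continuous_const.mul
    apply continuous_const.div (by fun_prop)
    intro y; positivity
  have hB : ∫ y in a..b, (1 / (2 * M) ^ 2) * (1 / (1 + ((1 + y) / 2) ^ 2)) ≤ 2 * π / (2 * M) ^ 2 := by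
    have h2 : ∫ y in a..b, (1 / (2 * M) ^ 2) * (1 / (1 + ((1 + y) / 2) ^ 2)) =
        (2 / (2 * M) ^ 2) * Real.arctan ((1 + b) / 2) - (2 / (2 * M) ^ 2) * Real.arctan ((1 + a) / 2) := by
      apply intervalIntegral.integral_eq_sub_of_hasDerivAt
        (f := fun y => (2 / (2 * M) ^ 2) * Real.arctan ((1 + y) / 2))
      · intro y _
        refine HasDerivAt.congr_deriv (((((hasDerivAt_id y).const_add 1).div_const 2).arctan).const_mul _) ?_
        simp only [id]; field_simp
      · exact hw.intervalIntegrable _ _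
    rw [h2]
    have q1 := (Real.arctan_lt_pi_div_two ((1 + b) / 2)).le
    have q2 := (Real.neg_pi_div_two_lt_arctan ((1 + a) / 2)).le
    have : (2 / (2 * M) ^ 2) * Real.arctan ((1 + b) / 2) - (2 / (2 * M) ^ 2) * Real.arctan ((1 + a) / 2)
      = (2 / (2 * M) ^ 2) * (Real.arctan ((1 + b) / 2) - Real.arctan ((1 + a) / 2)) := by ring
    rw [this]
    calc _ ≤ (2 / (2 * M) ^ 2) * π := mul_le_mul_of_nonneg_left (by linarith) (by positivity)
      _ = _ := by ring
  have := data_int hM hr hf hc hw hab (l := S) hS0 (fun y _ => by positivity) (fun y hy => by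
      have y0 : 0 < 1 - muS M r y := by linarith [bg_x1 hM hr y]
      have y1 : 1 ≤ (1 - muS M r y)⁻¹ := (one_le_inv₀ y0).2 (by linarith [bg_x0 hM hr y])
      have r0 := hr.1 y
      have yn : y ≤ 0 := hy.2.trans hb
      unfold E0Integrand
      set T := pd_t φ 1 y
      set D := pd_s φ 1 y
      have D0 : 0 < 1 + ((1 + y) / 2) ^ 2 := by positivity
      have e : D ^ 2 = (1 / (2 * M) ^ 2 * (1 / (1 + ((1 + y) / 2) ^ 2))) *
          (((1 + ((1 + y) / 2) ^ 2) * D ^ 2) * (2 * M) ^ 2) := by field_simp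
      rw [e]
      apply mul_le_mul_of_nonneg_left _ (by positivity)
      apply mul_le_mul _ (pow_le_pow_left₀ (by positivity) r0.le 2) (by positivity) (by positivity)
      have q4 : 0 ≤ (1 - muS M r y) * ((1 + y ^ 2) / r y ^ 2) * φ 1 y ^ 2 := by
        have := bg_rpos hM hr y
        positivity
      have q5 : (T - D) ^ 2 ≤ (1 - muS M r y)⁻¹ * (T - D) ^ 2 := le_mul_of_one_le_left (sq_nonneg _) y1
      have q6 : ((1 + y) / 2) ^ 2 * (T - D) ^ 2 ≤ ((1 - y) / 2) ^ 2 * (T - D) ^ 2 :=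
        mul_le_mul_of_nonneg_right (by nlinarith) (sq_nonneg _)
      have q7 := mul_nonneg D0.le (sq_nonneg T)
      have q8 := mul_nonneg D0.le (sq_nonneg D)
      nlinarith) hB hS
  have h2 : ∫ y in a..b, pd_s φ 1 y = φ 1 b - φ 1 a :=
    intervalIntegral.integral_eq_sub_of_hasDerivAt (f := fun y => φ 1 y) (fun y _ => h.ds 1 y)
      (hc.intervalIntegrable _ _)
  rw [← h2]
  refine (intervalIntegral.abs_integral_le_integral_abs hab).trans (this.trans (le_of_eq ?_))
  field_simp
end

section
variable {M : ℝ} {r : ℝ → ℝ}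

/-- the transport quantity along outgoing rays -/
def cF (M : ℝ) (r : ℝ → ℝ) (φ : ℝ → ℝ → ℝ) : ℝ → ℝ → ℝ :=
  fun t s => r s * (pd_t φ t s - pd_s φ t s) - (1 - muS M r s) * φ t s

lemma cF_diag (hM : 0 < M) (hr : IsTortoise M r) {φ : ℝ → ℝ → ℝ} (hφ : IsWaveSol r φ) (x t : ℝ) :
    HasDerivAt (fun t => cF M r φ t (t + x))
      (-(1 / (2 * M) * muS M r (t + x) ^ 2 * (1 - muS M r (t + x)) * φ t (t + x))) t := by
  have h : Sm φ := hφ.1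
  set s := t + x with hs
  have hd : HasDerivAt (fun t : ℝ => t + x) 1 t := (hasDerivAt_id t).add_const x
  have hr1 : HasDerivAt (fun t => r (t + x)) ((1 - muS M r s) * 1) t := (bg_r' hr s).comp t hd
  have hm : HasDerivAt (fun t => muS M r (t + x)) ((-(1 / (2 * M)) * muS M r s ^ 2 * (1 - muS M r s)) * 1) t :=
    HasDerivAt.comp (h₂ := muS M r) t (bg_x' hM hr s) hd
  have h1 := (hr1.mul ((h.pd_t.diag t x).sub (h.pd_s.diag t x))).sub ((hm.const_sub 1).mul (h.diag t x))
  refine HasDerivAt.congr_deriv h1 ?_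
  have h2 : HasDerivAt (fun x => (r x) ^ 2 * pd_s φ t x) _ s :=
    ((bg_r' hr s).pow 2).mul (h.pd_s.ds t s)
  have h3 := hφ.2.1 t s
  rw [h2.deriv] at h3
  have r0 := bg_rpos hM hr s
  have h4 : r s * pd_t (pd_t φ) t s = r s * pd_s (pd_s φ) t s + 2 * (1 - muS M r s) * pd_s φ t s := by
    rw [h3]
    simp only [Pi.pow_apply]
    field_simp
    ring
  rw [h.comm]
  simp only [← hs, Pi.sub_apply]
  linear_combination h4

/-- the outgoing estimate -/
lemma out_est (hM : 0 < M) (hr : IsTortoise M r) {φ : ℝ → ℝ → ℝ} (hφ : IsWaveSol r φ) {W : ℝ → ℝ}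
    (hW0 : ∀ q, 0 < W q) (hW : ∀ q q', q ≤ q' → W q ≤ W q' * Real.exp (1 / (18 * M) * (q' - q)))
    {t s N : ℝ} (ht : 1 ≤ t) (hs : s ≤ 0) (hN : 0 ≤ N)
    (hb : ∀ t' ∈ Set.Icc 1 t, |φ t' (t' + (s - t))| ≤ N * W (t' + (t' + (s - t)))) :
    |r s * (pd_t φ t s - pd_s φ t s)| ≤
      |r (1 + (s - t)) * (pd_t φ 1 (1 + (s - t)) - pd_s φ 1 (1 + (s - t)))|
      + 13 / 2 * N * W (t + s) * (1 - muS M r s) := by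
  set x := s - t with hx
  have y0 : 0 < 1 - muS M r s := by linarith [bg_x1 hM hr s]
  set b : ℝ := 1 / (9 * M) with hb'
  have b0 : 0 < b := by positivity
  have key : ∀ t' ∈ Set.Icc 1 t, (1 - muS M r (t' + x)) * W (t' + (t' + x)) ≤
      (1 - muS M r s) * W (t + s) * Real.exp (-(b * (t - t'))) := by
    intro t' ht'
    have e1 := bg_ymono hM hr (σ := t' + x) (s := s) (by rw [hx]; linarith [ht'.2]) hs
    have e2 := hW (t' + (t' + x)) (t + s) (by rw [hx]; linarith [ht'.2])
    have p0 := hW0 (t' + (t' + x))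
    have := mul_le_mul e1 e2 p0.le (by positivity)
    refine this.trans (le_of_eq ?_)
    have e3 : Real.exp (-(b * (t - t'))) = Real.exp (-(2 / (9 * M) * (s - (t' + x)))) *
        Real.exp (1 / (18 * M) * (t + s - (t' + (t' + x)))) := by
      rw [← Real.exp_add]; congr 1; rw [hb', hx]; field_simp; ring
    rw [e3]; ring
  have h1 := comp_le (f := fun t => cF M r φ t (t + x)) (B := fun t' =>
      9 / 2 * (N * ((1 - muS M r s) * W (t + s))) * Real.exp (-(b * (t - t'))))
    (B' := fun t' => 1 / (2 * M) * (N * ((1 - muS M r s) * W (t + s))) * Real.exp (-(b * (t - t'))))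
    ht (cF_diag hM hr hφ x) (fun t' => by
      refine HasDerivAt.congr_deriv (((((hasDerivAt_id t').const_sub t).const_mul b).neg.exp).const_mul _) ?_
      simp only [id, Pi.neg_apply]; rw [hb']; field_simp) (fun t' ht' => by
      have k1 := key t' ht'
      have k2 := hb t' ht'
      have m0 := bg_x0 hM hr (t' + x)
      have m1 := bg_x1 hM hr (t' + x)
      have z0 : 0 < 1 - muS M r (t' + x) := by linarith
      have mm : muS M r (t' + x) ^ 2 ≤ 1 := by nlinarith
      rw [abs_neg, abs_mul, abs_of_nonneg (by positivity)]
      calc 1 / (2 * M) * muS M r (t' + x) ^ 2 * (1 - muS M r (t' + x)) * |φ t' (t' + x)|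
          ≤ 1 / (2 * M) * 1 * (1 - muS M r (t' + x)) * (N * W (t' + (t' + x))) := by gcongr
        _ = 1 / (2 * M) * N * ((1 - muS M r (t' + x)) * W (t' + (t' + x))) := by ring
        _ ≤ 1 / (2 * M) * N * ((1 - muS M r s) * W (t + s) * Real.exp (-(b * (t - t')))) := by gcongr
        _ = _ := by ring)
  have ts : t + x = s := by rw [hx]; ring
  simp only [ts, sub_self, mul_zero, neg_zero, Real.exp_zero, mul_one] at h1
  have k1 := key 1 ⟨le_rfl, ht⟩
  have k2 := hb 1 ⟨le_rfl, ht⟩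
  have k3 := hb t ⟨ht, le_rfl⟩
  rw [ts] at k3
  have Wp0 := hW0 (t + s)
  have e0 : Real.exp (-(b * (t - 1))) ≤ 1 := by
    rw [Real.exp_le_one_iff]; have := mul_nonneg b0.le (sub_nonneg.2 ht); linarith
  have ep := Real.exp_pos (-(b * (t - 1)))
  have z0 : 0 < 1 - muS M r (1 + x) := by linarith [bg_x1 hM hr (1 + x)]
  have f1 : |(1 - muS M r (1 + x)) * φ 1 (1 + x)| ≤ N * ((1 - muS M r s) * W (t + s)) := by
    rw [abs_mul, abs_of_pos z0]
    calc (1 - muS M r (1 + x)) * |φ 1 (1 + x)| ≤ (1 - muS M r (1 + x)) * (N * W (1 + (1 + x))) := by gcongr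
      _ = N * ((1 - muS M r (1 + x)) * W (1 + (1 + x))) := by ring
      _ ≤ N * ((1 - muS M r s) * W (t + s) * 1) := by
        apply mul_le_mul_of_nonneg_left _ hN
        exact k1.trans (mul_le_mul_of_nonneg_left e0 (by positivity))
      _ = _ := by ring
  have f2 : |(1 - muS M r s) * φ t s| ≤ N * ((1 - muS M r s) * W (t + s)) := by
    rw [abs_mul, abs_of_pos y0]
    calc (1 - muS M r s) * |φ t s| ≤ (1 - muS M r s) * (N * W (t + s)) := by gcongr
      _ = _ := by ring
  have f3 : 0 ≤ 9 / 2 * (N * ((1 - muS M r s) * W (t + s))) * Real.exp (-(b * (t - 1))) := by positivity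
  unfold cF at h1
  set P := r s * (pd_t φ t s - pd_s φ t s)
  set Q := r (1 + x) * (pd_t φ 1 (1 + x) - pd_s φ 1 (1 + x))
  set Z := N * ((1 - muS M r s) * W (t + s)) with hZ
  have e : 13 / 2 * N * W (t + s) * (1 - muS M r s) = 13 / 2 * Z := by rw [hZ]; ring
  rw [e]
  have g1 := abs_le.1 h1
  have g2 := abs_le.1 f1
  have g3 := abs_le.1 f2
  have g4 := le_abs_self Q
  have g5 := neg_abs_le Q
  rw [abs_le]; constructor <;> linarith

/-- the ingoing estimate -/
lemma in_est (hM : 0 < M) (hr : IsTortoise M r) {φ : ℝ → ℝ → ℝ} (h : Sm φ) {q t0 t G : ℝ}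
    (ht : t0 ≤ t) (hG : 0 ≤ G)
    (hb : ∀ τ ∈ Set.Icc t0 t, |r (q - τ) * (pd_t φ τ (q - τ) - pd_s φ τ (q - τ))| ≤
      |r (q + 1 - 2 * τ) * (pd_t φ 1 (q + 1 - 2 * τ) - pd_s φ 1 (q + 1 - 2 * τ))|
      + G * (1 - muS M r (q - τ))) :
    |φ t (q - t) - φ t0 (q - t0)| ≤ 1 / (4 * M) *
      (∫ y in (q + 1 - 2 * t)..(q + 1 - 2 * t0), |r y * (pd_t φ 1 y - pd_s φ 1 y)|)
      + G * (r (q - t0) - r (q - t)) / (2 * M) := by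
  set d : ℝ → ℝ := fun y => |r y * (pd_t φ 1 y - pd_s φ 1 y)| with hd
  have dc : Continuous d := ((bg_r_cd hM hr).continuous.mul
    ((h.pd_t.cont_comp continuous_const continuous_id).sub
      (h.pd_s.cont_comp continuous_const continuous_id))).abs
  have h1 := comp_le (f := fun τ => φ τ (q - τ)) (f' := fun τ => pd_t φ τ (q - τ) - pd_s φ τ (q - τ))
    (B := fun τ => -(1 / (4 * M) * ∫ y in (q + 1 - 2 * t)..(q + 1 - 2 * τ), d y) - G / (2 * M) * r (q - τ))
    (B' := fun τ => 1 / (2 * M) * d (q + 1 - 2 * τ) + G / (2 * M) * (1 - muS M r (q - τ))) ht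
    (fun τ => by
      have k1 := (h.differentiable (τ, q - τ)).hasFDerivAt
      have k2 : HasDerivAt (fun t' : ℝ => (t', q - t')) ((1 : ℝ), (-1 : ℝ)) τ :=
        (hasDerivAt_id τ).prodMk ((hasDerivAt_id τ).const_sub q)
      have k3 := k1.comp_hasDerivAt τ k2
      refine HasDerivAt.congr_deriv k3 ?_
      rw [h.pd_t_eq, h.pd_s_eq, ← map_sub]
      simp)
    (fun τ => by
      have k1 : HasDerivAt (fun x => ∫ y in (q + 1 - 2 * t)..x, d y) (d (q + 1 - 2 * τ)) (q + 1 - 2 * τ) :=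
        intervalIntegral.integral_hasDerivAt_right (dc.intervalIntegrable _ _)
          (dc.stronglyMeasurableAtFilter _ _) dc.continuousAt
      have k2 : HasDerivAt (fun τ : ℝ => q + 1 - 2 * τ) (-(2 * 1)) τ :=
        ((hasDerivAt_id τ).const_mul 2).const_sub (q + 1)
      have k3 : HasDerivAt (fun τ => ∫ y in (q + 1 - 2 * t)..(q + 1 - 2 * τ), d y)
          (d (q + 1 - 2 * τ) * (-(2 * 1))) τ :=
        HasDerivAt.comp (h₂ := fun x => ∫ y in (q + 1 - 2 * t)..x, d y) τ k1 k2
      have k4 : HasDerivAt (fun τ => r (q - τ)) ((1 - muS M r (q - τ)) * (-1)) τ :=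
        (bg_r' hr (q - τ)).comp τ ((hasDerivAt_id τ).const_sub q)
      refine HasDerivAt.congr_deriv (((k3.const_mul (1 / (4 * M))).neg).sub (k4.const_mul (G / (2 * M)))) ?_
      field_simp; ring)
    (fun τ hτ => by
      have k := hb τ hτ
      have r0 := hr.1 (q - τ)
      rw [abs_mul, abs_of_pos (bg_rpos hM hr (q - τ))] at k
      set m := |pd_t φ τ (q - τ) - pd_s φ τ (q - τ)| with hm
      have m0 : 0 ≤ m := abs_nonneg _
      have e : 1 / (2 * M) * d (q + 1 - 2 * τ) + G / (2 * M) * (1 - muS M r (q - τ)) =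
        (d (q + 1 - 2 * τ) + G * (1 - muS M r (q - τ))) / (2 * M) := by field_simp
      rw [e, le_div_iff₀ (by positivity)]
      refine le_trans ?_ k
      nlinarith)
  simp only [intervalIntegral.integral_same] at h1
  refine h1.trans (le_of_eq ?_)
  ring
end

section
variable {M : ℝ} {r : ℝ → ℝ}

/-- closing the characteristic estimates near the horizon -/
lemma horizon (hM : 0 < M) (hr : IsTortoise M r) {s1 : ℝ} (hs1 : s1 ≤ 0)
    (hsm : 13 / 2 * (r s1 - 2 * M) / (2 * M) ≤ 1 / 2) {W : ℝ → ℝ} (hWc : Continuous W)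
    (hW0 : ∀ q, 0 < W q) (hW : ∀ q q', q ≤ q' → W q ≤ W q' * Real.exp (1 / (18 * M) * (q' - q)))
    {K K2 S : ℝ} (hS0 : 0 < S) (hK2 : ∀ q y, y ≤ 0 → y ≤ 1 - q → Real.exp (1 / (9 * M) * y) ≤ K2 * W q)
    {φ : ℝ → ℝ → ℝ} (hφ : IsWaveSol r φ) (hf : FinE0 M r φ) (hS : E0 M r φ ≤ S ^ 2)
    (hi : ∀ s ≤ s1, |φ 1 s| ≤ K * S * W (1 + s)) (hb : ∀ t, 1 ≤ t → |φ t s1| ≤ K * S * W (t + s1))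
    {t s : ℝ} (ht : 1 ≤ t) (hs : s ≤ s1) :
    |φ t s| ≤ 2 * (K + 1 / (4 * M) * (1 / 2 + 9 * M / 4) * K2) * S * W (t + s) := by
  have h : Sm φ := hφ.1
  set U := t - s with hU
  set D : Set (ℝ × ℝ) := {z | 1 ≤ z.1 ∧ z.2 ≤ s1 ∧ z.1 - z.2 ≤ U} with hD
  have Dc : IsCompact D := by
    apply (isCompact_Icc (a := ((1 : ℝ), 1 - U)) (b := (s1 + U, s1))).of_isClosed_subset
    · exact (isClosed_le continuous_const continuous_fst).inter
        ((isClosed_le continuous_snd continuous_const).inter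
          (isClosed_le (continuous_fst.sub continuous_snd) continuous_const))
    · rintro ⟨a, b⟩ ⟨h1, h2, h3⟩
      simp only at h1 h2 h3
      exact ⟨⟨h1, by show 1 - U ≤ b; linarith⟩, ⟨by show a ≤ s1 + U; linarith, h2⟩⟩
  have Dm : (t, s) ∈ D := ⟨ht, hs, le_rfl⟩
  have gc : Continuous (fun z : ℝ × ℝ => |φ z.1 z.2| / W (z.1 + z.2)) :=
    (h.cont_comp continuous_fst continuous_snd).abs.div
      (hWc.comp (continuous_fst.add continuous_snd)) (fun z => (hW0 _).ne')
  obtain ⟨z, hz, hmax⟩ := Dc.exists_isMaxOn ⟨_, Dm⟩ gc.continuousOn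
  obtain ⟨a, b⟩ := z
  obtain ⟨ha, hbs, hab⟩ := hz
  simp only at ha hbs hab
  set N := |φ a b| / W (a + b) with hN
  have N0 : 0 ≤ N := div_nonneg (abs_nonneg _) (hW0 _).le
  have bd : ∀ t s, (t, s) ∈ D → |φ t s| ≤ N * W (t + s) := by
    intro t s hts
    have := hmax hts
    simp only [Set.mem_ofPred_eq] at this
    rwa [← hN, div_le_iff₀ (hW0 _)] at this
  set q := a + b with hq
  set t0 := max 1 (q - s1) with ht0
  have t01 : 1 ≤ t0 := le_max_left _ _
  have t02 : q - s1 ≤ t0 := le_max_right _ _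
  have t0a : t0 ≤ a := max_le ha (by rw [hq]; linarith)
  have G0 : 0 ≤ 13 / 2 * N * W q := mul_nonneg (by positivity) (hW0 _).le
  have h1 := in_est hM hr h (q := q) t0a G0 (fun τ hτ => by
    have k := out_est hM hr hφ hW0 hW (t := τ) (s := q - τ) (N := N) (t01.trans hτ.1)
      (by linarith [hτ.1]) N0 (fun t' ht' => by
        apply bd
        refine ⟨ht'.1, ?_, ?_⟩
        · show t' + (q - τ - τ) ≤ s1
          linarith [ht'.2, hτ.1]
        · show t' - (t' + (q - τ - τ)) ≤ U
          linarith [hτ.2])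
    have e1 : 1 + (q - τ - τ) = q + 1 - 2 * τ := by ring
    have e2 : τ + (q - τ) = q := by ring
    rw [e1, e2] at k
    exact k)
  have h2 := data_u hM hr h hf (a := q + 1 - 2 * a) (b := q + 1 - 2 * t0) (by linarith) (by linarith) hS0 hS
  have h3 := hK2 q (q + 1 - 2 * t0) (by linarith) (by linarith)
  have h4 : |φ t0 (q - t0)| ≤ K * S * W q := by
    rcases max_cases 1 (q - s1) with ⟨e, e'⟩ | ⟨e, e'⟩
    · rw [ht0, e]
      have := hi (q - 1) (by linarith)
      rwa [show 1 + (q - 1) = q by ring] at this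
    · rw [ht0, e]
      have := hb (q - s1) e'.le
      rw [show q - s1 + s1 = q by ring] at this
      rwa [show q - (q - s1) = s1 by ring]
  have h5 : 13 / 2 * N * W q * (r (q - t0) - r (q - a)) / (2 * M) ≤ N * W q * (1 / 2) := by
    have m1 : r (q - t0) ≤ r s1 := (bg_mono hM hr).monotone (by linarith)
    have m2 := hr.1 (q - a)
    calc 13 / 2 * N * W q * (r (q - t0) - r (q - a)) / (2 * M)
        ≤ 13 / 2 * N * W q * (r s1 - 2 * M) / (2 * M) := by gcongr
      _ = N * W q * (13 / 2 * (r s1 - 2 * M) / (2 * M)) := by ring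
      _ ≤ _ := mul_le_mul_of_nonneg_left hsm (mul_nonneg N0 (hW0 _).le)
  have h6 : 1 / (4 * M) * (∫ y in (q + 1 - 2 * a)..(q + 1 - 2 * t0), |r y * (pd_t φ 1 y - pd_s φ 1 y)|)
      ≤ 1 / (4 * M) * (S * (1 / 2 + 9 * M / 4) * (K2 * W q)) := by
    apply mul_le_mul_of_nonneg_left _ (by positivity)
    exact h2.trans (mul_le_mul_of_nonneg_left h3 (by positivity))
  have h7 : |φ a b| = N * W q := by rw [hN, div_mul_cancel₀ _ (hW0 _).ne']
  rw [show q - a = b by rw [hq]; ring] at h1 h5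
  have h8 : |φ a b| ≤ |φ a b - φ t0 (q - t0)| + |φ t0 (q - t0)| := by
    have := abs_add_le (φ a b - φ t0 (q - t0)) (φ t0 (q - t0))
    rwa [sub_add_cancel] at this
  have h9 : N ≤ 2 * (K + 1 / (4 * M) * (1 / 2 + 9 * M / 4) * K2) * S := by
    have hw := hW0 q
    have : N * W q ≤ 2 * (K + 1 / (4 * M) * (1 / 2 + 9 * M / 4) * K2) * S * W q := by
      have e : 2 * (K + 1 / (4 * M) * (1 / 2 + 9 * M / 4) * K2) * S * W q = 2 * (K * S * W q) +
        2 * (1 / (4 * M) * (S * (1 / 2 + 9 * M / 4) * (K2 * W q))) := by ring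
      rw [e]; linarith
    exact le_of_mul_le_mul_right this hw
  exact (bd t s Dm).trans (mul_le_mul_of_nonneg_right h9 (hW0 _).le)

/-- the weight -/
def Wt (A p q : ℝ) : ℝ := (max q 0 + A) ^ (-p)

lemma Wt_pos {A p : ℝ} (hA : 0 < A) (q : ℝ) : 0 < Wt A p q :=
  rpow_pos_of_pos (by have := le_max_right q 0; linarith) _

lemma Wt_cont {A p : ℝ} (hA : 0 < A) : Continuous (Wt A p) := by
  unfold Wt
  refine Continuous.rpow_const (by fun_prop) (fun q => Or.inl ?_)
  have := le_max_right q 0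
  positivity

lemma Wt_slow {A p c : ℝ} (hA : 0 < A) (hp : 0 ≤ p) (hc : p ≤ c * A) {q q' : ℝ} (h : q ≤ q') :
    Wt A p q ≤ Wt A p q' * Real.exp (c * (q' - q)) := by
  have m0 := le_max_right q 0
  have m0' := le_max_right q' 0
  have h1 : max q' 0 + A ≤ (max q 0 + A) * Real.exp ((q' - q) / A) := by
    have e := Real.add_one_le_exp ((q' - q) / A)
    have m1 : max q' 0 ≤ max q 0 + (q' - q) :=
      max_le (by linarith [le_max_left q 0]) (by linarith)
    have d0 : 0 ≤ (q' - q) / A := div_nonneg (by linarith) hA.le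
    have d1 : (q' - q) / A * A = q' - q := div_mul_cancel₀ _ hA.ne'
    have : (max q 0 + A) * ((q' - q) / A + 1) ≤ (max q 0 + A) * Real.exp ((q' - q) / A) :=
      mul_le_mul_of_nonneg_left e (by positivity)
    nlinarith [mul_nonneg m0 d0]
  have P : 0 < max q 0 + A := by linarith
  have P' : 0 < max q' 0 + A := by linarith
  unfold Wt
  rw [rpow_neg P.le, rpow_neg P'.le]
  have h2 : (max q' 0 + A) ^ p ≤ (max q 0 + A) ^ p * Real.exp (c * (q' - q)) := by
    refine (rpow_le_rpow P'.le h1 hp).trans ?_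
    rw [mul_rpow P.le (Real.exp_pos _).le, ← Real.exp_mul]
    apply mul_le_mul_of_nonneg_left _ (rpow_pos_of_pos P _).le
    apply Real.exp_le_exp.2
    have : (q' - q) / A * p ≤ (q' - q) / A * (c * A) :=
      mul_le_mul_of_nonneg_left hc (div_nonneg (by linarith) hA.le)
    have e : (q' - q) / A * (c * A) = c * (q' - q) := by field_simp
    linarith
  have Q := rpow_pos_of_pos P p
  have Q' := rpow_pos_of_pos P' p
  rw [inv_mul_eq_div, inv_eq_one_div, div_le_div_iff₀ Q Q']
  linarith

end

section
variable {M : ℝ} {r : ℝ → ℝ}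

lemma rpow_lb {p x c y : ℝ} (hp : 0 ≤ p) (hx : 0 < x) (hc : 0 < c) (hy : 0 < y) (h : y ≤ x * c) :
    x ^ (-p) ≤ c ^ p * y ^ (-p) := by
  have h1 : (x * c) ^ (-p) ≤ y ^ (-p) := rpow_le_rpow_of_nonpos hy h (by linarith)
  have h2 : x ^ (-p) = c ^ p * (x * c) ^ (-p) := by
    rw [mul_rpow hx.le hc.le, rpow_neg hc.le p]
    have := (rpow_pos_of_pos hc p).ne'
    field_simp
  rw [h2]
  exact mul_le_mul_of_nonneg_left h1 (rpow_pos_of_pos hc p).le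

lemma E0_le_E2 (hM : 0 < M) (hr : IsTortoise M r) (φ : ℝ → ℝ → ℝ) : E0 M r φ ≤ E2 M r φ := by
  have h1 := E1_le_E2 hM hr φ
  have h2 := E0_nonneg hM hr (Svf φ)
  have h3 := E0_nonneg hM hr (pd_t φ)
  unfold E1 at h1
  linarith

set_option maxHeartbeats 1000000 in
/-- decay up to the horizon, with a slightly larger energy -/
lemma decay_aux (hM : 0 < M) (hr : IsTortoise M r) {δ R : ℝ} (hδ0 : 0 < δ) (hδ1 : δ < 1)
    (hR : 2 * M < R) :
    ∃ C, 0 < C ∧ ∀ φ, IsWaveSol r φ → FinE2 M r φ → ∀ S, 0 < S → Real.sqrt (E2 M r φ) ≤ S →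
      ∀ t s, 1 ≤ t → r s ≤ R → |φ t s| ≤ C * (max ((t + s) / 2) 1) ^ (-(3 : ℝ) / 2 + δ) * S := by
  set p : ℝ := 3 / 2 - δ with hp
  have p0 : 0 ≤ p := by linarith
  have ep : -(3 : ℝ) / 2 + δ = -p := by rw [hp]; ring
  rw [ep]
  -- thresholds
  set sR : ℝ := 3 * R with hsR
  have sR0 : 0 < sR := by linarith
  have hRs : ∀ s, r s ≤ R → s ≤ sR := by
    intro s hs
    by_contra hc
    have hc' := not_le.1 hc
    have := bg_low hM hr (s := s) (by linarith)
    linarith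
  set s1 : ℝ := -(9 * M / 2 * Real.log 20) with hs1
  have l20 : 0 < Real.log 20 := Real.log_pos (by norm_num)
  have s10 : s1 ≤ 0 := by
    have : 0 ≤ 9 * M / 2 * Real.log 20 := by positivity
    linarith
  have hsm : 13 / 2 * (r s1 - 2 * M) / (2 * M) ≤ 1 / 2 := by
    have h1 := bg_y hM hr s10
    have e : 2 / (9 * M) * s1 = -Real.log 20 := by rw [hs1]; field_simp
    rw [e, Real.exp_neg, Real.exp_log (by norm_num)] at h1
    have h2 := bg_r hM hr s1
    have h3 : r s1 ≤ 3 * M := by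
      have := (bg_mono hM hr).monotone s10
      rwa [hr.2.2] at this
    have h0 := bg_rpos hM hr s1
    rw [div_le_iff₀ (by positivity)]
    have e2 : r s1 - 2 * M = r s1 * (1 - muS M r s1) := by linarith
    have h4 : r s1 * (1 - muS M r s1) ≤ 3 * M * 20⁻¹ :=
      mul_le_mul h3 h1 (by linarith [bg_x1 hM hr s1]) (by positivity)
    rw [e2]; linarith
  obtain ⟨C1, C10, hC1⟩ := compact_decay hM hr hδ0 hδ1 (sa := s1 - 1) (sb := sR + 3) (by linarith)
  rw [ep] at hC1
  -- the weight
  set A : ℝ := max 1 (18 * M * p) with hA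
  have A1 : 1 ≤ A := le_max_left _ _
  have A0 : 0 < A := by linarith
  have Ap : p ≤ 1 / (18 * M) * A := by
    have : 18 * M * p ≤ A := le_max_right _ _
    rw [one_div_mul_eq_div, le_div_iff₀ (by positivity)]
    linarith
  have hWs : ∀ q q', q ≤ q' → Wt A p q ≤ Wt A p q' * Real.exp (1 / (18 * M) * (q' - q)) :=
    fun q q' h => Wt_slow A0 p0 Ap h
  set K2 : ℝ := Real.exp (1 / (9 * M)) / Wt A p 0 with hK2
  have K20 : 0 < K2 := div_pos (Real.exp_pos _) (Wt_pos A0 0)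
  have hK2' : ∀ q y, y ≤ 0 → y ≤ 1 - q → Real.exp (1 / (9 * M) * y) ≤ K2 * Wt A p q := by
    intro q y h1 h2
    have w0 : 0 < Wt A p 0 := Wt_pos A0 0
    have m0 := le_max_right q 0
    have e : Wt A p q = Wt A p (max q 0) := by unfold Wt; rw [max_eq_left m0]
    have h3 := hWs 0 (max q 0) m0
    rw [← e] at h3
    have hy : y ≤ 1 - max q 0 := by
      have : max q 0 ≤ 1 - y := max_le (by linarith) (by linarith)
      linarith
    have wq := Wt_pos (p := p) A0 q
    have h4 : Real.exp (1 / (9 * M) * y) * Real.exp (1 / (18 * M) * (max q 0 - 0)) ≤ Real.exp (1 / (9 * M)) := by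
      rw [← Real.exp_add]
      apply Real.exp_le_exp.2
      have b0 : 0 < 1 / (18 * M) := by positivity
      have e9 : 1 / (9 * M) = 2 * (1 / (18 * M)) := by field_simp; norm_num
      rw [e9]
      nlinarith
    rw [hK2, div_mul_eq_mul_div (Real.exp (1 / (9 * M))), le_div_iff₀ w0]
    calc Real.exp (1 / (9 * M) * y) * Wt A p 0
        ≤ Real.exp (1 / (9 * M) * y) * (Wt A p q * Real.exp (1 / (18 * M) * (max q 0 - 0))) := by gcongr
      _ = Real.exp (1 / (9 * M) * y) * Real.exp (1 / (18 * M) * (max q 0 - 0)) * Wt A p q := by ring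
      _ ≤ _ := by gcongr
  have Wlb : ∀ x q, 1 ≤ x → q ≤ x → x ^ (-p) ≤ (1 + A) ^ p * Wt A p q := by
    intro x q hx hq
    have m0 := le_max_right q 0
    have m1 : max q 0 ≤ x := max_le hq (by linarith)
    exact rpow_lb p0 (by linarith) (by linarith) (by linarith) (by nlinarith)
  set K0 : ℝ := (1 + 2 * π / (2 * M) ^ 2) / 2 with hK0
  have K00 : 0 < K0 := by positivity
  set K : ℝ := (C1 + K0) * (1 + A) ^ p with hK
  have P0 : 0 < (1 + A) ^ p := rpow_pos_of_pos (by linarith) _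
  have K0' : 0 < K := by positivity
  set C2 := 2 * (K + 1 / (4 * M) * (1 / 2 + 9 * M / 4) * K2) with hC2
  have C20 : 0 < C2 := by positivity
  have Q0 : 0 < (1 + sR) ^ p := rpow_pos_of_pos (by linarith) _
  refine ⟨C2 + C1 * (1 + sR) ^ p, by positivity, ?_⟩
  intro φ hφ hf S hS0 hS t s ht hrs
  set v := max ((t + s) / 2) 1 with hv
  have v1 : 1 ≤ v := le_max_right _ _
  have V0 : 0 < v ^ (-p) := rpow_pos_of_pos (by linarith) _
  have E20 : 0 ≤ E2 M r φ := (E0_nonneg hM hr φ).trans (E0_le_E2 hM hr φ)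
  have hE : E0 M r φ ≤ S ^ 2 := by
    refine (E0_le_E2 hM hr φ).trans ?_
    rw [← Real.sq_sqrt E20]
    exact pow_le_pow_left₀ (Real.sqrt_nonneg _) hS 2
  have hcd : ∀ t s, 1 ≤ t → s1 ≤ s → s ≤ sR → |φ t s| ≤ C1 * t ^ (-p) * S := by
    intro t s ht h1 h2
    have tp : 0 < t ^ (-p) := rpow_pos_of_pos (by linarith) _
    refine (hC1 φ hφ hf t s ht ⟨by linarith, by linarith⟩).trans ?_
    exact mul_le_mul_of_nonneg_left hS (by positivity)
  rcases le_total s s1 with hs | hs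
  · have h1 := horizon hM hr s10 hsm (Wt_cont A0) (Wt_pos A0) hWs (K := K) hS0 hK2' hφ hf.1.2.1 hE
      (fun s hs => by
        have k1 := data_0 hM hr hφ.1 hf.1.2.1 hs s10 hS0 hE
        have k2 := hcd 1 s1 le_rfl le_rfl (by linarith)
        rw [one_rpow] at k2
        have k3 := Wlb 1 (1 + s) le_rfl (by linarith)
        rw [one_rpow] at k3
        have k4 : |φ 1 s| ≤ (C1 + K0) * S := by
          have e : S * (1 + 2 * π / (2 * M) ^ 2) / 2 = K0 * S := by rw [hK0]; ring
          rw [e] at k1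
          have a1 := abs_le.1 k1
          have a2 := abs_le.1 k2
          rw [abs_le]; constructor <;> linarith
        calc |φ 1 s| ≤ (C1 + K0) * S * 1 := by linarith
          _ ≤ (C1 + K0) * S * ((1 + A) ^ p * Wt A p (1 + s)) := by gcongr
          _ = _ := by rw [hK]; ring)
      (fun t ht => by
        have k2 := hcd t s1 ht le_rfl (by linarith)
        have k3 := Wlb t (t + s1) ht (by linarith)
        have w0 := Wt_pos (p := p) A0 (t + s1)
        calc |φ t s1| ≤ C1 * t ^ (-p) * S := k2
          _ ≤ (C1 + K0) * ((1 + A) ^ p * Wt A p (t + s1)) * S := by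
            gcongr
            linarith
          _ = _ := by rw [hK]; ring) ht hs
    have h2 : Wt A p (t + s) ≤ v ^ (-p) := by
      unfold Wt
      apply rpow_le_rpow_of_nonpos (by linarith) _ (by linarith)
      have m0 := le_max_right (t + s) 0
      have m1 := le_max_left (t + s) 0
      exact max_le (by linarith) (by linarith)
    calc |φ t s| ≤ C2 * S * Wt A p (t + s) := h1
      _ ≤ C2 * S * v ^ (-p) := by gcongr
      _ = C2 * v ^ (-p) * S := by ring
      _ ≤ _ := by
        gcongr
        have : 0 ≤ C1 * (1 + sR) ^ p := by positivity
        linarith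
  · have hsr := hRs s hrs
    have h1 := hcd t s ht hs hsr
    have h2 : t ^ (-p) ≤ (1 + sR) ^ p * v ^ (-p) := by
      apply rpow_lb p0 (by linarith) (by linarith) (by linarith)
      have k := mul_le_mul_of_nonneg_right ht sR0.le
      have e : t * (1 + sR) = t + t * sR := by ring
      rw [e]
      apply max_le <;> linarith
    calc |φ t s| ≤ C1 * t ^ (-p) * S := h1
      _ ≤ C1 * ((1 + sR) ^ p * v ^ (-p)) * S := by gcongr
      _ = C1 * (1 + sR) ^ p * v ^ (-p) * S := by ring
      _ ≤ _ := by
        gcongr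
        linarith

end

/-- Main Theorem 1, part 1 (spherically symmetric case): pointwise decay
`|φ| ≤ C v₊^{-3/2+δ} E₂(φ)^{1/2}` in any region `r ≤ R`, including along the event
horizon. -/
theorem pointwise_decay_of_phi
    (M : ℝ) (hM : 0 < M) (r : ℝ → ℝ) (hr : IsTortoise M r)
    (δ R : ℝ) (hδ0 : 0 < δ) (hδ1 : δ < 1) (hR : 2 * M < R) :
    ∃ C : ℝ, 0 < C ∧
      ∀ φ : ℝ → ℝ → ℝ, IsWaveSol r φ → FinE2 M r φ →
        ∀ t s : ℝ, 1 ≤ t → r s ≤ R →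
          |φ t s| ≤ C * (max ((t + s) / 2) 1) ^ (-(3 : ℝ) / 2 + δ)
              * Real.sqrt (E2 M r φ) := by
  obtain ⟨C, C0, hC⟩ := decay_aux hM hr hδ0 hδ1 hR
  refine ⟨C, C0, fun φ hφ hf t s ht hs => ?_⟩
  have V0 : 0 < (max ((t + s) / 2) 1) ^ (-(3 : ℝ) / 2 + δ) :=
    rpow_pos_of_pos (by have := le_max_right ((t + s) / 2) 1; linarith) _
  set V := (max ((t + s) / 2) 1) ^ (-(3 : ℝ) / 2 + δ) with hV
  apply le_of_forall_pos_le_add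
  intro η hη
  have h0 := Real.sqrt_nonneg (E2 M r φ)
  have hq : 0 < η / (C * V) := by positivity
  have h1 := hC φ hφ hf (Real.sqrt (E2 M r φ) + η / (C * V)) (by linarith) (by linarith) t s ht hs
  rw [← hV, mul_add, mul_div_cancel₀ _ (by positivity : C * V ≠ 0)] at h1
  exact h1
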